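/- arXiv:2304.09417 — 12 statements merged into one kernel-verified Lean document; each statement's English description precedes it below -/
import Mathlib

section
/- Let γ_a(s) := inf{γ > 0 : ∫₀¹ ((φ^γ)^{-1}(t))^s / V(a, (φ^γ)^{-1}(t)) dt < ∞} for s ≥ 0, for a fixed point a ∈ M. Then the function s ↦ γ_a(s) is nonincreasing and Lipschitz continuous on [0,∞); moreover there exists a constant s₀ > 0 such that γ_a(s) = 0 for every s ≥ s₀, and 0 < γ_a(s₂) < γ_a(s₁) whenever 0 ≤ s₁ < s₂ < s₀. -/
open MeasureTheory Set

lemma setLIntegral_ofReal_lt_top_of_le {s : Set ℝ} (hs : MeasurableSet s) {f g : ℝ → ℝ} (C : ℝ)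
    (hC : 0 ≤ C) (h : ∀ t ∈ s, f t ≤ C * g t)
    (hg : ∫⁻ t in s, ENNReal.ofReal (g t) < ⊤) :
    ∫⁻ t in s, ENNReal.ofReal (f t) < ⊤ := by
  have h1 : ∫⁻ t in s, ENNReal.ofReal (f t) ≤
      ∫⁻ t in s, ENNReal.ofReal C * ENNReal.ofReal (g t) := by
    refine setLIntegral_mono' hs fun t ht => ?_
    rw [← ENNReal.ofReal_mul hC]
    exact ENNReal.ofReal_le_ofReal (h t ht)
  rw [lintegral_const_mul' _ _ ENNReal.ofReal_ne_top] at h1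
  exact h1.trans_lt (ENNReal.mul_lt_top ENNReal.ofReal_lt_top hg)

lemma setLIntegral_Ioo_rpow_lt_top_iff (b : ℝ) :
    ∫⁻ t in Ioo (0 : ℝ) 1, ENNReal.ofReal (t ^ b) < ⊤ ↔ -1 < b := by
  rw [← intervalIntegral.integrableOn_Ioo_rpow_iff (zero_lt_one : (0 : ℝ) < 1), IntegrableOn,
    ← hasFiniteIntegral_iff_ofReal]
  · exact ⟨fun h => ⟨(measurable_id.pow_const b).aestronglyMeasurable, h⟩, fun h => h.2⟩
  · filter_upwards [ae_restrict_mem measurableSet_Ioo] with t ht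
    exact Real.rpow_nonneg ht.1.le b

/-- The substitution `t = τ ^ γ` on the unit interval. -/
lemma setLIntegral_Ioo_comp_rpow_lt_top_iff {γ : ℝ} (hγ : 0 < γ) (f : ℝ → ℝ) :
    ∫⁻ t in Ioo (0 : ℝ) 1, ENNReal.ofReal (f (t ^ (1 / γ))) < ⊤ ↔
      ∫⁻ t in Ioo (0 : ℝ) 1, ENNReal.ofReal (t ^ (γ - 1) * f t) < ⊤ := by
  have himage : (fun t : ℝ => t ^ γ) '' Ioo 0 1 = Ioo 0 1 := by
    ext t
    constructor
    · rintro ⟨x, hx, rfl⟩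
      exact ⟨Real.rpow_pos_of_pos hx.1 γ, Real.rpow_lt_one hx.1.le hx.2 hγ⟩
    · intro ht
      refine ⟨t ^ γ⁻¹, ⟨Real.rpow_pos_of_pos ht.1 _,
        Real.rpow_lt_one ht.1.le ht.2 (inv_pos.2 hγ)⟩, Real.rpow_inv_rpow ht.1.le hγ.ne'⟩
  have hinj : InjOn (fun t : ℝ => t ^ γ) (Ioo 0 1) := fun x hx y hy hxy =>
    (Real.rpow_left_inj hx.1.le hy.1.le hγ.ne').1 hxy
  have hchange := lintegral_image_eq_lintegral_abs_deriv_mul measurableSet_Ioo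
    (fun x (hx : x ∈ Ioo (0 : ℝ) 1) =>
      (Real.hasDerivAt_rpow_const (p := γ) (Or.inl hx.1.ne')).hasDerivWithinAt) hinj
    (fun t => ENNReal.ofReal (f (t ^ (1 / γ))))
  rw [himage] at hchange
  have hsimp : ∫⁻ t in Ioo (0 : ℝ) 1, ENNReal.ofReal |γ * t ^ (γ - 1)| *
      ENNReal.ofReal (f ((t ^ γ) ^ (1 / γ))) =
      ∫⁻ t in Ioo (0 : ℝ) 1, ENNReal.ofReal γ * ENNReal.ofReal (t ^ (γ - 1) * f t) := by
    refine setLIntegral_congr_fun measurableSet_Ioo fun t ht => ?_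
    have hpow : (0 : ℝ) ≤ t ^ (γ - 1) := Real.rpow_nonneg ht.1.le _
    rw [one_div, Real.rpow_rpow_inv ht.1.le hγ.ne', abs_of_nonneg (mul_nonneg hγ.le hpow),
      ENNReal.ofReal_mul hγ.le, ENNReal.ofReal_mul hpow, mul_assoc]
  rw [hchange, hsimp, lintegral_const_mul' _ _ ENNReal.ofReal_ne_top, ENNReal.mul_lt_top_iff]
  have : ENNReal.ofReal γ ≠ 0 := by simpa using hγ
  constructor
  · rintro (h | h | h)
    · exact h.2
    · exact absurd h this
    · simp [h]
  · exact fun h => Or.inl ⟨ENNReal.ofReal_lt_top, h⟩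

/-- Critical exponents of a family of sets `S s` of positive reals, shifted by the index at a rate
between `q` and `p`. -/
lemma sInf_critical_exponent {P : ℝ → ℝ → Prop} {p q D E : ℝ} {g : ℝ → ℝ}
    (hp : 0 < p) (hq : 0 < q) (hD : 0 < D) (hE : 0 < E)
    (hg : ∀ s, g s = sInf {γ : ℝ | 0 < γ ∧ P γ s})
    (hup : ∀ γ γ' s δ, 0 ≤ δ → γ ≤ γ' + q * δ → P γ s → P γ' (s + δ))
    (hdown : ∀ γ s δ, 0 ≤ δ → P γ (s + δ) → P (γ + p * δ) s)
    (hfin : ∀ γ, 0 < γ → P γ D) (hinf : ∀ γ, P γ 0 → E < γ) :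
    (∀ s₁ s₂ : ℝ, 0 ≤ s₁ → s₁ ≤ s₂ → g s₂ ≤ g s₁) ∧
    (∃ K : ℝ, 0 < K ∧ ∀ s₁ s₂ : ℝ, 0 ≤ s₁ → 0 ≤ s₂ → |g s₁ - g s₂| ≤ K * |s₁ - s₂|) ∧
    (∃ s₀ : ℝ, 0 < s₀ ∧ (∀ s : ℝ, s₀ ≤ s → g s = 0) ∧
      (∀ s₁ s₂ : ℝ, 0 ≤ s₁ → s₁ < s₂ → s₂ < s₀ → 0 < g s₂ ∧ g s₂ < g s₁)) := by
  have hbdd : ∀ s, BddBelow {γ : ℝ | 0 < γ ∧ P γ s} := fun s => ⟨0, fun γ h => h.1.le⟩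
  have hne : ∀ s, 0 ≤ s → {γ : ℝ | 0 < γ ∧ P γ s}.Nonempty := by
    intro s hs
    have h0 : P (1 + p * D) 0 := hdown 1 0 D hD.le (by simpa using hfin 1 one_pos)
    have hs' : P (1 + p * D) (0 + s) := hup _ _ 0 s hs (by nlinarith [mul_nonneg hq.le hs]) h0
    exact ⟨1 + p * D, by positivity, by simpa using hs'⟩
  have hnonneg : ∀ s, 0 ≤ g s := fun s => hg s ▸ Real.sInf_nonneg fun γ h => h.1.le
  have hdecr : ∀ s₁ s₂, 0 ≤ s₁ → s₁ ≤ s₂ → g s₂ ≤ max (g s₁ - q * (s₂ - s₁)) 0 := by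
    intro s₁ s₂ h1 h12
    refine le_of_forall_pos_le_add fun ε hε => ?_
    obtain ⟨γ, ⟨_, hγ⟩, hlt⟩ := exists_lt_of_csInf_lt (hne s₁ h1)
      (lt_add_of_pos_right _ hε)
    rw [← hg s₁] at hlt
    rw [hg s₂]
    refine csInf_le (hbdd s₂) ⟨by positivity, ?_⟩
    have := hup γ (max (g s₁ - q * (s₂ - s₁)) 0 + ε) s₁ (s₂ - s₁) (by linarith)
      (by linarith [le_max_left (g s₁ - q * (s₂ - s₁)) 0]) hγ
    simpa using this
  have hanti : ∀ s₁ s₂, 0 ≤ s₁ → s₁ ≤ s₂ → g s₂ ≤ g s₁ := fun s₁ s₂ h1 h12 =>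
    (hdecr s₁ s₂ h1 h12).trans
      (max_le (by nlinarith [mul_nonneg hq.le (sub_nonneg.2 h12)]) (hnonneg s₁))
  have hlip : ∀ s₁ s₂, 0 ≤ s₁ → s₁ ≤ s₂ → g s₁ ≤ g s₂ + p * (s₂ - s₁) := by
    intro s₁ s₂ h1 h12
    rw [← sub_le_iff_le_add, hg s₂]
    refine le_csInf (hne s₂ (h1.trans h12)) fun γ hγ => ?_
    have hδ := sub_nonneg.2 h12
    rw [sub_le_iff_le_add, hg s₁]
    exact csInf_le (hbdd s₁) ⟨by have := hγ.1; positivity,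
      hdown γ s₁ (s₂ - s₁) hδ (by simpa using hγ.2)⟩
  have hgD : g D = 0 := by
    refine le_antisymm (le_of_forall_pos_le_add fun ε hε => ?_) (hnonneg D)
    rw [hg D, zero_add]
    exact csInf_le (hbdd D) ⟨hε, hfin ε hε⟩
  have hg0 : E ≤ g 0 := by
    rw [hg 0]
    exact le_csInf (hne 0 le_rfl) fun γ hγ => (hinf γ hγ.2).le
  refine ⟨hanti, ⟨p, hp, ?_⟩, ?_⟩
  · have aux : ∀ s₁ s₂, 0 ≤ s₁ → s₁ ≤ s₂ → |g s₁ - g s₂| ≤ p * |s₁ - s₂| := by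
      intro s₁ s₂ h1 h12
      rw [abs_of_nonneg (sub_nonneg.2 (hanti s₁ s₂ h1 h12)), abs_sub_comm,
        abs_of_nonneg (sub_nonneg.2 h12)]
      linarith [hlip s₁ s₂ h1 h12]
    intro s₁ s₂ h1 h2
    rcases le_total s₁ s₂ with h | h
    · exact aux s₁ s₂ h1 h
    · rw [abs_sub_comm, abs_sub_comm s₁]
      exact aux s₂ s₁ h2 h
  · set Z : Set ℝ := {s | 0 ≤ s ∧ g s = 0} with hZ
    have hZne : Z.Nonempty := ⟨D, hD.le, hgD⟩
    have hZbdd : BddBelow Z := ⟨0, fun s hs => hs.1⟩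
    have hZle : 0 ≤ sInf Z := Real.sInf_nonneg fun s hs => hs.1
    have hgZ : g (sInf Z) = 0 := by
      refine le_antisymm (le_of_forall_pos_le_add fun ε hε => ?_) (hnonneg _)
      obtain ⟨s, hs, hlt⟩ := exists_lt_of_csInf_lt hZne
        (lt_add_of_pos_right (sInf Z) (div_pos hε hp))
      have h1 := hlip (sInf Z) s hZle (csInf_le hZbdd hs)
      have h2 : p * (s - sInf Z) ≤ p * (ε / p) := by gcongr; linarith
      rw [mul_div_cancel₀ _ hp.ne'] at h2
      linarith [hs.2]
    refine ⟨sInf Z, hZle.lt_of_ne fun h => ?_, fun s hs => ?_, fun s₁ s₂ h1 h12 h2 => ?_⟩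
    · rw [← h] at hgZ
      linarith
    · exact le_antisymm (hgZ ▸ hanti _ s hZle hs) (hnonneg s)
    · have hpos : 0 < g s₂ := (hnonneg s₂).lt_of_ne fun h =>
        (csInf_le hZbdd ⟨h1.trans h12.le, h.symm⟩).not_gt h2
      refine ⟨hpos, ?_⟩
      rcases le_max_iff.1 (hdecr s₁ s₂ h1 h12.le) with h | h
      · nlinarith [mul_pos hq (sub_pos.2 h12)]
      · linarith

lemma critical_exponent_of_power_bounds {u W g : ℝ → ℝ} {A B p q A' B' d₁ d₂ : ℝ}
    (hA : 0 < A) (hB : 0 < B) (hp : 0 < p) (hq : 0 < q) (hA' : 0 < A') (hB' : 0 < B')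
    (hd₁ : 0 < d₁) (hd₂ : 0 < d₂)
    (hul : ∀ t ∈ Ioo (0 : ℝ) 1, A * t ^ p ≤ u t) (huu : ∀ t ∈ Ioo (0 : ℝ) 1, u t ≤ B * t ^ q)
    (hWl : ∀ t ∈ Ioo (0 : ℝ) 1, A' * u t ^ d₂ ≤ W t)
    (hWu : ∀ t ∈ Ioo (0 : ℝ) 1, W t ≤ B' * u t ^ d₁)
    (hg : ∀ s, g s = sInf {γ : ℝ | 0 < γ ∧
      (∫⁻ t in Ioo (0 : ℝ) 1, ENNReal.ofReal (u (t ^ (1 / γ)) ^ s / W (t ^ (1 / γ)))) < ⊤}) :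
    (∀ s₁ s₂ : ℝ, 0 ≤ s₁ → s₁ ≤ s₂ → g s₂ ≤ g s₁) ∧
    (∃ K : ℝ, 0 < K ∧ ∀ s₁ s₂ : ℝ, 0 ≤ s₁ → 0 ≤ s₂ → |g s₁ - g s₂| ≤ K * |s₁ - s₂|) ∧
    (∃ s₀ : ℝ, 0 < s₀ ∧ (∀ s : ℝ, s₀ ≤ s → g s = 0) ∧
      (∀ s₁ s₂ : ℝ, 0 ≤ s₁ → s₁ < s₂ → s₂ < s₀ → 0 < g s₂ ∧ g s₂ < g s₁)) := by
  have hu : ∀ t ∈ Ioo (0 : ℝ) 1, 0 < u t := fun t ht =>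
    (mul_pos hA (Real.rpow_pos_of_pos ht.1 p)).trans_le (hul t ht)
  have hW : ∀ t ∈ Ioo (0 : ℝ) 1, 0 < W t := fun t ht =>
    (mul_pos hA' (Real.rpow_pos_of_pos (hu t ht) d₂)).trans_le (hWl t ht)
  have hup : ∀ γ γ' s δ : ℝ, 0 ≤ δ → γ ≤ γ' + q * δ →
      ∫⁻ t in Ioo (0 : ℝ) 1, ENNReal.ofReal (t ^ (γ - 1) * (u t ^ s / W t)) < ⊤ →
      ∫⁻ t in Ioo (0 : ℝ) 1, ENNReal.ofReal (t ^ (γ' - 1) * (u t ^ (s + δ) / W t)) < ⊤ := by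
    intro γ γ' s δ hδ hγ
    refine setLIntegral_ofReal_lt_top_of_le measurableSet_Ioo (B ^ δ) (by positivity)
      fun t ht => ?_
    have hut := hu t ht
    have hWt := hW t ht
    have ht0 := ht.1
    calc t ^ (γ' - 1) * (u t ^ (s + δ) / W t)
        = t ^ (γ' - 1) * u t ^ δ * (u t ^ s / W t) := by rw [Real.rpow_add hut]; ring
      _ ≤ t ^ (γ' - 1) * (B * t ^ q) ^ δ * (u t ^ s / W t) := by
        gcongr
        exact huu t ht
      _ = B ^ δ * (t ^ (γ' - 1 + q * δ) * (u t ^ s / W t)) := by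
        rw [Real.mul_rpow hB.le (by positivity), ← Real.rpow_mul ht0.le, Real.rpow_add ht0]
        ring
      _ ≤ B ^ δ * (t ^ (γ - 1) * (u t ^ s / W t)) := by
        have := Real.rpow_le_rpow_of_exponent_ge ht0 ht.2.le
          (show γ - 1 ≤ γ' - 1 + q * δ by linarith)
        gcongr
  have hdown : ∀ γ s δ : ℝ, 0 ≤ δ →
      ∫⁻ t in Ioo (0 : ℝ) 1, ENNReal.ofReal (t ^ (γ - 1) * (u t ^ (s + δ) / W t)) < ⊤ →
      ∫⁻ t in Ioo (0 : ℝ) 1, ENNReal.ofReal (t ^ (γ + p * δ - 1) * (u t ^ s / W t)) < ⊤ := by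
    intro γ s δ hδ
    refine setLIntegral_ofReal_lt_top_of_le measurableSet_Ioo ((A ^ δ)⁻¹) (by positivity)
      fun t ht => ?_
    have hut := hu t ht
    have hWt := hW t ht
    have ht0 := ht.1
    rw [inv_mul_eq_div, le_div_iff₀ (by positivity)]
    calc t ^ (γ + p * δ - 1) * (u t ^ s / W t) * A ^ δ
        = t ^ (γ - 1) * (A * t ^ p) ^ δ * (u t ^ s / W t) := by
          rw [Real.mul_rpow hA.le (by positivity), ← Real.rpow_mul ht0.le, add_sub_right_comm,
            Real.rpow_add ht0]
          ring
      _ ≤ t ^ (γ - 1) * u t ^ δ * (u t ^ s / W t) := by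
        gcongr
        exact hul t ht
      _ = t ^ (γ - 1) * (u t ^ (s + δ) / W t) := by rw [Real.rpow_add hut]; ring
  refine sInf_critical_exponent
    (P := fun γ s => ∫⁻ t in Ioo (0 : ℝ) 1, ENNReal.ofReal (t ^ (γ - 1) * (u t ^ s / W t)) < ⊤)
    hp hq hd₂ (mul_pos hq hd₁) (fun s => ?_) hup hdown (fun γ hγ => ?_) (fun γ hγ => ?_)
  · rw [hg s]
    congr 1
    ext γ
    exact and_congr_right fun hγ =>
      setLIntegral_Ioo_comp_rpow_lt_top_iff hγ fun t => u t ^ s / W t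
  · refine setLIntegral_ofReal_lt_top_of_le measurableSet_Ioo A'⁻¹ (by positivity)
      (fun t ht => ?_) ((setLIntegral_Ioo_rpow_lt_top_iff (γ - 1)).2 (by linarith))
    have ht0 := ht.1
    rw [mul_comm]
    gcongr
    rw [div_le_iff₀ (hW t ht), inv_mul_eq_div, le_div_iff₀ hA', mul_comm]
    exact hWl t ht
  · by_contra! h
    have h1 := hup γ (γ - q * d₁) 0 d₁ hd₁.le (by linarith) hγ
    have h2 : ∫⁻ t in Ioo (0 : ℝ) 1, ENNReal.ofReal (t ^ (γ - q * d₁ - 1)) < ⊤ := by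
      refine setLIntegral_ofReal_lt_top_of_le measurableSet_Ioo B' hB'.le (fun t ht => ?_) h1
      have hWt := hW t ht
      have ht0 := ht.1
      rw [zero_add, mul_left_comm]
      refine le_mul_of_one_le_right (by positivity) ?_
      rw [← mul_div_assoc, one_le_div hWt]
      exact hWu t ht
    linarith [(setLIntegral_Ioo_rpow_lt_top_iff _).1 h2]

theorem gamma_a_properties
    {M : Type*} [MetricSpace M] [MeasurableSpace M] [BorelSpace M]
    (μ : Measure M) (V : M → ℝ → ℝ)
    (hV : ∀ x r, V x r = (μ (Metric.ball x r)).toReal)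
    (hVpos : ∀ (x : M) (r : ℝ), 0 < r → 0 < μ (Metric.ball x r) ∧ μ (Metric.ball x r) < ⊤)
    (c₁ c₂ d₁ d₂ : ℝ) (hc₁ : 0 < c₁) (hc₂ : 0 < c₂) (hd₁ : 0 < d₁) (hd₁₂ : d₁ ≤ d₂)
    (hVscale : ∀ (x : M) (r R : ℝ), 0 < r → r < R →
      c₁ * (R / r) ^ d₁ ≤ V x R / V x r ∧ V x R / V x r ≤ c₂ * (R / r) ^ d₂)
    (φ : ℝ → ℝ) (hφmono : StrictMonoOn φ (Ici 0))
    (hφnonneg : ∀ r : ℝ, 0 ≤ r → 0 ≤ φ r) (hφ0 : φ 0 = 0) (hφ1 : φ 1 = 1)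
    (c₃ c₄ α₁ α₂ : ℝ) (hc₃ : 0 < c₃) (hc₄ : 0 < c₄) (hα₁ : 0 < α₁) (hα₁₂ : α₁ ≤ α₂)
    (hφscale : ∀ r R : ℝ, 0 < r → r < R →
      c₃ * (R / r) ^ α₁ ≤ φ R / φ r ∧ φ R / φ r ≤ c₄ * (R / r) ^ α₂)
    (φinv : ℝ → ℝ)
    (hφinvnonneg : ∀ t : ℝ, 0 ≤ t → 0 ≤ φinv t)
    (hφinvl : ∀ r : ℝ, 0 ≤ r → φinv (φ r) = r)
    (hφinvr : ∀ t : ℝ, 0 ≤ t → φ (φinv t) = t)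
    (a : M) (γa : ℝ → ℝ)
    (hγa : ∀ s : ℝ, γa s = sInf {γ : ℝ | 0 < γ ∧
      (∫⁻ t in Ioo (0:ℝ) 1,
        ENNReal.ofReal ((φinv (t ^ (1 / γ))) ^ s / V a (φinv (t ^ (1 / γ))))) < ⊤})
    :
    (∀ s₁ s₂ : ℝ, 0 ≤ s₁ → s₁ ≤ s₂ → γa s₂ ≤ γa s₁) ∧
    (∃ K : ℝ, 0 < K ∧ ∀ s₁ s₂ : ℝ, 0 ≤ s₁ → 0 ≤ s₂ → |γa s₁ - γa s₂| ≤ K * |s₁ - s₂|) ∧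
    (∃ s₀ : ℝ, 0 < s₀ ∧ (∀ s : ℝ, s₀ ≤ s → γa s = 0) ∧
      (∀ s₁ s₂ : ℝ, 0 ≤ s₁ → s₁ < s₂ → s₂ < s₀ → 0 < γa s₂ ∧ γa s₂ < γa s₁)) := by
  have hinv : ∀ t ∈ Ioo (0 : ℝ) 1, 0 < φinv t ∧ φinv t < 1 := by
    intro t ht
    have h0 := hφinvnonneg t ht.1.le
    have hr := hφinvr t ht.1.le
    refine ⟨h0.lt_of_ne fun h => ?_, ?_⟩
    · rw [← h, hφ0] at hr
      exact ht.1.ne hr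
    · rw [← hφmono.lt_iff_lt (mem_Ici.2 h0) (mem_Ici.2 zero_le_one), hr, hφ1]
      exact ht.2
  have hVp : ∀ r, 0 < r → 0 < V a r := fun r hr => by
    rw [hV]
    exact ENNReal.toReal_pos (hVpos a r hr).1.ne' (hVpos a r hr).2.ne
  have hV1 := hVp 1 one_pos
  have hα₂ : 0 < α₂ := hα₁.trans_le hα₁₂
  refine critical_exponent_of_power_bounds (u := φinv) (W := fun t => V a (φinv t))
    (A := c₃ ^ α₁⁻¹) (B := c₄ ^ α₂⁻¹) (p := α₁⁻¹) (q := α₂⁻¹) (A' := V a 1 / c₂)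
    (B' := V a 1 / c₁) (d₁ := d₁) (d₂ := d₂) (by positivity) (by positivity) (by positivity)
    (by positivity) (by positivity) (by positivity) hd₁ (hd₁.trans_le hd₁₂)
    (fun t ht => ?_) (fun t ht => ?_) (fun t ht => ?_) (fun t ht => ?_) hγa
  all_goals
    obtain ⟨hr0, hr1⟩ := hinv t ht
    have ht0 := ht.1
    have hVr := hVp _ hr0
  · have h := (hφscale _ 1 hr0 hr1).1
    rw [hφinvr t ht0.le, hφ1, Real.div_rpow zero_le_one hr0.le, Real.one_rpow, mul_one_div,
      div_le_div_iff₀ (by positivity) ht0, one_mul] at h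
    rw [← Real.mul_rpow hc₃.le ht0.le]
    exact (Real.rpow_inv_le_iff_of_pos (by positivity) hr0.le hα₁).2 h
  · have h := (hφscale _ 1 hr0 hr1).2
    rw [hφinvr t ht0.le, hφ1, Real.div_rpow zero_le_one hr0.le, Real.one_rpow, mul_one_div,
      div_le_div_iff₀ ht0 (by positivity), one_mul] at h
    rw [← Real.mul_rpow hc₄.le ht0.le]
    exact (Real.le_rpow_inv_iff_of_pos hr0.le (by positivity) hα₂).2 h
  · have h := (hVscale a _ 1 hr0 hr1).2
    rw [Real.div_rpow zero_le_one hr0.le, Real.one_rpow, mul_one_div,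
      div_le_div_iff₀ hVr (by positivity)] at h
    rw [div_mul_eq_mul_div, div_le_iff₀ hc₂, mul_comm _ c₂]
    exact h
  · have h := (hVscale a _ 1 hr0 hr1).1
    rw [Real.div_rpow zero_le_one hr0.le, Real.one_rpow, mul_one_div,
      div_le_div_iff₀ (by positivity) hVr] at h
    rw [div_mul_eq_mul_div, le_div_iff₀ hc₁, mul_comm _ c₁]
    exact h
end

section
/- Suppose p satisfies the two-sided on-diagonal estimate (ODHK): there are constants 0 < a ≤ A with a / V(x, φ^{-1}(t)) ≤ p(t,x,x) ≤ A / V(x, φ^{-1}(t)) for all t > 0 and x ∈ M. Then there exist constants 0 < a' ≤ A' such that the subordinate kernel q(t,x,y) := ∫₀^∞ p(s,x,y) π_t(s) ds satisfies a' / V(x, (φ^γ)^{-1}(t)) ≤ q(t,x,x) ≤ A' / V(x, (φ^γ)^{-1}(t)) for all t > 0 and x ∈ M. -/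
open MeasureTheory Set

noncomputable def subQ {M : Type*} (π : ℝ → ℝ → ℝ) (p : ℝ → M → M → ℝ)
    (t : ℝ) (x y : M) : ENNReal :=
  ∫⁻ s in Set.Ioi (0:ℝ), ENNReal.ofReal (p s x y * π t s)

/-- Exponential decay beats any power. -/
theorem exp_neg_le_rpow_mul {x m : ℝ} (hx : 0 < x) (hm : 0 < m) :
    Real.exp (-x) ≤ m ^ m * x ^ (-m) := by
  have h1 : x / m ≤ Real.exp (x / m) := by linarith [Real.add_one_le_exp (x / m)]
  have h2 : (x / m) ^ m ≤ Real.exp (x / m) ^ m :=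
    Real.rpow_le_rpow (by positivity) h1 hm.le
  rw [← Real.exp_mul, div_mul_cancel₀ _ hm.ne', Real.div_rpow hx.le hm.le,
    div_le_iff₀ (by positivity)] at h2
  have h3 : 0 < x ^ m := by positivity
  rw [Real.exp_neg, Real.rpow_neg hx.le, ← div_eq_mul_inv, ← one_div,
    div_le_div_iff₀ (Real.exp_pos x) h3]
  linarith

/-- A profile with `p s ≤ A / W s`, `W` monotone with power growth of exponent `β`, integrated
against a subordinator density at time `T ^ γ`, is at most a multiple of `1 / W T`. -/
theorem lintegral_subordinate_le {W f g : ℝ → ℝ} {A K β γ C T : ℝ}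
    (hA : 0 < A) (hK : 0 < K) (hβ : 0 < β) (hγ : 0 < γ) (hC : 0 < C) (hT : 0 < T)
    (hWpos : ∀ s, 0 < s → 0 < W s) (hWmono : ∀ s, T < s → W T ≤ W s)
    (hWgrowth : ∀ s, 0 < s → s ≤ T → W T ≤ K * (T / s) ^ β * W s)
    (hg0 : ∀ s, 0 ≤ g s) (hf : ∀ s, 0 < s → f s ≤ A / W s)
    (hg : ∀ s, 0 < s → g s ≤ C * T ^ γ / s ^ (1 + γ) * Real.exp (-T ^ γ / s ^ γ)) :
    ∫⁻ s in Ioi (0 : ℝ), ENNReal.ofReal (f s * g s) ≤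
      ENNReal.ofReal
        ((A * K * C * ((β + 1 + γ) / γ) ^ ((β + 1 + γ) / γ) + A * C / γ) / W T) := by
  have hWT := hWpos T hT
  set m : ℝ := (β + 1 + γ) / γ with hm
  have hmpos : 0 < m := by positivity
  have hsmall : ∀ s ∈ Ioc (0 : ℝ) T, f s * g s ≤ A * K * C * m ^ m / W T / T := by
    rintro s ⟨hs, hsT⟩
    have hWs := hWpos s hs
    have h1 : A / W s ≤ A * (K * (T / s) ^ β) / W T := by
      rw [div_le_div_iff₀ hWs hWT]
      nlinarith [hWgrowth s hs hsT]
    have h2 : g s ≤ C * T ^ γ / s ^ (1 + γ) * (m ^ m * (T ^ γ / s ^ γ) ^ (-m)) := by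
      refine (hg s hs).trans ?_
      rw [neg_div]
      gcongr
      exact exp_neg_le_rpow_mul (by positivity) hmpos
    have h3 : (T / s) ^ β * (T ^ γ / s ^ (1 + γ) * (T ^ γ / s ^ γ) ^ (-m)) = T⁻¹ := by
      have hγm : γ * -m = -(β + 1 + γ) := by rw [hm]; field_simp
      rw [← Real.div_rpow hT.le hs.le, ← Real.rpow_mul (by positivity), hγm,
        Real.div_rpow hT.le hs.le, Real.div_rpow hT.le hs.le, Real.rpow_neg hT.le,
        Real.rpow_neg hs.le, Real.rpow_add hT, Real.rpow_add hT, Real.rpow_add hs,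
        Real.rpow_add hs, Real.rpow_add hs, Real.rpow_one, Real.rpow_one]
      field_simp
    calc f s * g s
        ≤ A * (K * (T / s) ^ β) / W T *
            (C * T ^ γ / s ^ (1 + γ) * (m ^ m * (T ^ γ / s ^ γ) ^ (-m))) :=
          mul_le_mul ((hf s hs).trans h1) h2 (hg0 s) (by positivity)
      _ = A * K * C * m ^ m / W T *
            ((T / s) ^ β * (T ^ γ / s ^ (1 + γ) * (T ^ γ / s ^ γ) ^ (-m))) := by ring
      _ = A * K * C * m ^ m / W T / T := by rw [h3, div_eq_mul_inv _ T]
  have hlarge : ∀ s ∈ Ioi T, f s * g s ≤ A * C * T ^ γ / W T * s ^ (-(1 + γ)) := by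
    intro s hsT
    have hs : 0 < s := hT.trans hsT
    have h1 : A / W s ≤ A / W T := by
      gcongr
      exact hWmono s hsT
    have h2 : g s ≤ C * T ^ γ / s ^ (1 + γ) := by
      refine (hg s hs).trans (mul_le_of_le_one_right (by positivity) ?_)
      rw [Real.exp_le_one_iff, neg_div, neg_nonpos]
      positivity
    calc f s * g s ≤ A / W T * (C * T ^ γ / s ^ (1 + γ)) :=
          mul_le_mul ((hf s hs).trans h1) h2 (hg0 s) (by positivity)
      _ = _ := by rw [Real.rpow_neg hs.le]; ring
  have hI1 : ∫⁻ s in Ioc (0 : ℝ) T, ENNReal.ofReal (f s * g s) ≤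
      ENNReal.ofReal (A * K * C * m ^ m / W T) := by
    calc ∫⁻ s in Ioc (0 : ℝ) T, ENNReal.ofReal (f s * g s)
        ≤ ∫⁻ _ in Ioc (0 : ℝ) T, ENNReal.ofReal (A * K * C * m ^ m / W T / T) :=
          setLIntegral_mono' measurableSet_Ioc
            fun s hs => ENNReal.ofReal_le_ofReal (hsmall s hs)
      _ = _ := by
          rw [setLIntegral_const, Real.volume_Ioc, sub_zero,
            ← ENNReal.ofReal_mul (by positivity), div_mul_cancel₀ _ hT.ne']
  have hI2 : ∫⁻ s in Ioi T, ENNReal.ofReal (f s * g s) ≤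
      ENNReal.ofReal (A * C / γ / W T) := by
    calc ∫⁻ s in Ioi T, ENNReal.ofReal (f s * g s)
        ≤ ∫⁻ s in Ioi T, ENNReal.ofReal (A * C * T ^ γ / W T * s ^ (-(1 + γ))) :=
          setLIntegral_mono' measurableSet_Ioi
            fun s hs => ENNReal.ofReal_le_ofReal (hlarge s hs)
      _ = ENNReal.ofReal (∫ s in Ioi T, A * C * T ^ γ / W T * s ^ (-(1 + γ))) := by
          rw [ofReal_integral_eq_lintegral_ofReal]
          · exact (integrableOn_Ioi_rpow_of_lt (by linarith) hT).const_mul _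
          · filter_upwards [ae_restrict_mem measurableSet_Ioi] with s hs
            have : 0 < s := hT.trans hs
            simp only [Pi.zero_apply]
            positivity
      _ = _ := by
          rw [integral_const_mul, integral_Ioi_rpow_of_lt (by linarith) hT]
          congr 1
          rw [show -(1 + γ) + 1 = -γ by ring, Real.rpow_neg hT.le]
          field_simp
  rw [← Ioc_union_Ioi_eq_Ioi hT.le, add_div, ENNReal.ofReal_add (by positivity) (by positivity)]
  exact (lintegral_union_le _ _ _).trans (add_le_add hI1 hI2)

/-- Lower counterpart of `lintegral_subordinate_le`: already the values `s ∈ (T, 2T]` contribute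
a multiple of `1 / W T`. -/
theorem le_lintegral_subordinate {W f g : ℝ → ℝ} {a K β γ C T : ℝ}
    (ha : 0 < a) (hK : 0 < K) (hβ : 0 < β) (hγ : 0 < γ) (hC : 0 < C) (hT : 0 < T)
    (hWpos : ∀ s, 0 < s → 0 < W s)
    (hWgrowth : ∀ s, T < s → W s ≤ K * (s / T) ^ β * W T)
    (hf : ∀ s, 0 < s → a / W s ≤ f s)
    (hg : ∀ s, T < s → C * T ^ γ / s ^ (1 + γ) ≤ g s) :
    ENNReal.ofReal (a * C / (K * 2 ^ β * 2 ^ (1 + γ)) / W T) ≤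
      ∫⁻ s in Ioi (0 : ℝ), ENNReal.ofReal (f s * g s) := by
  have hWT := hWpos T hT
  have hpt : ∀ s ∈ Ioc T (2 * T),
      a * C / (K * 2 ^ β * 2 ^ (1 + γ)) / W T / T ≤ f s * g s := by
    rintro s ⟨hTs, hs2⟩
    have hs : 0 < s := hT.trans hTs
    have hWs := hWpos s hs
    have h1 : a / (K * 2 ^ β * W T) ≤ f s := by
      refine le_trans ?_ (hf s hs)
      have h2 : s / T ≤ 2 := by rwa [div_le_iff₀ hT]
      have h3 : W s ≤ K * 2 ^ β * W T := (hWgrowth s hTs).trans (by gcongr)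
      gcongr
    have h4 : C * T ^ γ / (2 * T) ^ (1 + γ) ≤ g s := by
      refine le_trans ?_ (hg s hTs)
      gcongr
    calc a * C / (K * 2 ^ β * 2 ^ (1 + γ)) / W T / T
        = a / (K * 2 ^ β * W T) * (C * T ^ γ / (2 * T) ^ (1 + γ)) := by
          rw [Real.mul_rpow zero_le_two hT.le, Real.rpow_add hT, Real.rpow_one]
          field_simp
      _ ≤ f s * g s := mul_le_mul h1 h4 (by positivity) (le_trans (by positivity) h1)
  calc ENNReal.ofReal (a * C / (K * 2 ^ β * 2 ^ (1 + γ)) / W T)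
      = ∫⁻ _ in Ioc T (2 * T),
          ENNReal.ofReal (a * C / (K * 2 ^ β * 2 ^ (1 + γ)) / W T / T) := by
        rw [setLIntegral_const, Real.volume_Ioc, show 2 * T - T = T by ring,
          ← ENNReal.ofReal_mul (by positivity), div_mul_cancel₀ _ hT.ne']
    _ ≤ ∫⁻ s in Ioc T (2 * T), ENNReal.ofReal (f s * g s) :=
        setLIntegral_mono' measurableSet_Ioc fun s hs => ENNReal.ofReal_le_ofReal (hpt s hs)
    _ ≤ ∫⁻ s in Ioi (0 : ℝ), ENNReal.ofReal (f s * g s) :=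
        lintegral_mono_set fun s hs => hT.trans hs.1

/-- If `φ` grows at least like a power of exponent `α` and `v` at most like a power of exponent
`d`, then `v` grows at most like the power `d / α` of `φ`. -/
theorem growth_of_scaling {φ v : ℝ → ℝ} {c₂ c₃ α d : ℝ} (hc₂ : 0 < c₂)
    (hc₃ : 0 < c₃) (hα : 0 < α) (hd : 0 < d)
    (hv : ∀ r R : ℝ, 0 < r → r < R → v R / v r ≤ c₂ * (R / r) ^ d)
    (hφ : ∀ r R : ℝ, 0 < r → r < R → c₃ * (R / r) ^ α ≤ φ R / φ r)
    {r R : ℝ} (hr : 0 < r) (hrR : r < R) (hvr : 0 < v r) :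
    v R ≤ c₂ * c₃⁻¹ ^ (d / α) * (φ R / φ r) ^ (d / α) * v r := by
  have hR : 0 < R := hr.trans hrR
  have h1 : (R / r) ^ α ≤ c₃⁻¹ * (φ R / φ r) := by
    rw [inv_mul_eq_div, le_div_iff₀ hc₃, mul_comm]
    exact hφ r R hr hrR
  have hq : 0 ≤ φ R / φ r := le_trans (by positivity) (hφ r R hr hrR)
  have h2 : (R / r) ^ d ≤ c₃⁻¹ ^ (d / α) * (φ R / φ r) ^ (d / α) := by
    rw [← Real.mul_rpow (by positivity) hq]
    calc (R / r) ^ d = ((R / r) ^ α) ^ (d / α) := by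
          rw [← Real.rpow_mul (by positivity), mul_div_cancel₀ _ hα.ne']
      _ ≤ _ := Real.rpow_le_rpow (by positivity) h1 (by positivity)
  have h3 := (div_le_iff₀ hvr).1 (hv r R hr hrR)
  refine h3.trans ?_
  rw [mul_assoc c₂ (c₃⁻¹ ^ (d / α))]
  exact mul_le_mul_of_nonneg_right (mul_le_mul_of_nonneg_left h2 hc₂.le) hvr.le

theorem odhk_subordinate
    {M : Type*} [MetricSpace M] [MeasurableSpace M] [BorelSpace M]
    (μ : Measure M) (V : M → ℝ → ℝ)
    (hV : ∀ x r, V x r = (μ (Metric.ball x r)).toReal)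
    (hVpos : ∀ (x : M) (r : ℝ), 0 < r → 0 < μ (Metric.ball x r) ∧ μ (Metric.ball x r) < ⊤)
    (c₁ c₂ d₁ d₂ : ℝ) (hc₁ : 0 < c₁) (hc₂ : 0 < c₂) (hd₁ : 0 < d₁) (hd₁₂ : d₁ ≤ d₂)
    (hVscale : ∀ (x : M) (r R : ℝ), 0 < r → r < R →
      c₁ * (R / r) ^ d₁ ≤ V x R / V x r ∧ V x R / V x r ≤ c₂ * (R / r) ^ d₂)
    (φ : ℝ → ℝ) (hφmono : StrictMonoOn φ (Ici 0))
    (hφnonneg : ∀ r : ℝ, 0 ≤ r → 0 ≤ φ r) (hφ0 : φ 0 = 0) (hφ1 : φ 1 = 1)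
    (c₃ c₄ α₁ α₂ : ℝ) (hc₃ : 0 < c₃) (hc₄ : 0 < c₄) (hα₁ : 0 < α₁) (hα₁₂ : α₁ ≤ α₂)
    (hφscale : ∀ r R : ℝ, 0 < r → r < R →
      c₃ * (R / r) ^ α₁ ≤ φ R / φ r ∧ φ R / φ r ≤ c₄ * (R / r) ^ α₂)
    (φinv : ℝ → ℝ)
    (hφinvnonneg : ∀ t : ℝ, 0 ≤ t → 0 ≤ φinv t)
    (hφinvl : ∀ r : ℝ, 0 ≤ r → φinv (φ r) = r)
    (hφinvr : ∀ t : ℝ, 0 ≤ t → φ (φinv t) = t)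
    (γ : ℝ) (hγ0 : 0 < γ) (hγ1 : γ < 1)
    (π : ℝ → ℝ → ℝ) (hπmeas : Measurable (Function.uncurry π))
    (hπnonneg : ∀ t s : ℝ, 0 ≤ π t s)
    (C₁ C₂ : ℝ) (hC₁ : 0 < C₁) (hC₂ : 0 < C₂)
    (hπub : ∀ t s : ℝ, 0 < t → 0 < s → π t s ≤ C₁ * t / s ^ (1 + γ) * Real.exp (-t / s ^ γ))
    (hπlb : ∀ t s : ℝ, 0 < t → 0 < s → t ^ (1 / γ) ≤ s → C₂ * t / s ^ (1 + γ) ≤ π t s)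
    (p : ℝ → M → M → ℝ)
    (hpmeas : Measurable (fun z : ℝ × M × M => p z.1 z.2.1 z.2.2))
    (hpnonneg : ∀ (t : ℝ) (x y : M), 0 ≤ p t x y)
    (a A : ℝ) (ha : 0 < a) (haA : a ≤ A)
    (hODHK : ∀ (t : ℝ) (x : M), 0 < t →
      a / V x (φinv t) ≤ p t x x ∧ p t x x ≤ A / V x (φinv t)) :
    ∃ a' A' : ℝ, 0 < a' ∧ a' ≤ A' ∧ ∀ (t : ℝ) (x : M), 0 < t →
      ENNReal.ofReal (a' / V x (φinv (t ^ (1 / γ)))) ≤ subQ π p t x x ∧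
      subQ π p t x x ≤ ENNReal.ofReal (A' / V x (φinv (t ^ (1 / γ)))) := by
  have hφinvpos : ∀ s, 0 < s → 0 < φinv s := fun s hs =>
    (hφinvnonneg s hs.le).lt_of_ne fun h => hs.ne (by rw [← hφ0, h, hφinvr s hs.le])
  have hφinvlt : ∀ s T, 0 < s → s < T → φinv s < φinv T := fun s T hs hsT =>
    (hφmono.lt_iff_lt (hφinvnonneg s hs.le) (hφinvnonneg T (hs.trans hsT).le)).1 <| by
      rwa [hφinvr s hs.le, hφinvr T (hs.trans hsT).le]
  have hVp : ∀ x r, 0 < r → 0 < V x r := fun x r hr => by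
    rw [hV]
    exact ENNReal.toReal_pos (hVpos x r hr).1.ne' (hVpos x r hr).2.ne
  have hWpos : ∀ x s, 0 < s → 0 < V x (φinv s) := fun x s hs => hVp x _ (hφinvpos s hs)
  have hWmono : ∀ x s T, 0 < s → s < T → V x (φinv s) ≤ V x (φinv T) := fun x s T hs hsT => by
    rw [hV, hV]
    exact ENNReal.toReal_mono (hVpos x _ (hφinvpos T (hs.trans hsT))).2.ne
      (measure_mono (Metric.ball_subset_ball (hφinvlt s T hs hsT).le))
  have hd₂ : 0 < d₂ := hd₁.trans_le hd₁₂
  have hA : 0 < A := ha.trans_le haA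
  set β := d₂ / α₁
  have hβ : 0 < β := by positivity
  set K := max 1 (c₂ * c₃⁻¹ ^ β)
  have hK : 0 < K := lt_max_of_lt_left one_pos
  have hgrowth : ∀ x s T, 0 < s → s < T → V x (φinv T) ≤ K * (T / s) ^ β * V x (φinv s) := by
    intro x s T hs hsT
    have hT := hs.trans hsT
    have h := growth_of_scaling hc₂ hc₃ hα₁ hd₂ (fun r R hr hrR => (hVscale x r R hr hrR).2)
      (fun r R hr hrR => (hφscale r R hr hrR).1) (hφinvpos s hs) (hφinvlt s T hs hsT)
      (hWpos x s hs)
    rw [hφinvr s hs.le, hφinvr T hT.le] at h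
    have hW := hWpos x s hs
    refine h.trans ?_
    gcongr
    exact le_max_right _ _
  refine ⟨a * C₂ / (K * 2 ^ β * 2 ^ (1 + γ)), max (a * C₂ / (K * 2 ^ β * 2 ^ (1 + γ)))
      (A * K * C₁ * ((β + 1 + γ) / γ) ^ ((β + 1 + γ) / γ) + A * C₁ / γ), ?_, le_max_left _ _,
    fun t x ht => ?_⟩
  · positivity
  have hT : 0 < t ^ (1 / γ) := by positivity
  have hTγ : (t ^ (1 / γ)) ^ γ = t := by
    rw [← Real.rpow_mul ht.le, one_div_mul_cancel hγ0.ne', Real.rpow_one]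
  constructor
  · refine le_lintegral_subordinate (W := fun s => V x (φinv s)) ha hK hβ hγ0 hC₂ hT
      (hWpos x) (fun s hs => hgrowth x _ s hT hs) (fun s hs => (hODHK s x hs).1) fun s hs => ?_
    rw [hTγ]
    exact hπlb t s ht (hT.trans hs) hs.le
  · refine (lintegral_subordinate_le (W := fun s => V x (φinv s)) (A := A) (K := K) (β := β)
      (γ := γ) (C := C₁) hA hK hβ hγ0 hC₁ hT (hWpos x) (fun s hs => hWmono x _ s hT hs)
      (fun s hs hsT => ?_) (hπnonneg t) (fun s hs => (hODHK s x hs).2) fun s hs => ?_).trans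
      (ENNReal.ofReal_le_ofReal
        (div_le_div_of_nonneg_right (le_max_right _ _) (hWpos x _ hT).le))
    · rcases hsT.eq_or_lt with rfl | hlt
      · rw [div_self hs.ne', Real.one_rpow, mul_one]
        exact le_mul_of_one_le_left (hWpos x _ hs).le (le_max_left _ _)
      · exact hgrowth x s _ hs hlt
    · rw [hTγ]
      exact hπub t s ht hs
end

section
/- Suppose p satisfies the near-diagonal lower bound (NDLHK): there are constants c₀, a > 0 with p(t,x,y) ≥ a / V(x, φ^{-1}(t)) for all t > 0 and x, y ∈ M with d(x,y) ≤ c₀ φ^{-1}(t). Then there exist constants b₁, b₂, b₃ > 0 such that the subordinate kernel q(t,x,y) := ∫₀^∞ p(s,x,y) π_t(s) ds satisfies q(t,x,y) ≥ b₁ · min{ 1 / V(x, (φ^γ)^{-1}(t)), t / (V(x, d(x,y)) (φ(d(x,y)))^γ) } for all t > 0 and x, y ∈ M; moreover the 1-resolvent u₁^γ(x,y) := ∫₀^∞ e^{-t} q(t,x,y) dt satisfies u₁^γ(x,y) ≥ b₂ ∫_{(φ(d(x,y)))^γ}^∞ e^{-t} / V(x, (φ^γ)^{-1}(t)) dt whenever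 d(x,y) ≤ 1, and u₁^γ(x,y) ≥ b₃ / (V(x, d(x,y)) (φ(d(x,y)))^γ) whenever d(x,y) ≥ 1. -/
open MeasureTheory Set

noncomputable def resolvent1 {M : Type*} (π : ℝ → ℝ → ℝ) (p : ℝ → M → M → ℝ)
    (x y : M) : ENNReal :=
  ∫⁻ t in Set.Ioi (0:ℝ), ENNReal.ofReal (Real.exp (-t)) * subQ π p t x y

/-- A function with a lower scaling property has an inverse along which a function with an upper
scaling property is doubling. -/
theorem exists_doubling_comp_inv {M : Type*} {V : M → ℝ → ℝ} {φ φinv : ℝ → ℝ}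
    {c₂ d₂ c₃ α₁ : ℝ} (hc₂ : 0 < c₂) (hd₂ : 0 < d₂) (hc₃ : 0 < c₃) (hα₁ : 0 < α₁)
    (hVpos : ∀ x r, 0 < r → 0 < V x r)
    (hVscale : ∀ x r R, 0 < r → r < R → V x R / V x r ≤ c₂ * (R / r) ^ d₂)
    (hφscale : ∀ r R, 0 < r → r < R → c₃ * (R / r) ^ α₁ ≤ φ R / φ r)
    (hinvpos : ∀ s, 0 < s → 0 < φinv s)
    (hinvmono : ∀ s t, 0 < s → s < t → φinv s < φinv t)
    (hinvr : ∀ t, 0 ≤ t → φ (φinv t) = t) {L : ℝ} (hL : 0 < L) :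
    ∃ C, 0 < C ∧ ∀ x s t, 0 < s → s ≤ t → t ≤ L * s → V x (φinv t) ≤ C * V x (φinv s) := by
  refine ⟨max 1 (c₂ * ((L / c₃) ^ α₁⁻¹) ^ d₂), by positivity, fun x s t hs hst htL => ?_⟩
  have hVs := hVpos x _ (hinvpos s hs)
  rcases hst.eq_or_lt with rfl | hst
  · exact le_mul_of_one_le_left hVs.le (le_max_left _ _)
  have hr := hinvpos s hs
  have hR := hinvpos t (hs.trans hst)
  have hrR := hinvmono s t hs hst
  have hratio : φinv t / φinv s ≤ (L / c₃) ^ α₁⁻¹ := by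
    rw [Real.le_rpow_inv_iff_of_pos (by positivity) (by positivity) hα₁, le_div_iff₀' hc₃]
    refine (hφscale _ _ hr hrR).trans ?_
    rw [hinvr _ hs.le, hinvr _ (hs.trans hst).le]
    exact (div_le_iff₀ hs).2 htL
  rw [← div_le_iff₀ hVs]
  refine (hVscale x _ _ hr hrR).trans (le_trans ?_ (le_max_right _ _))
  gcongr

/-- Lower bound for the subordinate kernel at every time scale `W` which dominates both the
typical subordination time and the diffusion time between the two points. -/
theorem exists_le_subQ {M : Type*} [MetricSpace M] {V : M → ℝ → ℝ} {φ φinv : ℝ → ℝ}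
    {c₂ d₂ c₃ α₁ K γ C₂ c₀ a : ℝ} {π : ℝ → ℝ → ℝ} {p : ℝ → M → M → ℝ}
    (hc₂ : 0 < c₂) (hd₂ : 0 < d₂) (hc₃ : 0 < c₃) (hα₁ : 0 < α₁)
    (hVpos : ∀ x r, 0 < r → 0 < V x r)
    (hVscale : ∀ x r R, 0 < r → r < R → V x R / V x r ≤ c₂ * (R / r) ^ d₂)
    (hφscale : ∀ r R, 0 < r → r < R → c₃ * (R / r) ^ α₁ ≤ φ R / φ r)
    (hinvpos : ∀ s, 0 < s → 0 < φinv s)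
    (hinvmono : ∀ s t, 0 < s → s < t → φinv s < φinv t)
    (hinvr : ∀ t, 0 ≤ t → φ (φinv t) = t)
    (hK : 1 ≤ K)
    (hdist : ∀ r W s, 0 ≤ r → 0 < W → φ r ≤ W → K * W ≤ s → r ≤ c₀ * φinv s)
    (hγ : 0 < γ) (hC₂ : 0 < C₂) (ha : 0 < a)
    (hπlb : ∀ t s : ℝ, 0 < t → 0 < s → t ^ (1 / γ) ≤ s → C₂ * t / s ^ (1 + γ) ≤ π t s)
    (hNDL : ∀ (t : ℝ) (x y : M), 0 < t → dist x y ≤ c₀ * φinv t →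
      a / V x (φinv t) ≤ p t x y) :
    ∃ b, 0 < b ∧ ∀ t W x y, 0 < t → 0 < W → t ^ (1 / γ) ≤ W → φ (dist x y) ≤ W →
      ENNReal.ofReal (b * (t / (V x (φinv W) * W ^ γ))) ≤ subQ π p t x y := by
  have hK0 : 0 < K := by positivity
  obtain ⟨C, hC, hdoub⟩ := exists_doubling_comp_inv hc₂ hd₂ hc₃ hα₁ hVpos hVscale hφscale hinvpos
    hinvmono hinvr (L := 2 * K) (by positivity)
  refine ⟨a / C * (C₂ / (2 * K) ^ (1 + γ)) * K, by positivity, fun t W x y ht hW htW hxy => ?_⟩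
  have hVW := hVpos x _ (hinvpos W hW)
  have hlower : ∀ s ∈ Icc (K * W) (2 * K * W),
      a / (C * V x (φinv W)) * (C₂ * t / (2 * K * W) ^ (1 + γ)) ≤ p s x y * π t s := by
    rintro s ⟨hs₁, hs₂⟩
    have hWs : W ≤ s := (le_mul_of_one_le_left hW.le hK).trans hs₁
    have hs : 0 < s := hW.trans_le hWs
    have hVs := hVpos x _ (hinvpos s hs)
    have hp : a / (C * V x (φinv W)) ≤ p s x y := by
      refine le_trans ?_ (hNDL s x y hs (hdist _ W s dist_nonneg hW hxy hs₁))
      exact div_le_div_of_nonneg_left ha.le hVs (hdoub x W s hW hWs hs₂)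
    have hπ : C₂ * t / (2 * K * W) ^ (1 + γ) ≤ π t s := by
      refine le_trans ?_ (hπlb t s ht hs (htW.trans hWs))
      gcongr
    exact mul_le_mul hp hπ (by positivity) (le_trans (by positivity) hp)
  have hmass : a / C * (C₂ / (2 * K) ^ (1 + γ)) * K * (t / (V x (φinv W) * W ^ γ)) =
      a / (C * V x (φinv W)) * (C₂ * t / (2 * K * W) ^ (1 + γ)) * (2 * K * W - K * W) := by
    rw [Real.mul_rpow (by positivity) hW.le, Real.rpow_add hW, Real.rpow_one]
    field_simp
    ring
  calc ENNReal.ofReal (a / C * (C₂ / (2 * K) ^ (1 + γ)) * K * (t / (V x (φinv W) * W ^ γ)))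
      = ∫⁻ _ in Icc (K * W) (2 * K * W),
          ENNReal.ofReal (a / (C * V x (φinv W)) * (C₂ * t / (2 * K * W) ^ (1 + γ))) := by
        rw [setLIntegral_const, Real.volume_Icc, hmass, ENNReal.ofReal_mul (by positivity)]
    _ ≤ ∫⁻ s in Icc (K * W) (2 * K * W), ENNReal.ofReal (p s x y * π t s) :=
        setLIntegral_mono' measurableSet_Icc fun s hs => ENNReal.ofReal_le_ofReal (hlower s hs)
    _ ≤ subQ π p t x y :=
        lintegral_mono_set fun s hs => (mul_pos hK0 hW).trans_le hs.1

theorem ndlhk_subordinate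
    {M : Type*} [MetricSpace M] [MeasurableSpace M] [BorelSpace M]
    (μ : Measure M) (V : M → ℝ → ℝ)
    (hV : ∀ x r, V x r = (μ (Metric.ball x r)).toReal)
    (hVpos : ∀ (x : M) (r : ℝ), 0 < r → 0 < μ (Metric.ball x r) ∧ μ (Metric.ball x r) < ⊤)
    (c₁ c₂ d₁ d₂ : ℝ) (hc₁ : 0 < c₁) (hc₂ : 0 < c₂) (hd₁ : 0 < d₁) (hd₁₂ : d₁ ≤ d₂)
    (hVscale : ∀ (x : M) (r R : ℝ), 0 < r → r < R →
      c₁ * (R / r) ^ d₁ ≤ V x R / V x r ∧ V x R / V x r ≤ c₂ * (R / r) ^ d₂)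
    (φ : ℝ → ℝ) (hφmono : StrictMonoOn φ (Ici 0))
    (hφnonneg : ∀ r : ℝ, 0 ≤ r → 0 ≤ φ r) (hφ0 : φ 0 = 0) (hφ1 : φ 1 = 1)
    (c₃ c₄ α₁ α₂ : ℝ) (hc₃ : 0 < c₃) (hc₄ : 0 < c₄) (hα₁ : 0 < α₁) (hα₁₂ : α₁ ≤ α₂)
    (hφscale : ∀ r R : ℝ, 0 < r → r < R →
      c₃ * (R / r) ^ α₁ ≤ φ R / φ r ∧ φ R / φ r ≤ c₄ * (R / r) ^ α₂)
    (φinv : ℝ → ℝ)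
    (hφinvnonneg : ∀ t : ℝ, 0 ≤ t → 0 ≤ φinv t)
    (hφinvl : ∀ r : ℝ, 0 ≤ r → φinv (φ r) = r)
    (hφinvr : ∀ t : ℝ, 0 ≤ t → φ (φinv t) = t)
    (γ : ℝ) (hγ0 : 0 < γ) (hγ1 : γ < 1)
    (π : ℝ → ℝ → ℝ) (hπmeas : Measurable (Function.uncurry π))
    (hπnonneg : ∀ t s : ℝ, 0 ≤ π t s)
    (C₁ C₂ : ℝ) (hC₁ : 0 < C₁) (hC₂ : 0 < C₂)
    (hπub : ∀ t s : ℝ, 0 < t → 0 < s → π t s ≤ C₁ * t / s ^ (1 + γ) * Real.exp (-t / s ^ γ))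
    (hπlb : ∀ t s : ℝ, 0 < t → 0 < s → t ^ (1 / γ) ≤ s → C₂ * t / s ^ (1 + γ) ≤ π t s)
    (p : ℝ → M → M → ℝ)
    (hpmeas : Measurable (fun z : ℝ × M × M => p z.1 z.2.1 z.2.2))
    (hpnonneg : ∀ (t : ℝ) (x y : M), 0 ≤ p t x y)
    (c₀ a : ℝ) (hc₀ : 0 < c₀) (ha : 0 < a)
    (hNDL : ∀ (t : ℝ) (x y : M), 0 < t → dist x y ≤ c₀ * φinv t →
      a / V x (φinv t) ≤ p t x y) :
    ∃ b₁ b₂ b₃ : ℝ, 0 < b₁ ∧ 0 < b₂ ∧ 0 < b₃ ∧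
      (∀ (t : ℝ) (x y : M), 0 < t →
        ENNReal.ofReal b₁ *
          min ((ENNReal.ofReal (V x (φinv (t ^ (1 / γ)))))⁻¹)
            (ENNReal.ofReal t /
              (ENNReal.ofReal (V x (dist x y)) * ENNReal.ofReal (φ (dist x y) ^ γ))) ≤
        subQ π p t x y) ∧
      (∀ x y : M, dist x y ≤ 1 →
        ENNReal.ofReal b₂ *
          (∫⁻ t in Ioi ((φ (dist x y)) ^ γ),
            ENNReal.ofReal (Real.exp (-t) / V x (φinv (t ^ (1 / γ))))) ≤
        resolvent1 π p x y) ∧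
      (∀ x y : M, 1 ≤ dist x y →
        ENNReal.ofReal (b₃ / (V x (dist x y) * (φ (dist x y)) ^ γ)) ≤
        resolvent1 π p x y) := by
  have hVpos' : ∀ x r, 0 < r → 0 < V x r := fun x r hr => by
    rw [hV]
    exact ENNReal.toReal_pos (hVpos x r hr).1.ne' (hVpos x r hr).2.ne
  have hφpos : ∀ r, 0 < r → 0 < φ r := fun r hr => by
    simpa [hφ0] using hφmono (mem_Ici.2 le_rfl) (mem_Ici.2 hr.le) hr
  have hinvmono : ∀ s t, 0 ≤ s → s < t → φinv s < φinv t := fun s t hs hst => by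
    have ht := hs.trans hst.le
    rw [← hφmono.lt_iff_lt (hφinvnonneg s hs) (hφinvnonneg t ht), hφinvr s hs, hφinvr t ht]
    exact hst
  have hinvpos : ∀ s, 0 < s → 0 < φinv s := fun s hs =>
    (hφinvnonneg 0 le_rfl).trans_lt (hinvmono 0 s le_rfl hs)
  have hdist : ∀ r W s, 0 ≤ r → 0 < W → φ r ≤ W → max 1 (c₄ * (1 / c₀) ^ α₂) * W ≤ s →
      r ≤ c₀ * φinv s := by
    intro r W s hr hW hrW hs
    have hs0 : 0 < s := lt_of_lt_of_le (by positivity) hs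
    rw [← div_le_iff₀' hc₀, ← hφmono.le_iff_le (mem_Ici.2 (by positivity)) (hinvpos s hs0).le,
      hφinvr s hs0.le]
    rcases hr.eq_or_lt with rfl | hr
    · simpa [hφ0] using hs0.le
    have hφr := hφpos r hr
    refine le_trans ?_ ((mul_le_mul_of_nonneg_left hrW (by positivity)).trans hs)
    rcases le_or_gt (r / c₀) r with h | h
    · exact (hφmono.monotoneOn (mem_Ici.2 (by positivity)) hr.le h).trans
        (le_mul_of_one_le_left hφr.le (le_max_left _ _))
    · rw [← div_le_iff₀ hφr]
      refine (hφscale r _ hr h).2.trans (le_trans (le_of_eq ?_) (le_max_right _ _))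
      congr 2
      field_simp
  obtain ⟨b, hb, hq⟩ := exists_le_subQ (π := π) (p := p) hc₂ (hd₁.trans_le hd₁₂) hc₃ hα₁ hVpos'
    (fun x r R hr hrR => (hVscale x r R hr hrR).2) (fun r R hr hrR => (hφscale r R hr hrR).1)
    hinvpos (fun s t hs => hinvmono s t hs.le) hφinvr (le_max_left _ _) hdist hγ0 hC₂ ha hπlb hNDL
  have hnear : ∀ t x y, 0 < t → φ (dist x y) ≤ t ^ (1 / γ) →
      ENNReal.ofReal (b * (1 / V x (φinv (t ^ (1 / γ))))) ≤ subQ π p t x y := by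
    intro t x y ht hxy
    convert hq t (t ^ (1 / γ)) x y ht (by positivity) le_rfl hxy using 3
    rw [one_div γ, Real.rpow_inv_rpow ht.le hγ0.ne']
    field_simp
  have hfar : ∀ t x y, 0 < t → t ^ (1 / γ) ≤ φ (dist x y) →
      ENNReal.ofReal (b * (t / (V x (dist x y) * φ (dist x y) ^ γ))) ≤ subQ π p t x y := by
    intro t x y ht hxy
    convert hq t (φ (dist x y)) x y ht (lt_of_lt_of_le (by positivity) hxy) hxy le_rfl using 5
    rw [hφinvl _ dist_nonneg]
  refine ⟨b, b, b * Real.exp (-1) / 4, hb, hb, by positivity, ?_, ?_, ?_⟩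
  · intro t x y ht
    rcases le_total (φ (dist x y)) (t ^ (1 / γ)) with h | h
    · refine le_trans (mul_le_mul_right (min_le_left _ _) _) (le_trans (le_of_eq ?_)
        (hnear t x y ht h))
      rw [ENNReal.ofReal_mul hb.le, one_div (V _ _),
        ENNReal.ofReal_inv_of_pos (hVpos' x _ (hinvpos _ (by positivity)))]
    · have hφd : 0 < φ (dist x y) := lt_of_lt_of_le (by positivity) h
      have hd : 0 < dist x y := dist_nonneg.lt_of_ne fun h0 => by
        rw [← h0, hφ0] at hφd
        exact hφd.false
      have hVd := hVpos' x _ hd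
      refine le_trans (mul_le_mul_right (min_le_right _ _) _) (le_trans (le_of_eq ?_)
        (hfar t x y ht h))
      rw [ENNReal.ofReal_mul hb.le, ENNReal.ofReal_div_of_pos (by positivity),
        ENNReal.ofReal_mul hVd.le]
  · intro x y _
    have hφd := hφnonneg _ (dist_nonneg (x := x) (y := y))
    have hpow : 0 ≤ φ (dist x y) ^ γ := by positivity
    refine (lintegral_const_mul_le _ _).trans ((setLIntegral_mono' measurableSet_Ioi ?_).trans
      (lintegral_mono_set (Ioi_subset_Ioi hpow)))
    intro t ht
    have ht0 : 0 < t := hpow.trans_lt ht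
    have h : φ (dist x y) ≤ t ^ (1 / γ) := by
      rw [one_div, Real.le_rpow_inv_iff_of_pos hφd ht0.le hγ0]
      exact (mem_Ioi.1 ht).le
    refine le_trans (le_of_eq ?_) (mul_le_mul_right (hnear t x y ht0 h) _)
    rw [← ENNReal.ofReal_mul hb.le, ← ENNReal.ofReal_mul (Real.exp_pos _).le]
    congr 1
    ring
  · intro x y hxy
    have hd : 0 < dist x y := one_pos.trans_le hxy
    have hVd := hVpos' x _ hd
    have hφd := hφpos _ hd
    have hφd1 : 1 ≤ φ (dist x y) :=
      hφ1 ▸ hφmono.monotoneOn (mem_Ici.2 zero_le_one) (mem_Ici.2 hd.le) hxy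
    calc ENNReal.ofReal (b * Real.exp (-1) / 4 / (V x (dist x y) * φ (dist x y) ^ γ))
        = ∫⁻ _ in Icc (1 / 2 : ℝ) 1, ENNReal.ofReal (Real.exp (-1) *
            (b * (1 / 2 / (V x (dist x y) * φ (dist x y) ^ γ)))) := by
          rw [setLIntegral_const, Real.volume_Icc, ← ENNReal.ofReal_mul (by positivity)]
          congr 1
          ring
      _ ≤ ∫⁻ t in Icc (1 / 2 : ℝ) 1, ENNReal.ofReal (Real.exp (-t)) * subQ π p t x y := by
          refine setLIntegral_mono' measurableSet_Icc ?_
          rintro t ⟨ht₁, ht₂⟩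
          have ht0 : 0 < t := by linarith
          have h : t ^ (1 / γ) ≤ φ (dist x y) :=
            (Real.rpow_le_one ht0.le ht₂ (by positivity)).trans hφd1
          refine le_trans ?_ (mul_le_mul_right (hfar t x y ht0 h) _)
          rw [← ENNReal.ofReal_mul (Real.exp_pos _).le]
          gcongr
      _ ≤ resolvent1 π p x y :=
          lintegral_mono_set fun t ht => lt_of_lt_of_le (by norm_num) ht.1
end

section
/- Suppose p satisfies the near-diagonal lower bound (NDLHK): there are constants c₀, a > 0 with p(t,x,y) ≥ a / V(x, φ^{-1}(t)) for all t > 0 and x, y ∈ M with d(x,y) ≤ c₀ φ^{-1}(t). Then there is a constant b > 0 such that the Green function u₀^γ(x,y) := ∫₀^∞ ∫₀^∞ p(s,x,y) π_t(s) ds dt satisfies u₀^γ(x,y) ≥ b ∫_{(φ(d(x,y)))^γ}^∞ 1 / V(x, (φ^γ)^{-1}(t)) dt for all x, y ∈ M. -/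
open MeasureTheory Set

noncomputable def green0 {M : Type*} (π : ℝ → ℝ → ℝ) (p : ℝ → M → M → ℝ)
    (x y : M) : ENNReal :=
  ∫⁻ t in Set.Ioi (0:ℝ), subQ π p t x y

/-- A right inverse, with values in `[0, ∞)`, of a strictly increasing function on `[0, ∞)` is
strictly increasing there. -/
theorem strictMonoOn_of_rightInverse {φ φinv : ℝ → ℝ} (hφ : StrictMonoOn φ (Ici 0))
    (hnonneg : ∀ t : ℝ, 0 ≤ t → 0 ≤ φinv t) (hinv : ∀ t : ℝ, 0 ≤ t → φ (φinv t) = t) :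
    StrictMonoOn φinv (Ici 0) := by
  intro u hu v hv huv
  rw [← hφ.lt_iff_lt (hnonneg u hu) (hnonneg v hv), hinv u hu, hinv v hv]
  exact huv

/-- A lower bound for `p` and `π` on the window `[l * u, 2 * l * u]` bounds `subQ` from below. -/
theorem ofReal_le_subQ {M : Type*} {π : ℝ → ℝ → ℝ} {p : ℝ → M → M → ℝ} {t : ℝ} {x y : M}
    {l u P Q : ℝ} (hl : 0 < l) (hu : 0 < u) (hP : 0 ≤ P) (hQ : 0 ≤ Q)
    (hp : ∀ s ∈ Icc (l * u) (2 * l * u), P ≤ p s x y)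
    (hπ : ∀ s ∈ Icc (l * u) (2 * l * u), Q ≤ π t s) :
    ENNReal.ofReal (P * Q * (l * u)) ≤ subQ π p t x y := by
  have hsub : Icc (l * u) (2 * l * u) ⊆ Ioi (0 : ℝ) := fun s hs =>
    lt_of_lt_of_le (mul_pos hl hu) hs.1
  calc ENNReal.ofReal (P * Q * (l * u))
      = ∫⁻ _ in Icc (l * u) (2 * l * u), ENNReal.ofReal (P * Q) := by
        rw [setLIntegral_const, Real.volume_Icc, ← ENNReal.ofReal_mul (mul_nonneg hP hQ)]
        congr 1
        ring
    _ ≤ ∫⁻ s in Icc (l * u) (2 * l * u), ENNReal.ofReal (p s x y * π t s) := by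
        refine setLIntegral_mono' measurableSet_Icc fun s hs => ENNReal.ofReal_le_ofReal ?_
        exact mul_le_mul (hp s hs) (hπ s hs) hQ (hP.trans (hp s hs))
    _ ≤ subQ π p t x y := lintegral_mono_set hsub

theorem green_lower_subordinate
    {M : Type*} [MetricSpace M] [MeasurableSpace M] [BorelSpace M]
    (μ : Measure M) (V : M → ℝ → ℝ)
    (hV : ∀ x r, V x r = (μ (Metric.ball x r)).toReal)
    (hVpos : ∀ (x : M) (r : ℝ), 0 < r → 0 < μ (Metric.ball x r) ∧ μ (Metric.ball x r) < ⊤)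
    (c₁ c₂ d₁ d₂ : ℝ) (hc₁ : 0 < c₁) (hc₂ : 0 < c₂) (hd₁ : 0 < d₁) (hd₁₂ : d₁ ≤ d₂)
    (hVscale : ∀ (x : M) (r R : ℝ), 0 < r → r < R →
      c₁ * (R / r) ^ d₁ ≤ V x R / V x r ∧ V x R / V x r ≤ c₂ * (R / r) ^ d₂)
    (φ : ℝ → ℝ) (hφmono : StrictMonoOn φ (Ici 0))
    (hφnonneg : ∀ r : ℝ, 0 ≤ r → 0 ≤ φ r) (hφ0 : φ 0 = 0) (hφ1 : φ 1 = 1)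
    (c₃ c₄ α₁ α₂ : ℝ) (hc₃ : 0 < c₃) (hc₄ : 0 < c₄) (hα₁ : 0 < α₁) (hα₁₂ : α₁ ≤ α₂)
    (hφscale : ∀ r R : ℝ, 0 < r → r < R →
      c₃ * (R / r) ^ α₁ ≤ φ R / φ r ∧ φ R / φ r ≤ c₄ * (R / r) ^ α₂)
    (φinv : ℝ → ℝ)
    (hφinvnonneg : ∀ t : ℝ, 0 ≤ t → 0 ≤ φinv t)
    (hφinvl : ∀ r : ℝ, 0 ≤ r → φinv (φ r) = r)
    (hφinvr : ∀ t : ℝ, 0 ≤ t → φ (φinv t) = t)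
    (γ : ℝ) (hγ0 : 0 < γ) (hγ1 : γ < 1)
    (π : ℝ → ℝ → ℝ) (hπmeas : Measurable (Function.uncurry π))
    (hπnonneg : ∀ t s : ℝ, 0 ≤ π t s)
    (C₁ C₂ : ℝ) (hC₁ : 0 < C₁) (hC₂ : 0 < C₂)
    (hπub : ∀ t s : ℝ, 0 < t → 0 < s → π t s ≤ C₁ * t / s ^ (1 + γ) * Real.exp (-t / s ^ γ))
    (hπlb : ∀ t s : ℝ, 0 < t → 0 < s → t ^ (1 / γ) ≤ s → C₂ * t / s ^ (1 + γ) ≤ π t s)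
    (p : ℝ → M → M → ℝ)
    (hpmeas : Measurable (fun z : ℝ × M × M => p z.1 z.2.1 z.2.2))
    (hpnonneg : ∀ (t : ℝ) (x y : M), 0 ≤ p t x y)
    (c₀ a : ℝ) (hc₀ : 0 < c₀) (ha : 0 < a)
    (hNDL : ∀ (t : ℝ) (x y : M), 0 < t → dist x y ≤ c₀ * φinv t →
      a / V x (φinv t) ≤ p t x y) :
    ∃ b : ℝ, 0 < b ∧ ∀ x y : M,
      ENNReal.ofReal b *
        (∫⁻ t in Ioi ((φ (dist x y)) ^ γ),
          ENNReal.ofReal (1 / V x (φinv (t ^ (1 / γ))))) ≤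
      green0 π p x y := by
  have hVp : ∀ (x : M) (r : ℝ), 0 < r → 0 < V x r := fun x r hr => by
    rw [hV]
    exact ENNReal.toReal_pos (hVpos x r hr).1.ne' (hVpos x r hr).2.ne
  have hinvmono := strictMonoOn_of_rightInverse hφmono hφinvnonneg hφinvr
  have hinv0 : φinv 0 = 0 := by simpa [hφ0] using hφinvl 0 le_rfl
  have hinvpos : ∀ u : ℝ, 0 < u → 0 < φinv u := fun u hu => by
    simpa [hinv0] using hinvmono (self_mem_Ici (a := (0 : ℝ))) hu.le hu
  obtain ⟨l, hl⟩ : ∃ l : ℝ, l = 1 + c₄ * (1 / c₀) ^ α₂ := ⟨_, rfl⟩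
  have hKpos : 0 < c₄ * (1 / c₀) ^ α₂ := by positivity
  have hl1 : 1 < l := by linarith
  have hl0 : 0 < l := by linarith
  have hα₂ : 0 < α₂ := hα₁.trans_le hα₁₂
  have hd₂ : 0 < d₂ := hd₁.trans_le hd₁₂
  obtain ⟨A, hA⟩ : ∃ A : ℝ, A = c₂ * ((2 * l / c₃) ^ (1 / α₁)) ^ d₂ := ⟨_, rfl⟩
  have hA0 : 0 < A := by rw [hA]; positivity
  have hwindow : ∀ u s : ℝ, 0 < u → s ∈ Icc (l * u) (2 * l * u) →
      φinv u ≤ c₀ * φinv s ∧ ∀ x, V x (φinv s) ≤ A * V x (φinv u) := by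
    intro u s hu hs
    have hus : u < s := lt_of_lt_of_le (by nlinarith) hs.1
    have hs0 : 0 < s := hu.trans hus
    have hr := hinvpos u hu
    have hR := hinvpos s hs0
    have hrR : φinv u < φinv s := hinvmono hu.le hs0.le hus
    obtain ⟨hlow, hup⟩ := hφscale _ _ hr hrR
    rw [hφinvr u hu.le, hφinvr s hs0.le] at hlow hup
    have hratio : 0 < φinv s / φinv u := div_pos hR hr
    constructor
    · by_contra! hlt
      have hle : φinv s / φinv u ≤ 1 / c₀ := by
        rw [div_le_div_iff₀ hr hc₀]
        linarith
      have h1 : (φinv s / φinv u) ^ α₂ ≤ (1 / c₀) ^ α₂ :=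
        Real.rpow_le_rpow hratio.le hle hα₂.le
      have h2 : l ≤ s / u := (le_div_iff₀ hu).2 hs.1
      have h3 := mul_le_mul_of_nonneg_left h1 hc₄.le
      linarith
    · intro x
      have h2 : s / u ≤ 2 * l := (div_le_iff₀ hu).2 hs.2
      have h3 : (φinv s / φinv u) ^ α₁ ≤ 2 * l / c₃ := by
        rw [le_div_iff₀ hc₃]
        linarith
      have h4 : φinv s / φinv u ≤ (2 * l / c₃) ^ (1 / α₁) := by
        have := Real.rpow_le_rpow (by positivity) h3 (by positivity : 0 ≤ 1 / α₁)
        rwa [← Real.rpow_mul hratio.le, mul_one_div_cancel hα₁.ne', Real.rpow_one] at this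
      rw [← div_le_iff₀ (hVp x _ hr), hA]
      refine (hVscale x _ _ hr hrR).2.trans (mul_le_mul_of_nonneg_left ?_ hc₂.le)
      exact Real.rpow_le_rpow hratio.le h4 hd₂.le
  refine ⟨a / A * (C₂ * l / (2 * l) ^ (1 + γ)), by positivity, fun x y => ?_⟩
  have hφd : 0 ≤ φ (dist x y) := hφnonneg _ dist_nonneg
  refine (lintegral_const_mul_le _ _).trans ?_
  refine le_trans ?_ (lintegral_mono_set (Ioi_subset_Ioi (Real.rpow_nonneg hφd γ)))
  refine setLIntegral_mono' measurableSet_Ioi fun t ht => ?_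
  have ht0 : 0 < t := lt_of_le_of_lt (Real.rpow_nonneg hφd γ) ht
  obtain ⟨u, hut⟩ : ∃ u : ℝ, u = t ^ (1 / γ) := ⟨_, rfl⟩
  have hu : 0 < u := by rw [hut]; positivity
  have huγ : u ^ γ = t := by
    rw [hut, ← Real.rpow_mul ht0.le, one_div_mul_cancel hγ0.ne', Real.rpow_one]
  have hdu : φ (dist x y) < u := by
    refine (Real.rpow_lt_rpow_iff hφd hu.le hγ0).1 ?_
    rw [huγ]
    exact ht
  have hdist : dist x y ≤ φinv u := by
    rw [← hφinvl _ (dist_nonneg (x := x) (y := y))]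
    exact (hinvmono hφd hu.le hdu).le
  have hVu := hVp x _ (hinvpos u hu)
  rw [← hut, ← ENNReal.ofReal_mul (by positivity)]
  have key := ofReal_le_subQ (π := π) (p := p) (t := t) (x := x) (y := y) hl0 hu
    (P := a / (A * V x (φinv u))) (Q := C₂ * t / (2 * l * u) ^ (1 + γ))
    (by positivity) (by positivity) ?_ ?_
  · refine le_trans (le_of_eq ?_) key
    congr 1
    rw [Real.mul_rpow (by positivity) hu.le, Real.rpow_add hu, Real.rpow_one, huγ]
    field_simp
  · intro s hs
    have hs0 : 0 < s := lt_of_lt_of_le (by positivity) hs.1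
    obtain ⟨h1, h2⟩ := hwindow u s hu hs
    refine le_trans ?_ (hNDL s x y hs0 (hdist.trans h1))
    exact div_le_div_of_nonneg_left ha.le (hVp x _ (hinvpos s hs0)) (h2 x)
  · intro s hs
    have hs0 : 0 < s := lt_of_lt_of_le (by positivity) hs.1
    have hus : u ≤ s := le_trans (by nlinarith) hs.1
    refine le_trans ?_ (hπlb t s ht0 hs0 (hut ▸ hus))
    exact div_le_div_of_nonneg_left (by positivity) (by positivity)
      (Real.rpow_le_rpow hs0.le hs.2 (by positivity))
end

section
/- Suppose p satisfies the upper bound (WUHK): there is a constant A > 0 with p(t,x,y) ≤ A · min{ 1 / V(x, φ^{-1}(t)), t / (V(x, d(x,y)) φ(d(x,y))) } for all t > 0 and x, y ∈ M (the second term read as +∞ when x = y). Then there is a constant B > 0 such that the Green function u₀^γ(x,y) := ∫₀^∞ ∫₀^∞ p(s,x,y) π_t(s) ds dt satisfies u₀^γ(x,y) ≤ B ∫_{(φ(d(x,y)))^γ}^∞ 1 / V(x, (φ^γ)^{-1}(t)) dt for all x, y ∈ M with x ≠ y. -/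
open MeasureTheory Set

theorem lintegral_mul_exp_neg_mul_Ioi {r : ℝ} (hr : 0 < r) :
    ∫⁻ t in Ioi (0 : ℝ), ENNReal.ofReal (t * Real.exp (-(r * t))) = ENNReal.ofReal ((1 / r) ^ 2) := by
  have h := Real.integral_rpow_mul_exp_neg_mul_Ioi (a := 2) (r := r) (by norm_num) hr
  have h1 : ∀ t : ℝ, t ^ ((2 : ℝ) - 1) = t := fun t => by norm_num
  simp only [h1, Real.Gamma_two, mul_one, Real.rpow_two] at h
  rw [← h, ofReal_integral_eq_lintegral_ofReal]
  · by_contra hni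
    rw [integral_undef hni] at h
    have : 0 < (1 / r) ^ 2 := by positivity
    exact this.ne h
  · filter_upwards [ae_restrict_mem measurableSet_Ioi] with t ht
    exact mul_nonneg (le_of_lt ht) (Real.exp_pos _).le

/-- A subordinator density with the stated upper bound has potential density `O(s ^ (γ - 1))`. -/
theorem lintegral_density_le {γ C s : ℝ} {f : ℝ → ℝ} (hC : 0 ≤ C) (hs : 0 < s)
    (hf : ∀ t : ℝ, 0 < t → f t ≤ C * t / s ^ (1 + γ) * Real.exp (-t / s ^ γ)) :
    ∫⁻ t in Ioi (0 : ℝ), ENNReal.ofReal (f t) ≤ ENNReal.ofReal (C * s ^ (γ - 1)) := by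
  have hr : 0 < 1 / s ^ γ := by positivity
  calc ∫⁻ t in Ioi (0 : ℝ), ENNReal.ofReal (f t)
      ≤ ∫⁻ t in Ioi (0 : ℝ), ENNReal.ofReal (C / s ^ (1 + γ)) *
          ENNReal.ofReal (t * Real.exp (-(1 / s ^ γ * t))) := by
        refine setLIntegral_mono' measurableSet_Ioi fun t ht => ?_
        rw [← ENNReal.ofReal_mul (by positivity)]
        refine ENNReal.ofReal_le_ofReal ((hf t ht).trans_eq ?_)
        rw [show -t / s ^ γ = -(1 / s ^ γ * t) by ring]
        ring
    _ = ENNReal.ofReal (C * s ^ (γ - 1)) := by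
        rw [lintegral_const_mul' _ _ ENNReal.ofReal_ne_top, lintegral_mul_exp_neg_mul_Ioi hr,
          ← ENNReal.ofReal_mul (by positivity)]
        congr 1
        rw [one_div_one_div, Real.rpow_add hs, Real.rpow_sub hs, Real.rpow_one]
        field_simp

theorem lintegral_Ioi_rpow_eq {γ T : ℝ} (hγ : 0 < γ) (hT : 0 < T) (g : ℝ → ENNReal) :
    ∫⁻ t in Ioi (T ^ γ), g t =
      ∫⁻ s in Ioi T, ENNReal.ofReal (γ * s ^ (γ - 1)) * g (s ^ γ) := by
  have himg : (fun s : ℝ => s ^ γ) '' Ioi T = Ioi (T ^ γ) := by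
    ext t
    constructor
    · rintro ⟨s, hs, rfl⟩
      exact Real.rpow_lt_rpow hT.le hs hγ
    · intro ht
      have ht0 : 0 < t := (Real.rpow_pos_of_pos hT γ).trans ht
      refine ⟨t ^ γ⁻¹, ?_, Real.rpow_inv_rpow ht0.le hγ.ne'⟩
      exact (Real.lt_rpow_inv_iff_of_pos hT.le ht0.le hγ).2 ht
  have hinj : InjOn (fun s : ℝ => s ^ γ) (Ioi T) := fun a ha b hb hab =>
    (Real.rpow_left_inj (hT.trans ha).le (hT.trans hb).le hγ.ne').1 hab
  rw [← himg, lintegral_image_eq_lintegral_abs_deriv_mul measurableSet_Ioi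
    (fun s hs => (Real.hasDerivAt_rpow_const (Or.inl (hT.trans hs).ne')).hasDerivWithinAt) hinj]
  refine setLIntegral_congr_fun measurableSet_Ioi fun s hs => ?_
  have : 0 < s := hT.trans hs
  rw [abs_of_nonneg (by positivity)]

/-- Tonelli bound of the subordinate Green function by a weighted time integral of `p`. -/
theorem green0_le_lintegral {M : Type*} [MeasurableSpace M] {γ C : ℝ} {π : ℝ → ℝ → ℝ}
    {p : ℝ → M → M → ℝ} (hC : 0 ≤ C) (hπmeas : Measurable (Function.uncurry π))
    (hπub : ∀ t s : ℝ, 0 < t → 0 < s → π t s ≤ C * t / s ^ (1 + γ) * Real.exp (-t / s ^ γ))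
    (hpmeas : Measurable (fun z : ℝ × M × M => p z.1 z.2.1 z.2.2))
    (hpnonneg : ∀ (t : ℝ) (x y : M), 0 ≤ p t x y) (x y : M) :
    green0 π p x y ≤
      ∫⁻ s in Ioi (0 : ℝ), ENNReal.ofReal (p s x y) * ENNReal.ofReal (C * s ^ (γ - 1)) := by
  unfold green0 subQ
  have hpxy : Measurable fun s : ℝ => p s x y :=
    hpmeas.comp (measurable_id.prodMk (measurable_const (a := (x, y))))
  rw [lintegral_lintegral_swap (by
    exact ((hpxy.comp measurable_snd).mul hπmeas).ennreal_ofReal.aemeasurable)]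
  refine setLIntegral_mono' measurableSet_Ioi fun s hs => ?_
  simp_rw [ENNReal.ofReal_mul (hpnonneg s x y)]
  rw [lintegral_const_mul' _ _ ENNReal.ofReal_ne_top]
  gcongr
  exact lintegral_density_le hC hs fun t ht => hπub t s ht hs

theorem green_upper_subordinate
    {M : Type*} [MetricSpace M] [MeasurableSpace M] [BorelSpace M]
    (μ : Measure M) (V : M → ℝ → ℝ)
    (hV : ∀ x r, V x r = (μ (Metric.ball x r)).toReal)
    (hVpos : ∀ (x : M) (r : ℝ), 0 < r → 0 < μ (Metric.ball x r) ∧ μ (Metric.ball x r) < ⊤)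
    (c₁ c₂ d₁ d₂ : ℝ) (hc₁ : 0 < c₁) (hc₂ : 0 < c₂) (hd₁ : 0 < d₁) (hd₁₂ : d₁ ≤ d₂)
    (hVscale : ∀ (x : M) (r R : ℝ), 0 < r → r < R →
      c₁ * (R / r) ^ d₁ ≤ V x R / V x r ∧ V x R / V x r ≤ c₂ * (R / r) ^ d₂)
    (φ : ℝ → ℝ) (hφmono : StrictMonoOn φ (Ici 0))
    (hφnonneg : ∀ r : ℝ, 0 ≤ r → 0 ≤ φ r) (hφ0 : φ 0 = 0) (hφ1 : φ 1 = 1)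
    (c₃ c₄ α₁ α₂ : ℝ) (hc₃ : 0 < c₃) (hc₄ : 0 < c₄) (hα₁ : 0 < α₁) (hα₁₂ : α₁ ≤ α₂)
    (hφscale : ∀ r R : ℝ, 0 < r → r < R →
      c₃ * (R / r) ^ α₁ ≤ φ R / φ r ∧ φ R / φ r ≤ c₄ * (R / r) ^ α₂)
    (φinv : ℝ → ℝ)
    (hφinvnonneg : ∀ t : ℝ, 0 ≤ t → 0 ≤ φinv t)
    (hφinvl : ∀ r : ℝ, 0 ≤ r → φinv (φ r) = r)
    (hφinvr : ∀ t : ℝ, 0 ≤ t → φ (φinv t) = t)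
    (γ : ℝ) (hγ0 : 0 < γ) (hγ1 : γ < 1)
    (π : ℝ → ℝ → ℝ) (hπmeas : Measurable (Function.uncurry π))
    (hπnonneg : ∀ t s : ℝ, 0 ≤ π t s)
    (C₁ C₂ : ℝ) (hC₁ : 0 < C₁) (hC₂ : 0 < C₂)
    (hπub : ∀ t s : ℝ, 0 < t → 0 < s → π t s ≤ C₁ * t / s ^ (1 + γ) * Real.exp (-t / s ^ γ))
    (hπlb : ∀ t s : ℝ, 0 < t → 0 < s → t ^ (1 / γ) ≤ s → C₂ * t / s ^ (1 + γ) ≤ π t s)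
    (p : ℝ → M → M → ℝ)
    (hpmeas : Measurable (fun z : ℝ × M × M => p z.1 z.2.1 z.2.2))
    (hpnonneg : ∀ (t : ℝ) (x y : M), 0 ≤ p t x y)
    (A : ℝ) (hA : 0 < A)
    (hWUHK : ∀ (t : ℝ) (x y : M), 0 < t →
      ENNReal.ofReal (p t x y) ≤ ENNReal.ofReal A *
        min ((ENNReal.ofReal (V x (φinv t)))⁻¹)
          (ENNReal.ofReal t /
            (ENNReal.ofReal (V x (dist x y)) * ENNReal.ofReal (φ (dist x y))))) :
    ∃ B : ℝ, 0 < B ∧ ∀ x y : M, x ≠ y →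
      green0 π p x y ≤ ENNReal.ofReal B *
        ∫⁻ t in Ioi ((φ (dist x y)) ^ γ),
          ENNReal.ofReal (1 / V x (φinv (t ^ (1 / γ)))) := by
  have hV0 : ∀ x r, 0 < r → 0 < V x r := fun x r hr => by
    rw [hV]; exact ENNReal.toReal_pos (hVpos x r hr).1.ne' (hVpos x r hr).2.ne
  have hVmono : ∀ x r R, r ≤ R → 0 < R → V x r ≤ V x R := fun x r R h hR => by
    rw [hV, hV]
    exact ENNReal.toReal_mono (hVpos x R hR).2.ne (measure_mono (Metric.ball_subset_ball h))
  have hφinvpos : ∀ t, 0 < t → 0 < φinv t := fun t ht => by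
    refine (hφinvnonneg t ht.le).lt_of_ne fun h => ?_
    have := hφinvr t ht.le
    rw [← h, hφ0] at this
    exact ht.ne this
  have hφinvmono : ∀ s t, 0 ≤ s → s ≤ t → φinv s ≤ φinv t := fun s t hs hst => by
    rw [← hφmono.le_iff_le (hφinvnonneg s hs) (hφinvnonneg t (hs.trans hst)), hφinvr s hs,
      hφinvr t (hs.trans hst)]
    exact hst
  set K : ℝ := c₂ * ((2 / c₃) ^ α₁⁻¹) ^ d₂ with hK
  have hK0 : 0 < K := by positivity
  have hdouble : ∀ x r, 0 < r → V x (φinv (2 * φ r)) ≤ K * V x r := fun x r hr => by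
    have hφr : 0 < φ r := hφ0 ▸ hφmono (mem_Ici.2 le_rfl) (mem_Ici.2 hr.le) hr
    set R := φinv (2 * φ r) with hR
    have hφR : φ R = 2 * φ r := hφinvr _ (by positivity)
    have hR0 : 0 < R := hφinvpos _ (by positivity)
    have hrR : r < R := by
      rw [← hφmono.lt_iff_lt (mem_Ici.2 hr.le) (mem_Ici.2 hR0.le), hφR]
      linarith
    have h1 := (hφscale r R hr hrR).1
    rw [hφR, mul_div_assoc, div_self hφr.ne', mul_one, ← le_div_iff₀' hc₃] at h1
    have h2 : R / r ≤ (2 / c₃) ^ α₁⁻¹ :=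
      (Real.le_rpow_inv_iff_of_pos (by positivity) (by positivity) hα₁).2 h1
    have h3 := (hVscale x r R hr hrR).2
    rw [div_le_iff₀ (hV0 x r hr)] at h3
    refine h3.trans ?_
    have := (hV0 x r hr).le
    have hd₂ : 0 ≤ d₂ := hd₁.le.trans hd₁₂
    rw [hK]
    gcongr
  have h2γ : 0 < (2 : ℝ) ^ γ - 1 := sub_pos.2 (Real.one_lt_rpow (by norm_num) hγ0)
  refine ⟨A * C₁ * K / (2 ^ γ - 1) + A * C₁ / γ, by positivity, fun x y hxy => ?_⟩
  have hd : 0 < dist x y := dist_pos.2 hxy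
  have hT : 0 < φ (dist x y) := hφ0 ▸ hφmono (mem_Ici.2 le_rfl) (mem_Ici.2 hd.le) hd
  have hdT := hdouble x _ hd
  have hVd := hV0 x _ hd
  have hp := fun s hs => hWUHK s x y hs
  set T := φ (dist x y)
  set v := V x (dist x y)
  have hTγ : 0 < T ^ γ := by positivity
  refine (green0_le_lintegral hC₁.le hπmeas hπub hpmeas hpnonneg x y).trans ?_
  rw [← Ioc_union_Ioi_eq_Ioi hT.le, ENNReal.ofReal_add (by positivity) (by positivity), add_mul]
  refine (lintegral_union_le _ _ _).trans (add_le_add ?_ ?_)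
  · have hlow : ENNReal.ofReal ((2 ^ γ - 1) * T ^ γ / (K * v)) ≤
        ∫⁻ t in Ioi (T ^ γ), ENNReal.ofReal (1 / V x (φinv (t ^ (1 / γ)))) := by
      calc ENNReal.ofReal ((2 ^ γ - 1) * T ^ γ / (K * v))
          = ∫⁻ _ in Ioc (T ^ γ) ((2 * T) ^ γ), ENNReal.ofReal (1 / (K * v)) := by
            rw [setLIntegral_const, Real.volume_Ioc, ← ENNReal.ofReal_mul (by positivity),
              Real.mul_rpow (by norm_num) hT.le]
            congr 1
            ring
        _ ≤ ∫⁻ t in Ioc (T ^ γ) ((2 * T) ^ γ),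
              ENNReal.ofReal (1 / V x (φinv (t ^ (1 / γ)))) := by
            refine setLIntegral_mono' measurableSet_Ioc fun t ht => ENNReal.ofReal_le_ofReal ?_
            have ht0 : 0 < t := hTγ.trans ht.1
            have htT : t ^ (1 / γ) ≤ 2 * T := by
              rw [one_div]
              exact (Real.rpow_inv_le_iff_of_pos ht0.le (by positivity) hγ0).2 ht.2
            refine one_div_le_one_div_of_le (hV0 _ _ (hφinvpos _ (by positivity)))
              ((hVmono _ _ _ ?_ (hφinvpos _ (by positivity))).trans hdT)
            exact hφinvmono _ _ (by positivity) htT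
        _ ≤ _ := lintegral_mono_set Ioc_subset_Ioi_self
    calc ∫⁻ s in Ioc 0 T, ENNReal.ofReal (p s x y) * ENNReal.ofReal (C₁ * s ^ (γ - 1))
        ≤ ∫⁻ _ in Ioc 0 T, ENNReal.ofReal (A * C₁ * T ^ γ / (v * T)) := by
          refine setLIntegral_mono' measurableSet_Ioc fun s hs => ?_
          have hs0 : 0 < s := hs.1
          have h1 : ENNReal.ofReal (p s x y) ≤ ENNReal.ofReal (A * (s / (v * T))) := by
            rw [ENNReal.ofReal_mul hA.le, ENNReal.ofReal_div_of_pos (by positivity),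
              ENNReal.ofReal_mul hVd.le]
            exact (hp s hs0).trans (by gcongr; exact min_le_right _ _)
          refine (mul_le_mul_left h1 _).trans ?_
          rw [← ENNReal.ofReal_mul (by positivity)]
          refine ENNReal.ofReal_le_ofReal ?_
          have h2 : s ^ γ ≤ T ^ γ := Real.rpow_le_rpow hs0.le hs.2 hγ0.le
          calc A * (s / (v * T)) * (C₁ * s ^ (γ - 1)) = A * C₁ * s ^ γ / (v * T) := by
                rw [Real.rpow_sub_one hs0.ne']
                field_simp
            _ ≤ _ := by gcongr
      _ = ENNReal.ofReal (A * C₁ * K / (2 ^ γ - 1)) *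
            ENNReal.ofReal ((2 ^ γ - 1) * T ^ γ / (K * v)) := by
          rw [setLIntegral_const, Real.volume_Ioc, ← ENNReal.ofReal_mul (by positivity),
            ← ENNReal.ofReal_mul (by positivity)]
          congr 1
          field_simp
          ring
      _ ≤ _ := by gcongr
  · rw [lintegral_Ioi_rpow_eq hγ0 hT, ← lintegral_const_mul' _ _ ENNReal.ofReal_ne_top]
    refine setLIntegral_mono' measurableSet_Ioi fun s hs => ?_
    have hs0 : 0 < s := hT.trans hs
    have hVs := hV0 x _ (hφinvpos s hs0)
    have h1 : ENNReal.ofReal (p s x y) ≤ ENNReal.ofReal (A * (1 / V x (φinv s))) := by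
      rw [ENNReal.ofReal_mul hA.le, one_div, ENNReal.ofReal_inv_of_pos hVs]
      exact (hp s hs0).trans (by gcongr; exact min_le_left _ _)
    refine (mul_le_mul_left h1 _).trans_eq ?_
    rw [one_div γ, Real.rpow_rpow_inv hs0.le hγ0.ne', ← ENNReal.ofReal_mul (by positivity),
      ← ENNReal.ofReal_mul (by positivity), ← ENNReal.ofReal_mul (by positivity)]
    congr 1
    field_simp
end

section
/- Suppose p satisfies the Hölder regularity condition (HR): there exist constants θ ∈ (0,1] and C > 0 such that |p(s,u,w) − p(s,v,w)| ≤ C / V(w, φ^{-1}(s)) · (d(u,v)/φ^{-1}(s))^{θ} for all s > 0 and u, v, w ∈ M. Then there exists a constant C' > 0 such that ∫₀^∞ |p(s,u,w) − p(s,v,w)| π_t(s) ds ≤ C' / V(w, (φ^γ)^{-1}(t)) · (d(u,v)/(φ^γ)^{-1}(t))^{θ} for all t > 0 and u, v, w ∈ M. -/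
open MeasureTheory Set

theorem exists_rpow_mul_exp_neg_rpow_le (a γ : ℝ) (hγ : 0 < γ) :
    ∃ N : ℝ, 0 < N ∧ ∀ x : ℝ, 1 ≤ x → x ^ a * Real.exp (-x ^ γ) ≤ N := by
  obtain ⟨n, hn⟩ := exists_nat_ge (a / γ)
  refine ⟨n.factorial, by positivity, fun x hx => ?_⟩
  have h1 : x ^ a ≤ (x ^ γ) ^ n := by
    rw [← Real.rpow_natCast, ← Real.rpow_mul (by linarith)]
    exact Real.rpow_le_rpow_of_exponent_le hx (by rw [div_le_iff₀ hγ] at hn; linarith)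
  have h2 := Real.pow_div_factorial_le_exp (x ^ γ) (by positivity) n
  rw [div_le_iff₀ (by positivity)] at h2
  rw [Real.exp_neg, ← div_eq_mul_inv, div_le_iff₀ (Real.exp_pos _)]
  linarith

theorem holder_subordinate
    {M : Type*} [MetricSpace M] [MeasurableSpace M] [BorelSpace M]
    (μ : Measure M) (V : M → ℝ → ℝ)
    (hV : ∀ x r, V x r = (μ (Metric.ball x r)).toReal)
    (hVpos : ∀ (x : M) (r : ℝ), 0 < r → 0 < μ (Metric.ball x r) ∧ μ (Metric.ball x r) < ⊤)
    (c₁ c₂ d₁ d₂ : ℝ) (hc₁ : 0 < c₁) (hc₂ : 0 < c₂) (hd₁ : 0 < d₁) (hd₁₂ : d₁ ≤ d₂)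
    (hVscale : ∀ (x : M) (r R : ℝ), 0 < r → r < R →
      c₁ * (R / r) ^ d₁ ≤ V x R / V x r ∧ V x R / V x r ≤ c₂ * (R / r) ^ d₂)
    (φ : ℝ → ℝ) (hφmono : StrictMonoOn φ (Ici 0))
    (hφnonneg : ∀ r : ℝ, 0 ≤ r → 0 ≤ φ r) (hφ0 : φ 0 = 0) (hφ1 : φ 1 = 1)
    (c₃ c₄ α₁ α₂ : ℝ) (hc₃ : 0 < c₃) (hc₄ : 0 < c₄) (hα₁ : 0 < α₁) (hα₁₂ : α₁ ≤ α₂)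
    (hφscale : ∀ r R : ℝ, 0 < r → r < R →
      c₃ * (R / r) ^ α₁ ≤ φ R / φ r ∧ φ R / φ r ≤ c₄ * (R / r) ^ α₂)
    (φinv : ℝ → ℝ)
    (hφinvnonneg : ∀ t : ℝ, 0 ≤ t → 0 ≤ φinv t)
    (hφinvl : ∀ r : ℝ, 0 ≤ r → φinv (φ r) = r)
    (hφinvr : ∀ t : ℝ, 0 ≤ t → φ (φinv t) = t)
    (γ : ℝ) (hγ0 : 0 < γ) (hγ1 : γ < 1)
    (π : ℝ → ℝ → ℝ) (hπmeas : Measurable (Function.uncurry π))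
    (hπnonneg : ∀ t s : ℝ, 0 ≤ π t s)
    (C₁ : ℝ) (hC₁ : 0 < C₁)
    (hπub : ∀ t s : ℝ, 0 < t → 0 < s → π t s ≤ C₁ * t / s ^ (1 + γ) * Real.exp (-t / s ^ γ))
    (p : ℝ → M → M → ℝ)
    (hpmeas : Measurable (fun z : ℝ × M × M => p z.1 z.2.1 z.2.2))
    (hpnonneg : ∀ (t : ℝ) (x y : M), 0 ≤ p t x y)
    (θ C : ℝ) (hθ0 : 0 < θ) (hθ1 : θ ≤ 1) (hC : 0 < C)
    (hHR : ∀ (s : ℝ) (u v w : M), 0 < s →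
      |p s u w - p s v w| ≤ C / V w (φinv s) * (dist u v / φinv s) ^ θ) :
    ∃ C' : ℝ, 0 < C' ∧ ∀ (t : ℝ) (u v w : M), 0 < t →
      (∫⁻ s in Ioi (0:ℝ), ENNReal.ofReal (|p s u w - p s v w| * π t s)) ≤
      ENNReal.ofReal (C' / V w (φinv (t ^ (1 / γ))) *
        (dist u v / φinv (t ^ (1 / γ))) ^ θ) := by
  have hinvpos : ∀ s : ℝ, 0 < s → 0 < φinv s := fun s hs => by
    refine lt_of_le_of_ne (hφinvnonneg s hs.le) fun h => ?_
    have := hφinvr s hs.le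
    rw [← h, hφ0] at this
    exact hs.ne this
  have hinvlt : ∀ s T : ℝ, 0 < s → s < T → φinv s < φinv T := fun s T hs hT => by
    rw [← hφmono.lt_iff_lt (hφinvnonneg s hs.le) (hφinvnonneg T (hs.trans hT).le),
      hφinvr s hs.le, hφinvr T (hs.trans hT).le]
    exact hT
  have hVp : ∀ (x : M) (r : ℝ), 0 < r → 0 < V x r := fun x r hr => by
    rw [hV]
    exact ENNReal.toReal_pos (hVpos x r hr).1.ne' (hVpos x r hr).2.ne
  have hVmono : ∀ (x : M) (r R : ℝ), 0 < r → r ≤ R → V x r ≤ V x R := fun x r R hr hR => by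
    rw [hV, hV]
    exact ENNReal.toReal_mono (hVpos x R (hr.trans_le hR)).2.ne
      (measure_mono (Metric.ball_subset_ball hR))
  obtain ⟨β, hβ⟩ : ∃ β, β = (d₂ + θ) / α₁ := ⟨_, rfl⟩
  obtain ⟨N, hN, hNle⟩ := exists_rpow_mul_exp_neg_rpow_le (β + (1 + γ)) γ hγ0
  obtain ⟨A, hA⟩ : ∃ A, A = C * c₂ * c₃⁻¹ ^ β * C₁ * N := ⟨_, rfl⟩
  have hApos : 0 < A := by rw [hA]; positivity
  refine ⟨A + C * C₁ / γ, by positivity, fun t u v w ht => ?_⟩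
  obtain ⟨T, hT⟩ : ∃ T, T = t ^ (1 / γ) := ⟨_, rfl⟩
  have hTpos : 0 < T := by rw [hT]; positivity
  have hTt : T ^ γ = t := by
    rw [hT, ← Real.rpow_mul ht.le, one_div_mul_cancel hγ0.ne', Real.rpow_one]
  rw [← hT]
  obtain ⟨R, hR⟩ : ∃ R, R = φinv T := ⟨_, rfl⟩
  have hRpos : 0 < R := hR ▸ hinvpos T hTpos
  have hVR := hVp w R hRpos
  rw [← hR]
  obtain ⟨D, hD⟩ : ∃ D, D = 1 / V w R * (dist u v / R) ^ θ := ⟨_, rfl⟩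
  have hD0 : 0 ≤ D := by rw [hD]; positivity
  have small : ∀ s ∈ Ioo 0 T, |p s u w - p s v w| * π t s ≤ A * D / T := by
    rintro s ⟨hs, hsT⟩
    have hr := hinvpos s hs
    have hrR : φinv s < R := hR ▸ hinvlt s T hs hsT
    have hVr := hVp w _ hr
    obtain ⟨x, hx⟩ : ∃ x, x = T / s := ⟨_, rfl⟩
    have hx1 : 1 ≤ x := by rw [hx, one_le_div hs]; exact hsT.le
    have hx0 : 0 < x := by linarith
    obtain ⟨q, hq⟩ : ∃ q, q = R / φinv s := ⟨_, rfl⟩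
    have hq0 : 0 < q := by rw [hq]; positivity
    have hqx : q ^ (d₂ + θ) ≤ c₃⁻¹ ^ β * x ^ β := by
      have h := (hφscale _ _ hr hrR).1
      rw [← hq, hφinvr s hs.le, hR, hφinvr T hTpos.le, ← hx] at h
      have h' : q ^ α₁ ≤ c₃⁻¹ * x := by
        rw [inv_mul_eq_div, le_div_iff₀ hc₃]; linarith
      rw [← Real.mul_rpow (by positivity) hx0.le]
      calc q ^ (d₂ + θ) = (q ^ α₁) ^ β := by
            rw [← Real.rpow_mul hq0.le, hβ, mul_div_cancel₀ _ hα₁.ne']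
        _ ≤ _ := Real.rpow_le_rpow (by positivity) h'
            (by rw [hβ]; exact div_nonneg (by linarith) hα₁.le)
    have hVq : 1 / V w (φinv s) ≤ c₂ * q ^ d₂ / V w R := by
      have h := (hVscale w _ _ hr hrR).2
      rw [← hq, div_le_iff₀ hVr] at h
      rw [div_le_div_iff₀ hVr hVR]
      linarith
    have hdq : (dist u v / φinv s) ^ θ = (dist u v / R) ^ θ * q ^ θ := by
      rw [← Real.mul_rpow (by positivity) hq0.le, hq]
      congr 1
      field_simp
    have hp : |p s u w - p s v w| ≤ C * c₂ * c₃⁻¹ ^ β * D * x ^ β := by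
      calc |p s u w - p s v w| ≤ C / V w (φinv s) * (dist u v / φinv s) ^ θ := hHR s u v w hs
        _ = C * (1 / V w (φinv s)) * ((dist u v / R) ^ θ * q ^ θ) := by rw [hdq]; ring
        _ ≤ C * (c₂ * q ^ d₂ / V w R) * ((dist u v / R) ^ θ * q ^ θ) := by gcongr
        _ = C * c₂ * D * q ^ (d₂ + θ) := by rw [hD, Real.rpow_add hq0]; ring
        _ ≤ C * c₂ * D * (c₃⁻¹ ^ β * x ^ β) := by gcongr
        _ = _ := by ring
    have hπ : π t s ≤ C₁ / T * (x ^ (1 + γ) * Real.exp (-x ^ γ)) := by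
      refine (hπub t s ht hs).trans_eq ?_
      have e1 : t / s ^ γ = x ^ γ := by rw [hx, Real.div_rpow hTpos.le hs.le, hTt]
      rw [neg_div, e1, hx, Real.div_rpow hTpos.le hs.le (1 + γ), Real.rpow_add hTpos,
        Real.rpow_one, hTt]
      field_simp
    calc |p s u w - p s v w| * π t s
        ≤ (C * c₂ * c₃⁻¹ ^ β * D * x ^ β) * (C₁ / T * (x ^ (1 + γ) * Real.exp (-x ^ γ))) :=
          mul_le_mul hp hπ (hπnonneg t s) (by positivity)
      _ = C * c₂ * c₃⁻¹ ^ β * D * (C₁ / T) * (x ^ (β + (1 + γ)) * Real.exp (-x ^ γ)) := by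
          rw [Real.rpow_add hx0 β]; ring
      _ ≤ C * c₂ * c₃⁻¹ ^ β * D * (C₁ / T) * N := by gcongr; exact hNle x hx1
      _ = A * D / T := by rw [hA]; ring
  have large : ∀ s ∈ Ioi T,
      |p s u w - p s v w| * π t s ≤ C * D * C₁ * t * s ^ (-(1 + γ)) := by
    intro s hsT
    have hs : 0 < s := hTpos.trans hsT
    have hr := hinvpos s hs
    have hRr : R < φinv s := hR ▸ hinvlt T s hTpos hsT
    have hp : |p s u w - p s v w| ≤ C * D := by
      calc |p s u w - p s v w| ≤ C / V w (φinv s) * (dist u v / φinv s) ^ θ := hHR s u v w hs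
        _ ≤ C / V w R * (dist u v / R) ^ θ := by
          gcongr
          exact hVmono w _ _ hRpos hRr.le
        _ = C * D := by rw [hD]; ring
    have hπ : π t s ≤ C₁ * t * s ^ (-(1 + γ)) := by
      rw [Real.rpow_neg hs.le, ← div_eq_mul_inv]
      refine (hπub t s ht hs).trans (mul_le_of_le_one_right (by positivity) ?_)
      rw [Real.exp_le_one_iff, neg_div, neg_nonpos]
      positivity
    calc |p s u w - p s v w| * π t s ≤ (C * D) * (C₁ * t * s ^ (-(1 + γ))) :=
          mul_le_mul hp hπ (hπnonneg t s) (by positivity)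
      _ = _ := by ring
  have hint : IntegrableOn (fun s : ℝ => C * D * C₁ * t * s ^ (-(1 + γ))) (Ioi T) :=
    (integrableOn_Ioi_rpow_of_lt (by linarith) hTpos).const_mul _
  have Iint : ∫ s in Ioi T, C * D * C₁ * t * s ^ (-(1 + γ)) = C * C₁ / γ * D := by
    rw [integral_const_mul, integral_Ioi_rpow_of_lt (by linarith) hTpos,
      show -(1 + γ) + 1 = -γ by ring, Real.rpow_neg hTpos.le, hTt]
    field_simp
  calc (∫⁻ s in Ioi (0 : ℝ), ENNReal.ofReal (|p s u w - p s v w| * π t s))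
      = ∫⁻ s in Ioo 0 T ∪ Ici T, ENNReal.ofReal (|p s u w - p s v w| * π t s) := by
        rw [Ioo_union_Ici_eq_Ioi hTpos]
    _ ≤ (∫⁻ s in Ioo 0 T, ENNReal.ofReal (|p s u w - p s v w| * π t s)) +
          ∫⁻ s in Ici T, ENNReal.ofReal (|p s u w - p s v w| * π t s) :=
        lintegral_union_le _ _ _
    _ = (∫⁻ s in Ioo 0 T, ENNReal.ofReal (|p s u w - p s v w| * π t s)) +
          ∫⁻ s in Ioi T, ENNReal.ofReal (|p s u w - p s v w| * π t s) := by
        rw [restrict_Ioi_eq_restrict_Ici]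
    _ ≤ (∫⁻ _ in Ioo 0 T, ENNReal.ofReal (A * D / T)) +
          ∫⁻ s in Ioi T, ENNReal.ofReal (C * D * C₁ * t * s ^ (-(1 + γ))) :=
        add_le_add
          (setLIntegral_mono' measurableSet_Ioo fun s hs => ENNReal.ofReal_le_ofReal (small s hs))
          (setLIntegral_mono' measurableSet_Ioi fun s hs => ENNReal.ofReal_le_ofReal (large s hs))
    _ = ENNReal.ofReal (A * D) + ENNReal.ofReal (C * C₁ / γ * D) := by
        congr 1
        · rw [setLIntegral_const, Real.volume_Ioo, ← ENNReal.ofReal_mul (by positivity), sub_zero,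
            div_mul_cancel₀ _ hTpos.ne']
        · rw [← Iint, ofReal_integral_eq_lintegral_ofReal hint]
          refine (ae_restrict_iff' measurableSet_Ioi).2 (.of_forall fun s hs => ?_)
          have : 0 < s := hTpos.trans hs
          positivity
    _ = ENNReal.ofReal ((A + C * C₁ / γ) / V w R * (dist u v / R) ^ θ) := by
        rw [← ENNReal.ofReal_add (by positivity) (by positivity), hD]
        congr 1
        ring
end

section
/- Suppose each pⁱ (i = 1,2) satisfies the near-diagonal lower bound (NDLHK): there are constants c₀, a > 0 with pⁱ(t,u,v) ≥ a / V(u, φᵢ^{-1}(t)) for all t > 0 and u, v ∈ M with d(u,v) ≤ c₀ φᵢ^{-1}(t). Then there exist constants b₁, b₂ > 0 such that for all x = (x₁,x₂), y = (y₁,y₂) ∈ M × M: if φ_d(x,y) ≤ 1 then u₁^γ(x,y) ≥ b₁ ∫_{φ_d^γ(x,y)}^∞ e^{-t} / (V(x₁, (φ₁^γ)^{-1}(t)) V(x₂, (φ₂^γ)^{-1}(t))) dt, and if φ_d(x,y) ≥ 1 then u₁^γ(x,y) ≥ b₂ / (V(x₁, φ₁^{-1}(φ_d(x,y))) V(x₂,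 φ₂^{-1}(φ_d(x,y))) φ_d^γ(x,y)). -/
open MeasureTheory Set

noncomputable def subQ2 {M : Type*} (π : ℝ → ℝ → ℝ) (p1 p2 : ℝ → M → M → ℝ)
    (t : ℝ) (x y : M × M) : ENNReal :=
  ∫⁻ s in Set.Ioi (0:ℝ), ENNReal.ofReal (p1 s x.1 y.1 * p2 s x.2 y.2 * π t s)

noncomputable def phid {M : Type*} [MetricSpace M] (φ₁ φ₂ : ℝ → ℝ) (x y : M × M) : ℝ :=
  max (φ₁ (dist x.1 y.1)) (φ₂ (dist x.2 y.2))

noncomputable def resolvent2 {M : Type*} (π : ℝ → ℝ → ℝ) (p1 p2 : ℝ → M → M → ℝ)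
    (x y : M × M) : ENNReal :=
  ∫⁻ t in Set.Ioi (0:ℝ), ENNReal.ofReal (Real.exp (-t)) * subQ2 π p1 p2 t x y

/-- The scaling upper bound of `φ` turns `K * φ r ≤ s` into `r ≤ c₀ * φ⁻¹ s` for large `K`. -/
theorem exists_le_mul_inv_of_mul_le {φ ψ : ℝ → ℝ} {c₄ α₂ c₀ : ℝ}
    (hmono : StrictMonoOn φ (Ici 0)) (h0 : φ 0 = 0) (hc₄ : 0 < c₄) (hα₂ : 0 < α₂)
    (hscale : ∀ r R : ℝ, 0 < r → r < R → φ R / φ r ≤ c₄ * (R / r) ^ α₂)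
    (hψ : ∀ t : ℝ, 0 ≤ t → 0 ≤ ψ t) (hφψ : ∀ t : ℝ, 0 ≤ t → φ (ψ t) = t) (hc₀ : 0 < c₀) :
    ∃ K : ℝ, 1 ≤ K ∧ ∀ r s : ℝ, 0 ≤ r → 0 < s → K * φ r ≤ s → r ≤ c₀ * ψ s := by
  have hpow : 0 < c₄ * (1 / c₀) ^ α₂ := by positivity
  refine ⟨1 + c₄ * (1 / c₀) ^ α₂, by linarith, fun r s hr hs hK => ?_⟩
  by_contra! hlt
  have hR := hψ s hs.le
  have hr0 : 0 < r := lt_of_le_of_lt (by positivity) hlt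
  have hφr : 0 < φ r := h0 ▸ hmono self_mem_Ici hr hr0
  have hφlt : φ r < φ (ψ s) := by
    rw [hφψ s hs.le]
    nlinarith [mul_pos hpow hφr]
  have hrR : r < ψ s := (hmono.lt_iff_lt hr hR).1 hφlt
  have h1 := hscale r (ψ s) hr0 hrR
  have h2 : ψ s / r ≤ 1 / c₀ := by
    rw [div_le_div_iff₀ hr0 hc₀]
    linarith
  have h3 : (ψ s / r) ^ α₂ ≤ (1 / c₀) ^ α₂ := by gcongr
  have h4 : 1 + c₄ * (1 / c₀) ^ α₂ ≤ φ (ψ s) / φ r := by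
    rw [hφψ s hs.le, le_div_iff₀ hφr]
    exact hK
  nlinarith [mul_le_mul_of_nonneg_left h3 hc₄.le]

/-- The scaling lower bound of `φ` makes its inverse doubling. -/
theorem exists_inv_le_mul_inv {φ ψ : ℝ → ℝ} {c₃ α₁ : ℝ} (h0 : φ 0 = 0)
    (hc₃ : 0 < c₃) (hα₁ : 0 < α₁)
    (hscale : ∀ r R : ℝ, 0 < r → r < R → c₃ * (R / r) ^ α₁ ≤ φ R / φ r)
    (hψ : ∀ t : ℝ, 0 ≤ t → 0 ≤ ψ t) (hφψ : ∀ t : ℝ, 0 ≤ t → φ (ψ t) = t)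
    {K : ℝ} (hK : 0 < K) :
    ∃ C : ℝ, 0 < C ∧ ∀ τ s : ℝ, 0 < τ → 0 < s → s ≤ K * τ → ψ s ≤ C * ψ τ := by
  have hpow : 0 < (K / c₃) ^ (1 / α₁) := by positivity
  refine ⟨1 + (K / c₃) ^ (1 / α₁), by linarith, fun τ s hτ hs hle => ?_⟩
  have hr : 0 < ψ τ := (hψ τ hτ.le).lt_of_ne fun h => by
    have := hφψ τ hτ.le
    rw [← h, h0] at this
    exact hτ.ne this
  rcases le_or_gt (ψ s) (ψ τ) with h | h
  · nlinarith [mul_pos hpow hr]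
  have h1 := hscale _ _ hr h
  rw [hφψ s hs.le, hφψ τ hτ.le] at h1
  have h2 : (ψ s / ψ τ) ^ α₁ ≤ K / c₃ := by
    rw [le_div_iff₀ hc₃]
    have : s / τ ≤ K := (div_le_iff₀ hτ).2 hle
    linarith
  have hq : 0 ≤ ψ s / ψ τ := div_nonneg (hψ s hs.le) hr.le
  have h3 : ψ s / ψ τ ≤ (K / c₃) ^ (1 / α₁) := by
    rw [one_div]
    exact (Real.le_rpow_inv_iff_of_pos hq (by positivity) hα₁).2 h2
  rw [div_le_iff₀ hr] at h3
  linarith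

/-- Volumes of balls with comparable radii are comparable. -/
theorem exists_volume_le_mul_volume {M : Type*} {V : M → ℝ → ℝ} {c₂ d₂ : ℝ} (hc₂ : 0 < c₂)
    (hd₂ : 0 < d₂) (hpos : ∀ x r, 0 < r → 0 < V x r)
    (hmono : ∀ x r R, 0 < r → r ≤ R → V x r ≤ V x R)
    (hscale : ∀ (x : M) (r R : ℝ), 0 < r → r < R → V x R / V x r ≤ c₂ * (R / r) ^ d₂)
    {C : ℝ} (hC : 0 < C) :
    ∃ C' : ℝ, 0 < C' ∧ ∀ x r R, 0 < r → 0 < R → R ≤ C * r → V x R ≤ C' * V x r := by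
  have hpow : 0 < c₂ * C ^ d₂ := by positivity
  refine ⟨1 + c₂ * C ^ d₂, by linarith, fun x r R hr hR hle => ?_⟩
  have hVr := hpos x r hr
  rcases le_or_gt R r with h | h
  · nlinarith [hmono x R r hR h, mul_pos hpow hVr]
  have h1 := hscale x r R hr h
  rw [div_le_iff₀ hVr] at h1
  have h2 : R / r ≤ C := (div_le_iff₀ hr).2 hle
  have h3 : (R / r) ^ d₂ ≤ C ^ d₂ := by gcongr
  have h4 : c₂ * (R / r) ^ d₂ * V x r ≤ c₂ * C ^ d₂ * V x r := by gcongr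
  linarith

/-- A near-diagonal lower bound gives a lower bound on the time window `[K * τ, 2 * K * τ]` for all
points at scale at most `τ`, in terms of the volume at scale `τ`. -/
theorem exists_kernel_lower_of_nearDiagonal {M : Type*} [MetricSpace M] {V : M → ℝ → ℝ}
    {c₂ d₂ : ℝ} (hc₂ : 0 < c₂) (hd₂ : 0 < d₂) (hpos : ∀ x r, 0 < r → 0 < V x r)
    (hVmono : ∀ x r R, 0 < r → r ≤ R → V x r ≤ V x R)
    (hVscale : ∀ (x : M) (r R : ℝ), 0 < r → r < R → V x R / V x r ≤ c₂ * (R / r) ^ d₂)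
    {φ ψ : ℝ → ℝ} {c₃ c₄ α₁ α₂ c₀ a : ℝ}
    (hmono : StrictMonoOn φ (Ici 0)) (h0 : φ 0 = 0) (hc₃ : 0 < c₃) (hc₄ : 0 < c₄)
    (hα₁ : 0 < α₁) (hα₂ : 0 < α₂)
    (hscale : ∀ r R : ℝ, 0 < r → r < R →
      c₃ * (R / r) ^ α₁ ≤ φ R / φ r ∧ φ R / φ r ≤ c₄ * (R / r) ^ α₂)
    (hψ : ∀ t : ℝ, 0 ≤ t → 0 ≤ ψ t) (hφψ : ∀ t : ℝ, 0 ≤ t → φ (ψ t) = t)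
    (hc₀ : 0 < c₀) (ha : 0 < a) {p : ℝ → M → M → ℝ}
    (hp : ∀ (t : ℝ) (u v : M), 0 < t → dist u v ≤ c₀ * ψ t → a / V u (ψ t) ≤ p t u v) :
    ∃ K₀ : ℝ, 1 ≤ K₀ ∧ ∀ K, K₀ ≤ K → ∃ A : ℝ, 0 < A ∧ ∀ (u v : M) (τ s : ℝ), 0 < τ →
      φ (dist u v) ≤ τ → K * τ ≤ s → s ≤ 2 * K * τ → A / V u (ψ τ) ≤ p s u v := by
  obtain ⟨K₀, hK₀, hnear⟩ := exists_le_mul_inv_of_mul_le hmono h0 hc₄ hα₂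
    (fun r R hr h => (hscale r R hr h).2) hψ hφψ hc₀
  refine ⟨K₀, hK₀, fun K hK => ?_⟩
  have hKpos : 0 < K := by linarith
  obtain ⟨C, hC, hinv⟩ := exists_inv_le_mul_inv h0 hc₃ hα₁
    (fun r R hr h => (hscale r R hr h).1) hψ hφψ (K := 2 * K) (by positivity)
  obtain ⟨C', hC', hvol⟩ := exists_volume_le_mul_volume hc₂ hd₂ hpos hVmono hVscale hC
  have hψpos : ∀ t, 0 < t → 0 < ψ t := fun t ht => (hψ t ht.le).lt_of_ne fun h => by
    have := hφψ t ht.le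
    rw [← h, h0] at this
    exact ht.ne this
  refine ⟨a / C', by positivity, fun u v τ s hτ hd hs1 hs2 => ?_⟩
  have hs : 0 < s := lt_of_lt_of_le (by positivity) hs1
  have hdist : dist u v ≤ c₀ * ψ s := by
    refine hnear _ _ dist_nonneg hs (le_trans ?_ hs1)
    exact (mul_le_mul_of_nonneg_left hd (by linarith)).trans
      (mul_le_mul_of_nonneg_right hK hτ.le)
  refine le_trans ?_ (hp s u v hs hdist)
  rw [div_div]
  exact div_le_div_of_nonneg_left ha.le (hpos _ _ (hψpos s hs))
    (hvol u _ _ (hψpos τ hτ) (hψpos s hs) (hinv τ s hτ hs hs2))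

/-- Lower bound for the subordinate kernel from a lower bound for the kernel on a time window. -/
theorem ofReal_le_subQ2 {M : Type*} {π : ℝ → ℝ → ℝ} {p1 p2 : ℝ → M → M → ℝ} {γ C₂ : ℝ}
    (hγ : 0 < γ) (hC₂ : 0 < C₂)
    (hπ : ∀ t s : ℝ, 0 < t → 0 < s → t ^ (1 / γ) ≤ s → C₂ * t / s ^ (1 + γ) ≤ π t s)
    {K τ t B₁ B₂ : ℝ} (hK : 1 ≤ K) (hτ : 0 < τ) (ht : 0 < t) (htτ : t ≤ τ ^ γ)
    (hB₁ : 0 ≤ B₁) (hB₂ : 0 ≤ B₂) {x y : M × M}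
    (h1 : ∀ s, K * τ ≤ s → s ≤ 2 * K * τ → B₁ ≤ p1 s x.1 y.1)
    (h2 : ∀ s, K * τ ≤ s → s ≤ 2 * K * τ → B₂ ≤ p2 s x.2 y.2) :
    ENNReal.ofReal (B₁ * B₂ * (C₂ * K / (2 * K) ^ (1 + γ)) * (t / τ ^ γ)) ≤
      subQ2 π p1 p2 t x y := by
  have hKτ : 0 < K * τ := by positivity
  have hτK : τ ≤ K * τ := le_mul_of_one_le_left hτ.le hK
  have hwindow : ∀ s ∈ Icc (K * τ) (2 * K * τ),
      ENNReal.ofReal (B₁ * B₂ * (C₂ * t / (2 * K * τ) ^ (1 + γ))) ≤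
        ENNReal.ofReal (p1 s x.1 y.1 * p2 s x.2 y.2 * π t s) := by
    rintro s ⟨hs1, hs2⟩
    have hs : 0 < s := hKτ.trans_le hs1
    have hts : t ^ (1 / γ) ≤ s := by
      rw [one_div]
      exact ((Real.rpow_inv_le_iff_of_pos ht.le hτ.le hγ).2 htτ).trans (hτK.trans hs1)
    have hπs : C₂ * t / (2 * K * τ) ^ (1 + γ) ≤ π t s := by
      refine le_trans ?_ (hπ t s ht hs hts)
      gcongr
    have hp1 := h1 s hs1 hs2
    have hp2 := h2 s hs1 hs2
    have hp1' := hB₁.trans hp1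
    apply ENNReal.ofReal_le_ofReal
    gcongr
    exact mul_nonneg hp1' (hB₂.trans hp2)
  calc
    _ = ENNReal.ofReal (B₁ * B₂ * (C₂ * t / (2 * K * τ) ^ (1 + γ))) *
        volume (Icc (K * τ) (2 * K * τ)) := by
      rw [Real.volume_Icc, ← ENNReal.ofReal_mul (by positivity)]
      congr 1
      rw [Real.mul_rpow (by positivity) hτ.le, Real.rpow_add hτ, Real.rpow_one]
      field_simp
      ring
    _ = ∫⁻ _ in Icc (K * τ) (2 * K * τ),
          ENNReal.ofReal (B₁ * B₂ * (C₂ * t / (2 * K * τ) ^ (1 + γ))) :=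
      (setLIntegral_const _ _).symm
    _ ≤ ∫⁻ s in Icc (K * τ) (2 * K * τ),
          ENNReal.ofReal (p1 s x.1 y.1 * p2 s x.2 y.2 * π t s) :=
      setLIntegral_mono' measurableSet_Icc hwindow
    _ ≤ subQ2 π p1 p2 t x y :=
      lintegral_mono_set fun s hs => hKτ.trans_le hs.1

theorem prod_resolvent_lower
    {M : Type*} [MetricSpace M] [MeasurableSpace M] [BorelSpace M]
    (μ : Measure M) (V : M → ℝ → ℝ)
    (hV : ∀ x r, V x r = (μ (Metric.ball x r)).toReal)
    (hVpos : ∀ (x : M) (r : ℝ), 0 < r → 0 < μ (Metric.ball x r) ∧ μ (Metric.ball x r) < ⊤)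
    (c₁ c₂ d₁ d₂ : ℝ) (hc₁ : 0 < c₁) (hc₂ : 0 < c₂) (hd₁ : 0 < d₁) (hd₁₂ : d₁ ≤ d₂)
    (hVscale : ∀ (x : M) (r R : ℝ), 0 < r → r < R →
      c₁ * (R / r) ^ d₁ ≤ V x R / V x r ∧ V x R / V x r ≤ c₂ * (R / r) ^ d₂)
    (φ₁ φ₂ : ℝ → ℝ)
    (hφ₁mono : StrictMonoOn φ₁ (Ici 0)) (hφ₂mono : StrictMonoOn φ₂ (Ici 0))
    (hφ₁nonneg : ∀ r : ℝ, 0 ≤ r → 0 ≤ φ₁ r) (hφ₂nonneg : ∀ r : ℝ, 0 ≤ r → 0 ≤ φ₂ r)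
    (hφ₁0 : φ₁ 0 = 0) (hφ₂0 : φ₂ 0 = 0) (hφ₁1 : φ₁ 1 = 1) (hφ₂1 : φ₂ 1 = 1)
    (c₃ c₄ α₁ α₂ : ℝ) (hc₃ : 0 < c₃) (hc₄ : 0 < c₄) (hα₁ : 0 < α₁) (hα₁₂ : α₁ ≤ α₂)
    (hφ₁scale : ∀ r R : ℝ, 0 < r → r < R →
      c₃ * (R / r) ^ α₁ ≤ φ₁ R / φ₁ r ∧ φ₁ R / φ₁ r ≤ c₄ * (R / r) ^ α₂)
    (hφ₂scale : ∀ r R : ℝ, 0 < r → r < R →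
      c₃ * (R / r) ^ α₁ ≤ φ₂ R / φ₂ r ∧ φ₂ R / φ₂ r ≤ c₄ * (R / r) ^ α₂)
    (φ₁inv φ₂inv : ℝ → ℝ)
    (hφ₁invnonneg : ∀ t : ℝ, 0 ≤ t → 0 ≤ φ₁inv t) (hφ₂invnonneg : ∀ t : ℝ, 0 ≤ t → 0 ≤ φ₂inv t)
    (hφ₁invl : ∀ r : ℝ, 0 ≤ r → φ₁inv (φ₁ r) = r) (hφ₂invl : ∀ r : ℝ, 0 ≤ r → φ₂inv (φ₂ r) = r)
    (hφ₁invr : ∀ t : ℝ, 0 ≤ t → φ₁ (φ₁inv t) = t) (hφ₂invr : ∀ t : ℝ, 0 ≤ t → φ₂ (φ₂inv t) = t)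
    (γ : ℝ) (hγ0 : 0 < γ) (hγ1 : γ < 1)
    (π : ℝ → ℝ → ℝ) (hπmeas : Measurable (Function.uncurry π))
    (hπnonneg : ∀ t s : ℝ, 0 ≤ π t s)
    (C₁ C₂ : ℝ) (hC₁ : 0 < C₁) (hC₂ : 0 < C₂)
    (hπub : ∀ t s : ℝ, 0 < t → 0 < s → π t s ≤ C₁ * t / s ^ (1 + γ) * Real.exp (-t / s ^ γ))
    (hπlb : ∀ t s : ℝ, 0 < t → 0 < s → t ^ (1 / γ) ≤ s → C₂ * t / s ^ (1 + γ) ≤ π t s)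
    (p1 p2 : ℝ → M → M → ℝ)
    (hp1meas : Measurable (fun z : ℝ × M × M => p1 z.1 z.2.1 z.2.2))
    (hp2meas : Measurable (fun z : ℝ × M × M => p2 z.1 z.2.1 z.2.2))
    (hp1nonneg : ∀ (t : ℝ) (x y : M), 0 ≤ p1 t x y)
    (hp2nonneg : ∀ (t : ℝ) (x y : M), 0 ≤ p2 t x y)
    (c₀ a : ℝ) (hc₀ : 0 < c₀) (ha : 0 < a)
    (hNDL1 : ∀ (t : ℝ) (u v : M), 0 < t → dist u v ≤ c₀ * φ₁inv t →
      a / V u (φ₁inv t) ≤ p1 t u v)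
    (hNDL2 : ∀ (t : ℝ) (u v : M), 0 < t → dist u v ≤ c₀ * φ₂inv t →
      a / V u (φ₂inv t) ≤ p2 t u v) :
    ∃ b₁ b₂ : ℝ, 0 < b₁ ∧ 0 < b₂ ∧ ∀ x y : M × M,
      (phid φ₁ φ₂ x y ≤ 1 →
        ENNReal.ofReal b₁ *
          (∫⁻ t in Ioi ((phid φ₁ φ₂ x y) ^ γ),
            ENNReal.ofReal (Real.exp (-t) /
              (V x.1 (φ₁inv (t ^ (1 / γ))) * V x.2 (φ₂inv (t ^ (1 / γ)))))) ≤
        resolvent2 π p1 p2 x y) ∧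
      (1 ≤ phid φ₁ φ₂ x y →
        ENNReal.ofReal (b₂ /
          (V x.1 (φ₁inv (phid φ₁ φ₂ x y)) * V x.2 (φ₂inv (phid φ₁ φ₂ x y)) *
            (phid φ₁ φ₂ x y) ^ γ)) ≤
        resolvent2 π p1 p2 x y) := by
  have hVpos' : ∀ x r, 0 < r → 0 < V x r := fun x r hr => by
    rw [hV]
    exact ENNReal.toReal_pos (hVpos x r hr).1.ne' (hVpos x r hr).2.ne
  have hVmono : ∀ x r R, 0 < r → r ≤ R → V x r ≤ V x R := fun x r R hr hrR => by
    rw [hV, hV]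
    exact ENNReal.toReal_mono (hVpos x R (hr.trans_le hrR)).2.ne
      (measure_mono (Metric.ball_subset_ball hrR))
  have hVup := fun x r R hr h => (hVscale x r R hr h).2
  have hVnonneg : ∀ x r, 0 ≤ V x r := fun x r => by
    rw [hV]
    exact ENNReal.toReal_nonneg
  obtain ⟨K₁, hK₁, hp1⟩ := exists_kernel_lower_of_nearDiagonal hc₂ (hd₁.trans_le hd₁₂) hVpos' hVmono
    hVup hφ₁mono hφ₁0 hc₃ hc₄ hα₁ (hα₁.trans_le hα₁₂) hφ₁scale hφ₁invnonneg hφ₁invr hc₀ ha hNDL1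
  obtain ⟨K₂, hK₂, hp2⟩ := exists_kernel_lower_of_nearDiagonal hc₂ (hd₁.trans_le hd₁₂) hVpos' hVmono
    hVup hφ₂mono hφ₂0 hc₃ hc₄ hα₁ (hα₁.trans_le hα₁₂) hφ₂scale hφ₂invnonneg hφ₂invr hc₀ ha hNDL2
  set K := max K₁ K₂
  have hK : 1 ≤ K := hK₁.trans (le_max_left _ _)
  obtain ⟨A₁, hA₁, hp1⟩ := hp1 K (le_max_left _ _)
  obtain ⟨A₂, hA₂, hp2⟩ := hp2 K (le_max_right _ _)
  set b := A₁ * A₂ * (C₂ * K / (2 * K) ^ (1 + γ)) with hb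
  have hbpos : 0 < b := by positivity
  have hq : ∀ (x y : M × M) (τ t : ℝ), phid φ₁ φ₂ x y ≤ τ → 0 < τ → 0 < t → t ≤ τ ^ γ →
      ENNReal.ofReal (b * (t / τ ^ γ) / (V x.1 (φ₁inv τ) * V x.2 (φ₂inv τ))) ≤
        subQ2 π p1 p2 t x y := fun x y τ t hD hτ ht htτ => by
    have h := ofReal_le_subQ2 hγ0 hC₂ hπlb hK hτ ht htτ
      (div_nonneg hA₁.le (hVnonneg x.1 (φ₁inv τ))) (div_nonneg hA₂.le (hVnonneg x.2 (φ₂inv τ)))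
      (fun s => hp1 x.1 y.1 τ s hτ ((le_max_left _ _).trans hD))
      (fun s => hp2 x.2 y.2 τ s hτ ((le_max_right _ _).trans hD))
    convert h using 2
    rw [hb, div_mul_div_comm]
    ring
  refine ⟨b, b * (Real.exp (-1) * (1 / 2) * (1 / 2)), hbpos, by positivity, fun x y => ?_⟩
  set D := phid φ₁ φ₂ x y with hDdef
  have hD0 : 0 ≤ D := (hφ₁nonneg _ dist_nonneg).trans (le_max_left _ _)
  constructor
  · intro _
    rw [← lintegral_const_mul' _ _ ENNReal.ofReal_ne_top]
    have hsub : Ioi (D ^ γ) ⊆ Ioi 0 := Ioi_subset_Ioi (Real.rpow_nonneg hD0 γ)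
    refine le_trans (setLIntegral_mono' measurableSet_Ioi fun t ht => ?_)
      (lintegral_mono_set hsub)
    have ht0 : 0 < t := hsub ht
    have hDt : D ≤ t ^ (1 / γ) := by
      rw [one_div]
      exact (Real.le_rpow_inv_iff_of_pos hD0 ht0.le hγ0).2 (le_of_lt ht)
    have htt : (t ^ (1 / γ)) ^ γ = t := by
      rw [one_div, Real.rpow_inv_rpow ht0.le hγ0.ne']
    have h := hq x y (t ^ (1 / γ)) t hDt (by positivity) ht0 htt.ge
    rw [htt, div_self ht0.ne', mul_one] at h
    refine le_trans (le_of_eq ?_) (mul_le_mul_right h _)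
    rw [← ENNReal.ofReal_mul hbpos.le, ← ENNReal.ofReal_mul (Real.exp_pos _).le]
    congr 1
    ring
  · intro hD1
    have hDpos : 0 < D := by linarith
    have hDγ : 1 ≤ D ^ γ := Real.one_le_rpow hD1 hγ0.le
    set W := V x.1 (φ₁inv D) * V x.2 (φ₂inv D)
    have hW : 0 ≤ W := mul_nonneg (hVnonneg _ _) (hVnonneg _ _)
    calc
      _ = ENNReal.ofReal (Real.exp (-1) * (b * ((1 / 2) / D ^ γ) / W)) *
          volume (Icc (1 / 2 : ℝ) 1) := by
        rw [Real.volume_Icc, ← ENNReal.ofReal_mul (by positivity)]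
        congr 1
        field_simp
        norm_num
      _ = ∫⁻ _ in Icc (1 / 2 : ℝ) 1,
            ENNReal.ofReal (Real.exp (-1) * (b * ((1 / 2) / D ^ γ) / W)) :=
        (setLIntegral_const _ _).symm
      _ ≤ ∫⁻ t in Icc (1 / 2 : ℝ) 1, ENNReal.ofReal (Real.exp (-t)) * subQ2 π p1 p2 t x y := by
        refine setLIntegral_mono' measurableSet_Icc fun t ht => ?_
        have ht0 : 0 < t := by linarith [ht.1]
        refine le_trans ?_ (mul_le_mul_right (hq x y D t le_rfl hDpos ht0 (ht.2.trans hDγ)) _)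
        rw [← ENNReal.ofReal_mul (Real.exp_pos _).le]
        apply ENNReal.ofReal_le_ofReal
        have := ht.1
        have := ht.2
        gcongr
      _ ≤ resolvent2 π p1 p2 x y :=
        lintegral_mono_set fun t ht => lt_of_lt_of_le (by norm_num) ht.1
end

section
/- Suppose each pⁱ (i = 1,2) satisfies the near-diagonal lower bound (NDLHK): there are constants c₀, a > 0 with pⁱ(t,u,v) ≥ a / V(u, φᵢ^{-1}(t)) for all t > 0 and u, v ∈ M with d(u,v) ≤ c₀ φᵢ^{-1}(t). If x = (x₁,x₂) ∈ M × M satisfies J^γ(x) := ∫₁^∞ 1 / (V(x₁, (φ₁^γ)^{-1}(t)) V(x₂, (φ₂^γ)^{-1}(t))) dt = ∞, then ∫₁^∞ q^γ(t,x,y) dt = ∞ for every y ∈ M × M. -/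
open MeasureTheory Set

/-- A divergent integral over `(1, ∞)` of a function bounded on `(1, T]` diverges on `(T, ∞)`. -/
theorem lintegral_Ioi_eq_top_of_le_const {f : ℝ → ENNReal} {C : ENNReal} (hC : C ≠ ⊤) {T : ℝ}
    (hT : 1 ≤ T) (hf : ∀ t ∈ Ioc (1:ℝ) T, f t ≤ C) (h : ∫⁻ t in Ioi (1:ℝ), f t = ⊤) :
    ∫⁻ t in Ioi T, f t = ⊤ := by
  rw [← Ioc_union_Ioi_eq_Ioi hT, lintegral_union measurableSet_Ioi Ioc_disjoint_Ioi_same,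
    ENNReal.add_eq_top] at h
  refine h.resolve_left (ne_of_lt ?_)
  calc ∫⁻ t in Ioc 1 T, f t ≤ ∫⁻ _ in Ioc 1 T, C := setLIntegral_mono' measurableSet_Ioc hf
    _ < ⊤ := by
      rw [setLIntegral_const, Real.volume_Ioc]
      exact ENNReal.mul_lt_top hC.lt_top ENNReal.ofReal_lt_top

/-- A right inverse of an increasing function is at least `r` beyond the value at `r`. -/
theorem StrictMonoOn.le_rightInverse {φ φinv : ℝ → ℝ} (hmono : StrictMonoOn φ (Ici 0))
    (hnonneg : ∀ t : ℝ, 0 ≤ t → 0 ≤ φinv t) (hinv : ∀ t : ℝ, 0 ≤ t → φ (φinv t) = t)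
    {r s : ℝ} (hr : 0 ≤ r) (hs : 0 ≤ s) (h : φ r ≤ s) : r ≤ φinv s := by
  rw [← hinv s hs] at h
  exact (hmono.le_iff_le hr (hnonneg s hs)).1 h

/-- The substitution `s = t ^ (1 / γ)` on `(T, ∞)`. -/
theorem lintegral_comp_rpow_one_div_Ioi {γ T : ℝ} (hγ : 0 < γ) (hT : 0 ≤ T) (f : ℝ → ENNReal) :
    ∫⁻ t in Ioi T, f (t ^ (1 / γ)) =
      ENNReal.ofReal γ * ∫⁻ s in Ioi (T ^ (1 / γ)), ENNReal.ofReal (s ^ (γ - 1)) * f s := by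
  have himage : (fun s : ℝ => s ^ γ) '' Ioi (T ^ (1 / γ)) = Ioi T := by
    ext t
    simp only [mem_image, mem_Ioi, one_div]
    constructor
    · rintro ⟨s, hs, rfl⟩
      exact (Real.rpow_inv_lt_iff_of_pos hT ((Real.rpow_nonneg hT _).trans hs.le) hγ).1 hs
    · intro ht
      exact ⟨t ^ γ⁻¹, Real.rpow_lt_rpow hT ht (inv_pos.2 hγ),
        Real.rpow_inv_rpow (hT.trans ht.le) hγ.ne'⟩
  have hpos : ∀ s ∈ Ioi (T ^ (1 / γ)), 0 < s := fun s hs => (Real.rpow_nonneg hT _).trans_lt hs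
  have hderiv : ∀ s ∈ Ioi (T ^ (1 / γ)),
      HasDerivWithinAt (fun s : ℝ => s ^ γ) (γ * s ^ (γ - 1)) (Ioi (T ^ (1 / γ))) s :=
    fun s hs => (Real.hasDerivAt_rpow_const (Or.inl (hpos s hs).ne')).hasDerivWithinAt
  have hinj : InjOn (fun s : ℝ => s ^ γ) (Ioi (T ^ (1 / γ))) := fun s hs t ht h =>
    (Real.rpow_left_inj (hpos s hs).le (hpos t ht).le hγ.ne').1 h
  rw [← himage, lintegral_image_eq_lintegral_abs_deriv_mul measurableSet_Ioi hderiv hinj,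
    ← lintegral_const_mul' _ _ ENNReal.ofReal_ne_top]
  refine setLIntegral_congr_fun measurableSet_Ioi fun s hs => ?_
  have hs0 := hpos s hs
  rw [abs_of_nonneg (mul_nonneg hγ.le (Real.rpow_nonneg hs0.le _)), ENNReal.ofReal_mul hγ.le,
    mul_assoc, one_div, Real.rpow_rpow_inv hs0.le hγ.ne']

/-- The potential density of a subordinator whose transition density is bounded below. -/
theorem ofReal_le_lintegral_subordinator {γ C s : ℝ} {π : ℝ → ℝ → ℝ} (hγ : 0 < γ) (hC : 0 < C)
    (hlb : ∀ t s : ℝ, 0 < t → 0 < s → t ^ (1 / γ) ≤ s → C * t / s ^ (1 + γ) ≤ π t s)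
    (hs : 0 < s) (hs2 : 2 ≤ s ^ γ) :
    ENNReal.ofReal (C / 4) * ENNReal.ofReal (s ^ (γ - 1)) ≤
      ∫⁻ t in Ioi (1:ℝ), ENNReal.ofReal (π t s) := by
  have hsub : Ioc (s ^ γ / 2) (s ^ γ) ⊆ Ioi 1 := fun t ht =>
    lt_of_le_of_lt (by linarith) ht.1
  have hden : 0 < s ^ (1 + γ) := Real.rpow_pos_of_pos hs _
  calc ENNReal.ofReal (C / 4) * ENNReal.ofReal (s ^ (γ - 1))
      = ENNReal.ofReal (C * (s ^ γ / 2) / s ^ (1 + γ)) * volume (Ioc (s ^ γ / 2) (s ^ γ)) := by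
        rw [Real.volume_Ioc, ← ENNReal.ofReal_mul (by positivity),
          ← ENNReal.ofReal_mul (by positivity), Real.rpow_sub_one hs.ne', Real.rpow_add hs,
          Real.rpow_one]
        congr 1
        field_simp
        ring
    _ = ∫⁻ _ in Ioc (s ^ γ / 2) (s ^ γ), ENNReal.ofReal (C * (s ^ γ / 2) / s ^ (1 + γ)) :=
        (setLIntegral_const _ _).symm
    _ ≤ ∫⁻ t in Ioc (s ^ γ / 2) (s ^ γ), ENNReal.ofReal (π t s) := by
        refine setLIntegral_mono' measurableSet_Ioc fun t ht => ENNReal.ofReal_le_ofReal ?_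
        have ht0 : 0 < t := one_pos.trans (hsub ht)
        refine le_trans ?_ (hlb t s ht0 hs ?_)
        · gcongr
          exact ht.1.le
        · rw [one_div]
          exact (Real.rpow_inv_le_iff_of_pos ht0.le hs.le hγ).2 ht.2
    _ ≤ _ := lintegral_mono_set hsub

/-- Positivity and monotonicity of the volume, relative to the unit ball. -/
theorem unit_ball_volume_pos_and_le {M : Type*} [MetricSpace M] [MeasurableSpace M] {μ : Measure M}
    {V : M → ℝ → ℝ} (hV : ∀ x r, V x r = (μ (Metric.ball x r)).toReal)
    (hVpos : ∀ (x : M) (r : ℝ), 0 < r → 0 < μ (Metric.ball x r) ∧ μ (Metric.ball x r) < ⊤)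
    (x : M) {r : ℝ} (hr : 1 ≤ r) : 0 < V x 1 ∧ V x 1 ≤ V x r := by
  have h1 := hVpos x 1 one_pos
  have h2 := hVpos x r (by linarith)
  rw [hV, hV]
  exact ⟨ENNReal.toReal_pos h1.1.ne' h1.2.ne,
    ENNReal.toReal_mono h2.2.ne (measure_mono (Metric.ball_subset_ball hr))⟩

theorem prod_recurrence_criterion
    {M : Type*} [MetricSpace M] [MeasurableSpace M] [BorelSpace M]
    (μ : Measure M) (V : M → ℝ → ℝ)
    (hV : ∀ x r, V x r = (μ (Metric.ball x r)).toReal)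
    (hVpos : ∀ (x : M) (r : ℝ), 0 < r → 0 < μ (Metric.ball x r) ∧ μ (Metric.ball x r) < ⊤)
    (c₁ c₂ d₁ d₂ : ℝ) (hc₁ : 0 < c₁) (hc₂ : 0 < c₂) (hd₁ : 0 < d₁) (hd₁₂ : d₁ ≤ d₂)
    (hVscale : ∀ (x : M) (r R : ℝ), 0 < r → r < R →
      c₁ * (R / r) ^ d₁ ≤ V x R / V x r ∧ V x R / V x r ≤ c₂ * (R / r) ^ d₂)
    (φ₁ φ₂ : ℝ → ℝ)
    (hφ₁mono : StrictMonoOn φ₁ (Ici 0)) (hφ₂mono : StrictMonoOn φ₂ (Ici 0))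
    (hφ₁nonneg : ∀ r : ℝ, 0 ≤ r → 0 ≤ φ₁ r) (hφ₂nonneg : ∀ r : ℝ, 0 ≤ r → 0 ≤ φ₂ r)
    (hφ₁0 : φ₁ 0 = 0) (hφ₂0 : φ₂ 0 = 0) (hφ₁1 : φ₁ 1 = 1) (hφ₂1 : φ₂ 1 = 1)
    (c₃ c₄ α₁ α₂ : ℝ) (hc₃ : 0 < c₃) (hc₄ : 0 < c₄) (hα₁ : 0 < α₁) (hα₁₂ : α₁ ≤ α₂)
    (hφ₁scale : ∀ r R : ℝ, 0 < r → r < R →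
      c₃ * (R / r) ^ α₁ ≤ φ₁ R / φ₁ r ∧ φ₁ R / φ₁ r ≤ c₄ * (R / r) ^ α₂)
    (hφ₂scale : ∀ r R : ℝ, 0 < r → r < R →
      c₃ * (R / r) ^ α₁ ≤ φ₂ R / φ₂ r ∧ φ₂ R / φ₂ r ≤ c₄ * (R / r) ^ α₂)
    (φ₁inv φ₂inv : ℝ → ℝ)
    (hφ₁invnonneg : ∀ t : ℝ, 0 ≤ t → 0 ≤ φ₁inv t) (hφ₂invnonneg : ∀ t : ℝ, 0 ≤ t → 0 ≤ φ₂inv t)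
    (hφ₁invl : ∀ r : ℝ, 0 ≤ r → φ₁inv (φ₁ r) = r) (hφ₂invl : ∀ r : ℝ, 0 ≤ r → φ₂inv (φ₂ r) = r)
    (hφ₁invr : ∀ t : ℝ, 0 ≤ t → φ₁ (φ₁inv t) = t) (hφ₂invr : ∀ t : ℝ, 0 ≤ t → φ₂ (φ₂inv t) = t)
    (γ : ℝ) (hγ0 : 0 < γ) (hγ1 : γ < 1)
    (π : ℝ → ℝ → ℝ) (hπmeas : Measurable (Function.uncurry π))
    (hπnonneg : ∀ t s : ℝ, 0 ≤ π t s)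
    (C₁ C₂ : ℝ) (hC₁ : 0 < C₁) (hC₂ : 0 < C₂)
    (hπub : ∀ t s : ℝ, 0 < t → 0 < s → π t s ≤ C₁ * t / s ^ (1 + γ) * Real.exp (-t / s ^ γ))
    (hπlb : ∀ t s : ℝ, 0 < t → 0 < s → t ^ (1 / γ) ≤ s → C₂ * t / s ^ (1 + γ) ≤ π t s)
    (p1 p2 : ℝ → M → M → ℝ)
    (hp1meas : Measurable (fun z : ℝ × M × M => p1 z.1 z.2.1 z.2.2))
    (hp2meas : Measurable (fun z : ℝ × M × M => p2 z.1 z.2.1 z.2.2))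
    (hp1nonneg : ∀ (t : ℝ) (x y : M), 0 ≤ p1 t x y)
    (hp2nonneg : ∀ (t : ℝ) (x y : M), 0 ≤ p2 t x y)
    (c₀ a : ℝ) (hc₀ : 0 < c₀) (ha : 0 < a)
    (hNDL1 : ∀ (t : ℝ) (u v : M), 0 < t → dist u v ≤ c₀ * φ₁inv t →
      a / V u (φ₁inv t) ≤ p1 t u v)
    (hNDL2 : ∀ (t : ℝ) (u v : M), 0 < t → dist u v ≤ c₀ * φ₂inv t →
      a / V u (φ₂inv t) ≤ p2 t u v)
    (x : M × M)
    (hJ : (∫⁻ t in Ioi (1:ℝ),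
      ENNReal.ofReal (1 /
        (V x.1 (φ₁inv (t ^ (1 / γ))) * V x.2 (φ₂inv (t ^ (1 / γ)))))) = ⊤) :
    ∀ y : M × M, (∫⁻ t in Ioi (1:ℝ), subQ2 π p1 p2 t x y) = ⊤ := by
  intro y
  have hunit : ∀ s : ℝ, 1 ≤ s → 1 ≤ φ₁inv s ∧ 1 ≤ φ₂inv s := fun s hs =>
    ⟨hφ₁mono.le_rightInverse hφ₁invnonneg hφ₁invr zero_le_one (by linarith) (by rwa [hφ₁1]),
      hφ₂mono.le_rightInverse hφ₂invnonneg hφ₂invr zero_le_one (by linarith) (by rwa [hφ₂1])⟩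
  obtain ⟨T, hT2, hT₁, hT₂⟩ : ∃ T : ℝ, 2 ≤ T ∧ φ₁ (dist x.1 y.1 / c₀) ≤ T ∧
      φ₂ (dist x.2 y.2 / c₀) ≤ T :=
    ⟨max 2 (max (φ₁ (dist x.1 y.1 / c₀)) (φ₂ (dist x.2 y.2 / c₀))), by simp, by simp, by simp⟩
  have hpow : ∀ t : ℝ, 1 ≤ t → t ≤ t ^ (1 / γ) := fun t ht =>
    Real.self_le_rpow_of_one_le ht ((one_le_div hγ0).2 hγ1.le)
  have hJtail := lintegral_Ioi_eq_top_of_le_const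
    (C := ENNReal.ofReal (1 / (V x.1 1 * V x.2 1))) ENNReal.ofReal_ne_top
    (one_le_two.trans hT2) (fun t ht => by
      have h := hunit (t ^ (1 / γ)) (ht.1.le.trans (hpow t ht.1.le))
      obtain ⟨hpos₁, hle₁⟩ := unit_ball_volume_pos_and_le hV hVpos x.1 h.1
      obtain ⟨hpos₂, hle₂⟩ := unit_ball_volume_pos_and_le hV hVpos x.2 h.2
      gcongr
      exact hpos₁.le.trans hle₁) hJ
  set G : ℝ → ℝ := fun s => p1 s x.1 y.1 * p2 s x.2 y.2
  have hGnonneg : ∀ s, 0 ≤ G s := fun s => mul_nonneg (hp1nonneg _ _ _) (hp2nonneg _ _ _)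
  have hGmeas : Measurable G :=
    (hp1meas.comp (measurable_prodMk_right (y := (x.1, y.1)))).mul
      (hp2meas.comp (measurable_prodMk_right (y := (x.2, y.2))))
  have hGlb : ∀ t ∈ Ioi T, ENNReal.ofReal (a * a) * ENNReal.ofReal (1 /
      (V x.1 (φ₁inv (t ^ (1 / γ))) * V x.2 (φ₂inv (t ^ (1 / γ))))) ≤
        ENNReal.ofReal (G (t ^ (1 / γ))) := by
    intro t ht
    have ht1 : 1 ≤ t := by linarith [mem_Ioi.1 ht]
    have hTs : T ≤ t ^ (1 / γ) := (mem_Ioi.1 ht).le.trans (hpow t ht1)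
    set s := t ^ (1 / γ)
    have hs0 : 0 < s := by linarith
    have hb₁ := hφ₁mono.le_rightInverse hφ₁invnonneg hφ₁invr
      (div_nonneg dist_nonneg hc₀.le) hs0.le (hT₁.trans hTs)
    have hb₂ := hφ₂mono.le_rightInverse hφ₂invnonneg hφ₂invr
      (div_nonneg dist_nonneg hc₀.le) hs0.le (hT₂.trans hTs)
    have h₁ := hNDL1 s x.1 y.1 hs0 ((div_le_iff₀' hc₀).1 hb₁)
    have h₂ := hNDL2 s x.2 y.2 hs0 ((div_le_iff₀' hc₀).1 hb₂)
    have hV₂ : 0 ≤ V x.2 (φ₂inv s) := by rw [hV]; exact ENNReal.toReal_nonneg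
    rw [← ENNReal.ofReal_mul (by positivity), ← div_eq_mul_one_div, ← div_mul_div_comm]
    exact ENNReal.ofReal_le_ofReal
      (mul_le_mul h₁ h₂ (div_nonneg ha.le hV₂) (hp1nonneg _ _ _))
  have hGtop : ∫⁻ t in Ioi T, ENNReal.ofReal (G (t ^ (1 / γ))) = ⊤ := by
    refine top_unique (le_trans ?_ (setLIntegral_mono' measurableSet_Ioi hGlb))
    rw [lintegral_const_mul' _ _ ENNReal.ofReal_ne_top, hJtail, ENNReal.mul_top]
    exact (ENNReal.ofReal_pos.2 (mul_pos ha ha)).ne'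
  rw [lintegral_comp_rpow_one_div_Ioi hγ0 (by linarith) (fun s => ENNReal.ofReal (G s))] at hGtop
  have hpot : ∫⁻ s in Ioi (T ^ (1 / γ)), ENNReal.ofReal (s ^ (γ - 1)) * ENNReal.ofReal (G s) = ⊤ :=
    by_contra fun h => ENNReal.mul_ne_top ENNReal.ofReal_ne_top h hGtop
  have hTpos : 0 < T ^ (1 / γ) := Real.rpow_pos_of_pos (by linarith) _
  have hmeas : Measurable (Function.uncurry fun t s => ENNReal.ofReal (G s * π t s)) :=
    ((hGmeas.comp measurable_snd).mul hπmeas).ennreal_ofReal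
  refine top_unique ?_
  calc ⊤ = ENNReal.ofReal (C₂ / 4) * ∫⁻ s in Ioi (T ^ (1 / γ)),
        ENNReal.ofReal (s ^ (γ - 1)) * ENNReal.ofReal (G s) := by
        rw [hpot, ENNReal.mul_top (ENNReal.ofReal_pos.2 (by positivity)).ne']
    _ = ∫⁻ s in Ioi (T ^ (1 / γ)),
        ENNReal.ofReal (C₂ / 4) * (ENNReal.ofReal (s ^ (γ - 1)) * ENNReal.ofReal (G s)) :=
        (lintegral_const_mul' _ _ ENNReal.ofReal_ne_top).symm
    _ ≤ ∫⁻ s in Ioi (T ^ (1 / γ)), ∫⁻ t in Ioi (1:ℝ), ENNReal.ofReal (G s * π t s) := by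
        refine setLIntegral_mono' measurableSet_Ioi fun s hs => ?_
        have hs0 : 0 < s := hTpos.trans hs
        have hs2 : 2 ≤ s ^ γ := by
          have h : T ^ γ⁻¹ < s := by simpa only [one_div, mem_Ioi] using hs
          exact hT2.trans ((Real.rpow_inv_lt_iff_of_pos (by linarith) hs0.le hγ0).1 h).le
        simp only [ENNReal.ofReal_mul (hGnonneg s)]
        rw [lintegral_const_mul' _ _ ENNReal.ofReal_ne_top, ← mul_assoc, mul_comm]
        gcongr
        exact ofReal_le_lintegral_subordinator hγ0 hC₂ hπlb hs0 hs2
    _ ≤ ∫⁻ s in Ioi (0:ℝ), ∫⁻ t in Ioi (1:ℝ), ENNReal.ofReal (G s * π t s) :=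
        lintegral_mono_set (Ioi_subset_Ioi hTpos.le)
    _ = ∫⁻ t in Ioi (1:ℝ), subQ2 π p1 p2 t x y :=
        (lintegral_lintegral_swap hmeas.aemeasurable).symm
end

section
/- Suppose each pⁱ (i = 1,2) satisfies the upper bound (WUHK): there is A > 0 with pⁱ(t,u,v) ≤ A · min{ 1 / V(u, φᵢ^{-1}(t)), t / (V(u, d(u,v)) φᵢ(d(u,v))) } for all t > 0 and u, v ∈ M (the second term read as +∞ when u = v). If x = (x₁,x₂) ∈ M × M satisfies ∫₁^∞ s^{γ−1} / (V(x₁, φ₁^{-1}(s)) V(x₂, φ₂^{-1}(s))) ds < ∞, then ∫₁^∞ ( sup_{y ∈ M × M} q^γ(t,x,y) ) dt < ∞. -/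
open MeasureTheory Set

/-- The inverse volume of a ball whose radius is a generalised inverse of a function with
lower power growth blows up at most polynomially at the origin. -/
lemma exists_inv_volume_le_rpow {v φ ψ : ℝ → ℝ} {c₂ d₂ c₃ α₁ : ℝ}
    (hv : ∀ r, 0 < r → 0 < v r) (hc₂ : 0 < c₂) (hd₂ : 0 < d₂)
    (hvscale : ∀ r R : ℝ, 0 < r → r < R → v R / v r ≤ c₂ * (R / r) ^ d₂)
    (hmono : StrictMonoOn φ (Ici 0)) (hφ1 : φ 1 = 1)
    (hc₃ : 0 < c₃) (hα₁ : 0 < α₁)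
    (hφscale : ∀ r R : ℝ, 0 < r → r < R → c₃ * (R / r) ^ α₁ ≤ φ R / φ r)
    (hψpos : ∀ s, 0 < s → 0 < ψ s) (hψ : ∀ s, 0 ≤ s → φ (ψ s) = s) :
    ∃ K b : ℝ, 0 < K ∧ ∀ s, 0 < s → s < 1 → (v (ψ s))⁻¹ ≤ K * s ^ (-b) := by
  refine ⟨c₂ / v 1 * (1 / c₃) ^ (d₂ / α₁), d₂ / α₁,
    mul_pos (div_pos hc₂ (hv 1 one_pos)) (Real.rpow_pos_of_pos (by positivity) _), ?_⟩
  intro s hs hs1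
  have hr : 0 < ψ s := hψpos s hs
  have hr1 : ψ s < 1 := by
    by_contra! h
    have := hmono.monotoneOn (by simp : (1 : ℝ) ∈ Ici 0) hr.le h
    rw [hφ1, hψ s hs.le] at this
    linarith
  have h1 := hvscale _ _ hr hr1
  have h2 := hφscale _ _ hr hr1
  rw [hφ1, hψ s hs.le] at h2
  have h3 : (1 / ψ s) ^ α₁ ≤ 1 / c₃ * s⁻¹ := by
    rw [mul_comm, ← div_eq_mul_one_div, le_div_iff₀ hc₃]
    rw [one_div s] at h2
    linarith
  have h4 : (1 / ψ s) ^ d₂ ≤ (1 / c₃) ^ (d₂ / α₁) * s ^ (-(d₂ / α₁)) := by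
    have h5 : (1 / ψ s) ^ d₂ = ((1 / ψ s) ^ α₁) ^ (d₂ / α₁) := by
      rw [← Real.rpow_mul (by positivity), mul_div_cancel₀ _ hα₁.ne']
    rw [h5, Real.rpow_neg hs.le, ← Real.inv_rpow hs.le,
      ← Real.mul_rpow (by positivity) (by positivity)]
    exact Real.rpow_le_rpow (by positivity) h3 (by positivity)
  have hv1 := hv 1 one_pos
  calc (v (ψ s))⁻¹ = v 1 / v (ψ s) / v 1 := by field_simp
    _ ≤ c₂ * ((1 / c₃) ^ (d₂ / α₁) * s ^ (-(d₂ / α₁))) / v 1 := by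
      gcongr
      exact h1.trans (by gcongr)
    _ = _ := by ring

lemma exists_rpow_mul_exp_neg_div_le {γ : ℝ} (hγ : 0 < γ) (b : ℝ) :
    ∃ K : ℝ, 0 < K ∧ ∀ s t : ℝ, 0 < s → s < 1 → 1 < t →
      s ^ (-b) * (t * Real.exp (-t / s ^ γ)) ≤ K * t ^ (-2 : ℝ) := by
  obtain ⟨N, hN⟩ := exists_nat_ge (max 3 (b / γ))
  have hN3 : 3 ≤ N := by exact_mod_cast (le_max_left _ _).trans hN
  have hNb : b ≤ γ * N := by
    have := (le_max_right _ _).trans hN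
    rwa [div_le_iff₀' hγ] at this
  refine ⟨N.factorial, by positivity, fun s t hs hs1 ht => ?_⟩
  have ht0 : 0 < t := one_pos.trans ht
  have ha : 0 < s ^ γ := Real.rpow_pos_of_pos hs _
  have h1 : Real.exp (-t / s ^ γ) ≤ N.factorial * ((s ^ γ) ^ N / t ^ N) := by
    have := Real.pow_div_factorial_le_exp (t / s ^ γ) (by positivity) N
    rw [neg_div, Real.exp_neg, inv_le_comm₀ (Real.exp_pos _) (by positivity)]
    refine le_trans (le_of_eq ?_) this
    rw [div_pow]
    field_simp
  have h2 : s ^ (-b) * (s ^ γ) ^ N ≤ 1 := by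
    rw [← Real.rpow_natCast, ← Real.rpow_mul hs.le, ← Real.rpow_add hs]
    exact Real.rpow_le_one hs.le hs1.le (by linarith)
  have h3 : t / t ^ N ≤ t ^ (-2 : ℝ) := by
    rw [Real.rpow_neg ht0.le, Real.rpow_two, div_le_iff₀ (by positivity), inv_mul_eq_div,
      le_div_iff₀ (by positivity), ← pow_succ']
    exact pow_le_pow_right₀ ht.le hN3
  calc s ^ (-b) * (t * Real.exp (-t / s ^ γ))
      ≤ s ^ (-b) * (t * (N.factorial * ((s ^ γ) ^ N / t ^ N))) := by gcongr
    _ = N.factorial * ((s ^ (-b) * (s ^ γ) ^ N) * (t / t ^ N)) := by ring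
    _ ≤ N.factorial * (1 * t ^ (-2 : ℝ)) := by gcongr
    _ = _ := by ring

lemma lintegral_Ioi_mul_exp_neg_div {a : ℝ} (ha : 0 < a) :
    ∫⁻ t in Ioi (0 : ℝ), ENNReal.ofReal (t * Real.exp (-t / a)) = ENNReal.ofReal (a ^ 2) := by
  have h : ∫ t in Ioi (0 : ℝ), t * Real.exp (-t / a) = a ^ 2 := by
    have := Real.integral_rpow_mul_exp_neg_mul_Ioi (a := 2) (r := a⁻¹) two_pos (by positivity)
    rw [Real.Gamma_two, mul_one, one_div, inv_inv, Real.rpow_two] at this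
    rw [← this]
    refine integral_congr_ae (Filter.Eventually.of_forall fun t => ?_)
    norm_num [div_eq_inv_mul]
  rw [← h, ofReal_integral_eq_lintegral_ofReal]
  · exact not_imp_comm.1 integral_undef (by rw [h]; positivity)
  · filter_upwards [ae_restrict_mem measurableSet_Ioi] with t ht
    have : 0 < t := ht
    simp only [Pi.zero_apply]
    positivity

/-- Upper bound on the time integral of the subordinator density. -/
lemma lintegral_Ioi_one_subordinator_le {γ C s : ℝ} (hC : 0 ≤ C) (hs : 0 < s) :
    ∫⁻ t in Ioi (1 : ℝ), ENNReal.ofReal (C * t / s ^ (1 + γ) * Real.exp (-t / s ^ γ))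
      ≤ ENNReal.ofReal (C * s ^ (γ - 1)) := by
  have ha : 0 < s ^ γ := Real.rpow_pos_of_pos hs _
  calc ∫⁻ t in Ioi (1 : ℝ), ENNReal.ofReal (C * t / s ^ (1 + γ) * Real.exp (-t / s ^ γ))
      ≤ ∫⁻ t in Ioi (0 : ℝ), ENNReal.ofReal (C * t / s ^ (1 + γ) * Real.exp (-t / s ^ γ)) :=
        lintegral_mono_set (Ioi_subset_Ioi zero_le_one)
    _ = ∫⁻ t in Ioi (0 : ℝ),
          ENNReal.ofReal (C / s ^ (1 + γ)) * ENNReal.ofReal (t * Real.exp (-t / s ^ γ)) := by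
        refine lintegral_congr fun t => ?_
        rw [← ENNReal.ofReal_mul (by positivity)]
        congr 1
        ring
    _ = ENNReal.ofReal (C * s ^ (γ - 1)) := by
        rw [lintegral_const_mul _ (by fun_prop), lintegral_Ioi_mul_exp_neg_div ha,
          ← ENNReal.ofReal_mul (by positivity)]
        congr 1
        rw [← Real.rpow_natCast, ← Real.rpow_mul hs.le, div_mul_eq_mul_div, mul_div_assoc,
          ← Real.rpow_sub hs]
        congr 2
        push_cast
        ring

/-- A subordinated product whose spatial factor is dominated by `g` has finite time integral
over `(1, ∞)`, provided that `g` has at most a power singularity at `0` and is integrable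
against `s ^ (γ - 1)` near infinity. -/
lemma lintegral_lintegral_subordinator_lt_top {γ C K b : ℝ} (hγ : 0 < γ) (hC : 0 < C)
    (hK : 0 < K) {g : ℝ → ENNReal} (hg : Measurable g)
    (hg0 : ∀ s, 0 < s → s < 1 → g s ≤ ENNReal.ofReal (K * s ^ (-b)))
    (hg1 : ∫⁻ s in Ioi (1 : ℝ), ENNReal.ofReal (s ^ (γ - 1)) * g s < ⊤) :
    ∫⁻ t in Ioi (1 : ℝ), ∫⁻ s in Ioi (0 : ℝ),
      ENNReal.ofReal (C * t / s ^ (1 + γ) * Real.exp (-t / s ^ γ)) * g s < ⊤ := by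
  set H : ℝ → ℝ → ENNReal := fun t s =>
    ENNReal.ofReal (C * t / s ^ (1 + γ) * Real.exp (-t / s ^ γ)) * g s with hH
  have hHm : Measurable (Function.uncurry H) := by
    simp only [hH, Function.uncurry_def]
    fun_prop
  obtain ⟨L, hL, hLb⟩ := exists_rpow_mul_exp_neg_div_le hγ (b + (1 + γ))
  have hsplit : ∀ t, ∫⁻ s in Ioi (0 : ℝ), H t s
      = (∫⁻ s in Ioo (0 : ℝ) 1, H t s) + ∫⁻ s in Ioi (1 : ℝ), H t s := by
    intro t
    rw [← Ioc_union_Ioi_eq_Ioi zero_le_one, lintegral_union measurableSet_Ioi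
      (Set.disjoint_left.2 fun s hs hs' => not_lt.2 hs.2 hs'), restrict_Ioo_eq_restrict_Ioc]
  change ∫⁻ t in Ioi (1 : ℝ), ∫⁻ s in Ioi (0 : ℝ), H t s < ⊤
  simp only [hsplit]
  have hIm : Measurable fun t : ℝ => ∫⁻ s in Ioi (1 : ℝ), H t s := hHm.lintegral_prod_right'
  rw [lintegral_add_right _ hIm]
  refine ENNReal.add_lt_top.2 ⟨?_, ?_⟩
  · have hle : ∀ t ∈ Ioi (1 : ℝ), ∫⁻ s in Ioo (0 : ℝ) 1, H t s
        ≤ ENNReal.ofReal (C * K * L * t ^ (-2 : ℝ)) := by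
      intro t ht
      have ht0 : (0 : ℝ) < t := one_pos.trans ht
      calc ∫⁻ s in Ioo (0 : ℝ) 1, H t s
          ≤ ∫⁻ _ in Ioo (0 : ℝ) 1, ENNReal.ofReal (C * K * L * t ^ (-2 : ℝ)) := by
            refine setLIntegral_mono measurable_const fun s hs => ?_
            have hs0 := hs.1
            refine (mul_le_mul_right (hg0 s hs.1 hs.2) _).trans ?_
            rw [← ENNReal.ofReal_mul (by positivity)]
            refine ENNReal.ofReal_le_ofReal ?_
            have h1 := hLb s t hs.1 hs.2 ht
            rw [neg_add, Real.rpow_add hs0, Real.rpow_neg hs0.le (1 + γ)] at h1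
            calc C * t / s ^ (1 + γ) * Real.exp (-t / s ^ γ) * (K * s ^ (-b))
                = C * K * (s ^ (-b) * (s ^ (1 + γ))⁻¹ * (t * Real.exp (-t / s ^ γ))) := by ring
              _ ≤ C * K * (L * t ^ (-2 : ℝ)) := by gcongr
              _ = _ := by ring
        _ = _ := by simp
    refine (setLIntegral_mono (by fun_prop) hle).trans_lt ?_
    exact (((integrableOn_Ioi_rpow_of_lt (by norm_num : (-2 : ℝ) < -1) one_pos).const_mul
      (C * K * L))).lintegral_lt_top
  · rw [lintegral_lintegral_swap hHm.aemeasurable]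
    have hle : ∀ s ∈ Ioi (1 : ℝ), ∫⁻ t in Ioi (1 : ℝ), H t s
        ≤ ENNReal.ofReal C * (ENNReal.ofReal (s ^ (γ - 1)) * g s) := by
      intro s hs
      simp only [hH]
      rw [lintegral_mul_const _ (by fun_prop), ← mul_assoc, ← ENNReal.ofReal_mul hC.le]
      gcongr
      exact lintegral_Ioi_one_subordinator_le hC.le (one_pos.trans hs)
    refine (setLIntegral_mono (by fun_prop) hle).trans_lt ?_
    rw [lintegral_const_mul _ (by fun_prop)]
    exact ENNReal.mul_lt_top ENNReal.ofReal_lt_top hg1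

/-- A right inverse of an increasing function on `[0, ∞)` is monotone there. -/
lemma monotone_rightInverse_max {φ ψ : ℝ → ℝ} (hmono : StrictMonoOn φ (Ici 0))
    (hψ0 : ∀ t, 0 ≤ t → 0 ≤ ψ t) (hψ : ∀ t, 0 ≤ t → φ (ψ t) = t) :
    Monotone fun s => ψ (max s 0) := by
  intro s t hst
  by_contra! h
  have hs : (0 : ℝ) ≤ max s 0 := le_max_right _ _
  have ht : (0 : ℝ) ≤ max t 0 := le_max_right _ _
  have := hmono (hψ0 _ ht) (hψ0 _ hs) h
  rw [hψ _ ht, hψ _ hs] at this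
  exact absurd (max_le_max_right 0 hst) (not_le.2 this)

lemma measurable_inv_measure_ball_comp {M : Type*} [PseudoMetricSpace M] [MeasurableSpace M]
    (μ : Measure M) (u : M) {ρ : ℝ → ℝ} (hρ : Monotone ρ) :
    Measurable fun s => (μ (Metric.ball u (ρ s)))⁻¹ :=
  Measurable.inv (Monotone.measurable fun _ _ h =>
    measure_mono (Metric.ball_subset_ball (hρ h)))

theorem prod_transience_criterion
    {M : Type*} [MetricSpace M] [MeasurableSpace M] [BorelSpace M]
    (μ : Measure M) (V : M → ℝ → ℝ)
    (hV : ∀ x r, V x r = (μ (Metric.ball x r)).toReal)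
    (hVpos : ∀ (x : M) (r : ℝ), 0 < r → 0 < μ (Metric.ball x r) ∧ μ (Metric.ball x r) < ⊤)
    (c₁ c₂ d₁ d₂ : ℝ) (hc₁ : 0 < c₁) (hc₂ : 0 < c₂) (hd₁ : 0 < d₁) (hd₁₂ : d₁ ≤ d₂)
    (hVscale : ∀ (x : M) (r R : ℝ), 0 < r → r < R →
      c₁ * (R / r) ^ d₁ ≤ V x R / V x r ∧ V x R / V x r ≤ c₂ * (R / r) ^ d₂)
    (φ₁ φ₂ : ℝ → ℝ)
    (hφ₁mono : StrictMonoOn φ₁ (Ici 0)) (hφ₂mono : StrictMonoOn φ₂ (Ici 0))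
    (hφ₁nonneg : ∀ r : ℝ, 0 ≤ r → 0 ≤ φ₁ r) (hφ₂nonneg : ∀ r : ℝ, 0 ≤ r → 0 ≤ φ₂ r)
    (hφ₁0 : φ₁ 0 = 0) (hφ₂0 : φ₂ 0 = 0) (hφ₁1 : φ₁ 1 = 1) (hφ₂1 : φ₂ 1 = 1)
    (c₃ c₄ α₁ α₂ : ℝ) (hc₃ : 0 < c₃) (hc₄ : 0 < c₄) (hα₁ : 0 < α₁) (hα₁₂ : α₁ ≤ α₂)
    (hφ₁scale : ∀ r R : ℝ, 0 < r → r < R →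
      c₃ * (R / r) ^ α₁ ≤ φ₁ R / φ₁ r ∧ φ₁ R / φ₁ r ≤ c₄ * (R / r) ^ α₂)
    (hφ₂scale : ∀ r R : ℝ, 0 < r → r < R →
      c₃ * (R / r) ^ α₁ ≤ φ₂ R / φ₂ r ∧ φ₂ R / φ₂ r ≤ c₄ * (R / r) ^ α₂)
    (φ₁inv φ₂inv : ℝ → ℝ)
    (hφ₁invnonneg : ∀ t : ℝ, 0 ≤ t → 0 ≤ φ₁inv t) (hφ₂invnonneg : ∀ t : ℝ, 0 ≤ t → 0 ≤ φ₂inv t)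
    (hφ₁invl : ∀ r : ℝ, 0 ≤ r → φ₁inv (φ₁ r) = r) (hφ₂invl : ∀ r : ℝ, 0 ≤ r → φ₂inv (φ₂ r) = r)
    (hφ₁invr : ∀ t : ℝ, 0 ≤ t → φ₁ (φ₁inv t) = t) (hφ₂invr : ∀ t : ℝ, 0 ≤ t → φ₂ (φ₂inv t) = t)
    (γ : ℝ) (hγ0 : 0 < γ) (hγ1 : γ < 1)
    (π : ℝ → ℝ → ℝ) (hπmeas : Measurable (Function.uncurry π))
    (hπnonneg : ∀ t s : ℝ, 0 ≤ π t s)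
    (C₁ : ℝ) (hC₁ : 0 < C₁)
    (hπub : ∀ t s : ℝ, 0 < t → 0 < s → π t s ≤ C₁ * t / s ^ (1 + γ) * Real.exp (-t / s ^ γ))
    (p1 p2 : ℝ → M → M → ℝ)
    (hp1meas : Measurable (fun z : ℝ × M × M => p1 z.1 z.2.1 z.2.2))
    (hp2meas : Measurable (fun z : ℝ × M × M => p2 z.1 z.2.1 z.2.2))
    (hp1nonneg : ∀ (t : ℝ) (x y : M), 0 ≤ p1 t x y)
    (hp2nonneg : ∀ (t : ℝ) (x y : M), 0 ≤ p2 t x y)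
    (A : ℝ) (hA : 0 < A)
    (hWUHK1 : ∀ (t : ℝ) (u v : M), 0 < t →
      ENNReal.ofReal (p1 t u v) ≤ ENNReal.ofReal A *
        min ((ENNReal.ofReal (V u (φ₁inv t)))⁻¹)
          (ENNReal.ofReal t /
            (ENNReal.ofReal (V u (dist u v)) * ENNReal.ofReal (φ₁ (dist u v)))))
    (hWUHK2 : ∀ (t : ℝ) (u v : M), 0 < t →
      ENNReal.ofReal (p2 t u v) ≤ ENNReal.ofReal A *
        min ((ENNReal.ofReal (V u (φ₂inv t)))⁻¹)
          (ENNReal.ofReal t /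
            (ENNReal.ofReal (V u (dist u v)) * ENNReal.ofReal (φ₂ (dist u v)))))
    (x : M × M)
    (hJ : (∫⁻ s in Ioi (1:ℝ),
      ENNReal.ofReal (s ^ (γ - 1) / (V x.1 (φ₁inv s) * V x.2 (φ₂inv s)))) < ⊤) :
    (∫⁻ t in Ioi (1:ℝ), ⨆ y : M × M, subQ2 π p1 p2 t x y) < ⊤ := by
  have hd₂ : 0 < d₂ := hd₁.trans_le hd₁₂
  have hVp : ∀ u r, 0 < r → 0 < V u r := fun u r hr => by
    rw [hV]
    exact ENNReal.toReal_pos (hVpos u r hr).1.ne' (hVpos u r hr).2.ne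
  have hinvpos : ∀ φ ψ : ℝ → ℝ, φ 0 = 0 → (∀ t : ℝ, 0 ≤ t → 0 ≤ ψ t) →
      (∀ t : ℝ, 0 ≤ t → φ (ψ t) = t) → ∀ s, 0 < s → 0 < ψ s := by
    intro φ ψ h0 hn hr s hs
    refine (hn s hs.le).lt_of_ne fun h => ?_
    have := hr s hs.le
    rw [← h, h0] at this
    exact hs.ne this
  have hψ₁ := hinvpos φ₁ φ₁inv hφ₁0 hφ₁invnonneg hφ₁invr
  have hψ₂ := hinvpos φ₂ φ₂inv hφ₂0 hφ₂invnonneg hφ₂invr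
  obtain ⟨K₁, b₁, hK₁, hb₁⟩ := exists_inv_volume_le_rpow (hVp x.1) hc₂ hd₂
    (fun r R h h' => (hVscale x.1 r R h h').2) hφ₁mono hφ₁1 hc₃ hα₁
    (fun r R h h' => (hφ₁scale r R h h').1) hψ₁ hφ₁invr
  obtain ⟨K₂, b₂, hK₂, hb₂⟩ := exists_inv_volume_le_rpow (hVp x.2) hc₂ hd₂
    (fun r R h h' => (hVscale x.2 r R h h').2) hφ₂mono hφ₂1 hc₃ hα₁
    (fun r R h h' => (hφ₂scale r R h h').1) hψ₂ hφ₂invr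
  set g : ℝ → ENNReal := fun s => (μ (Metric.ball x.1 (φ₁inv (max s 0))))⁻¹ *
    (μ (Metric.ball x.2 (φ₂inv (max s 0))))⁻¹ with hg
  have hgm : Measurable g :=
    (measurable_inv_measure_ball_comp μ x.1
      (monotone_rightInverse_max hφ₁mono hφ₁invnonneg hφ₁invr)).mul
    (measurable_inv_measure_ball_comp μ x.2
      (monotone_rightInverse_max hφ₂mono hφ₂invnonneg hφ₂invr))
  have hball : ∀ u r, 0 < r → ENNReal.ofReal (V u r) = μ (Metric.ball u r) := fun u r hr => by
    rw [hV, ENNReal.ofReal_toReal (hVpos u r hr).2.ne]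
  have hgV : ∀ s, 0 < s → g s = (ENNReal.ofReal (V x.1 (φ₁inv s)))⁻¹ *
      (ENNReal.ofReal (V x.2 (φ₂inv s)))⁻¹ := by
    intro s hs
    simp only [hg]
    rw [max_eq_left hs.le, hball _ _ (hψ₁ s hs), hball _ _ (hψ₂ s hs)]
  have hgR : ∀ s, 0 < s → g s =
      ENNReal.ofReal ((V x.1 (φ₁inv s))⁻¹ * (V x.2 (φ₂inv s))⁻¹) := by
    intro s hs
    have h1 := hVp x.1 _ (hψ₁ s hs)
    have h2 := hVp x.2 _ (hψ₂ s hs)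
    rw [hgV s hs, ENNReal.ofReal_mul (by positivity), ENNReal.ofReal_inv_of_pos h1,
      ENNReal.ofReal_inv_of_pos h2]
  have hfin := lintegral_lintegral_subordinator_lt_top (K := K₁ * K₂) (b := b₁ + b₂) hγ0 hC₁
    (mul_pos hK₁ hK₂) hgm
    (by
      intro s hs hs1
      rw [hgR s hs]
      refine ENNReal.ofReal_le_ofReal ?_
      have h1 := hVp x.1 _ (hψ₁ s hs)
      have h2 := hVp x.2 _ (hψ₂ s hs)
      rw [neg_add, Real.rpow_add hs]
      calc _ ≤ (K₁ * s ^ (-b₁)) * (K₂ * s ^ (-b₂)) :=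
            mul_le_mul (hb₁ s hs hs1) (hb₂ s hs hs1) (by positivity) (by positivity)
        _ = _ := by ring)
    (by
      refine (lintegral_congr_ae ?_).trans_lt hJ
      filter_upwards [ae_restrict_mem measurableSet_Ioi] with s hs
      have hs0 : (0 : ℝ) < s := one_pos.trans hs
      rw [hgR s hs0, ← ENNReal.ofReal_mul (by positivity), ← mul_inv, div_eq_mul_inv])
  have hle : ∀ t ∈ Ioi (1 : ℝ), ⨆ y : M × M, subQ2 π p1 p2 t x y ≤
      ENNReal.ofReal A ^ 2 * ∫⁻ s in Ioi (0 : ℝ),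
        ENNReal.ofReal (C₁ * t / s ^ (1 + γ) * Real.exp (-t / s ^ γ)) * g s := by
    intro t ht
    refine iSup_le fun y => ?_
    have hm : Measurable fun s : ℝ =>
        ENNReal.ofReal (C₁ * t / s ^ (1 + γ) * Real.exp (-t / s ^ γ)) * g s := by fun_prop
    rw [← lintegral_const_mul _ hm]
    refine setLIntegral_mono (hm.const_mul _) fun s hs => ?_
    rw [hgV s hs, ENNReal.ofReal_mul (mul_nonneg (hp1nonneg _ _ _) (hp2nonneg _ _ _)),
      ENNReal.ofReal_mul (hp1nonneg _ _ _)]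
    calc _ ≤ ENNReal.ofReal A * (ENNReal.ofReal (V x.1 (φ₁inv s)))⁻¹ *
          (ENNReal.ofReal A * (ENNReal.ofReal (V x.2 (φ₂inv s)))⁻¹) *
          ENNReal.ofReal (C₁ * t / s ^ (1 + γ) * Real.exp (-t / s ^ γ)) := by
          gcongr
          · exact (hWUHK1 s x.1 y.1 hs).trans (by gcongr; exact min_le_left _ _)
          · exact (hWUHK2 s x.2 y.2 hs).trans (by gcongr; exact min_le_left _ _)
          · exact hπub t s (one_pos.trans ht) hs
      _ = _ := by ring
  have hIm : Measurable fun t : ℝ => ∫⁻ s in Ioi (0 : ℝ),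
      ENNReal.ofReal (C₁ * t / s ^ (1 + γ) * Real.exp (-t / s ^ γ)) * g s := by
    refine Measurable.lintegral_prod_right' (f := fun z : ℝ × ℝ =>
      ENNReal.ofReal (C₁ * z.1 / z.2 ^ (1 + γ) * Real.exp (-z.1 / z.2 ^ γ)) * g z.2) ?_
    fun_prop
  refine (setLIntegral_mono (hIm.const_mul _) hle).trans_lt ?_
  rw [lintegral_const_mul _ hIm]
  exact ENNReal.mul_lt_top (ENNReal.pow_lt_top ENNReal.ofReal_lt_top) hfin
end

section
/- Suppose each pⁱ (i = 1,2) satisfies the near-diagonal lower bound (NDLHK): there are constants c₀, a > 0 with pⁱ(t,u,v) ≥ a / V(u, φᵢ^{-1}(t)) for all t > 0 and u, v ∈ M with d(u,v) ≤ c₀ φᵢ^{-1}(t). Then there is a constant b > 0 such that the Green function u₀^γ(x,y) := ∫₀^∞ q^γ(t,x,y) dt satisfies u₀^γ(x,y) ≥ b ∫_{φ_d^γ(x,y)}^∞ 1 / (V(x₁, (φ₁^γ)^{-1}(t)) V(x₂, (φ₂^γ)^{-1}(t))) dt for all x = (x₁,x₂), y = (y₁,y₂) ∈ M × M. -/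
open MeasureTheory Set

noncomputable def green2 {M : Type*} (π : ℝ → ℝ → ℝ) (p1 p2 : ℝ → M → M → ℝ)
    (x y : M × M) : ENNReal :=
  ∫⁻ t in Set.Ioi (0:ℝ), subQ2 π p1 p2 t x y

section ScaleFunction

variable {φ φinv : ℝ → ℝ}

theorem scale_inv_pos (hφ0 : φ 0 = 0) (hinvnonneg : ∀ t : ℝ, 0 ≤ t → 0 ≤ φinv t)
    (hinvr : ∀ t : ℝ, 0 ≤ t → φ (φinv t) = t) {t : ℝ} (ht : 0 < t) : 0 < φinv t := by
  refine lt_of_le_of_ne (hinvnonneg t ht.le) fun h => ?_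
  have := hinvr t ht.le
  rw [← h, hφ0] at this
  exact ht.ne this

/-- Upper scaling of `φ` makes its inverse grow at least like a power. -/
theorem mul_scale_inv_le (hmono : StrictMonoOn φ (Ici 0)) (hφ0 : φ 0 = 0)
    (hinvnonneg : ∀ t : ℝ, 0 ≤ t → 0 ≤ φinv t) (hinvr : ∀ t : ℝ, 0 ≤ t → φ (φinv t) = t)
    {c α : ℝ} (hscale : ∀ r R : ℝ, 0 < r → r < R → φ R / φ r ≤ c * (R / r) ^ α)
    {ρ t s : ℝ} (hρ : 1 < ρ) (ht : 0 < t) (hts : c * ρ ^ α * t ≤ s) (hs : 0 ≤ s) :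
    ρ * φinv t ≤ φinv s := by
  have hr := scale_inv_pos hφ0 hinvnonneg hinvr ht
  have h := hscale (φinv t) (ρ * φinv t) hr (lt_mul_of_one_lt_left hr hρ)
  rw [hinvr t ht.le, mul_div_cancel_right₀ _ hr.ne', div_le_iff₀ ht] at h
  refine (hmono.le_iff_le (mem_Ici.2 (by positivity)) (hinvnonneg s hs)).1 ?_
  rw [hinvr s hs]
  exact h.trans hts

/-- Lower scaling of `φ` makes its inverse grow at most like a power. -/
theorem scale_inv_le_mul (hmono : StrictMonoOn φ (Ici 0)) (hφ0 : φ 0 = 0)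
    (hinvnonneg : ∀ t : ℝ, 0 ≤ t → 0 ≤ φinv t) (hinvr : ∀ t : ℝ, 0 ≤ t → φ (φinv t) = t)
    {c α : ℝ} (hscale : ∀ r R : ℝ, 0 < r → r < R → c * (R / r) ^ α ≤ φ R / φ r)
    {ρ t s : ℝ} (hρ : 1 < ρ) (ht : 0 < t) (hts : s ≤ c * ρ ^ α * t) (hs : 0 ≤ s) :
    φinv s ≤ ρ * φinv t := by
  have hr := scale_inv_pos hφ0 hinvnonneg hinvr ht
  have h := hscale (φinv t) (ρ * φinv t) hr (lt_mul_of_one_lt_left hr hρ)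
  rw [hinvr t ht.le, mul_div_cancel_right₀ _ hr.ne', le_div_iff₀ ht] at h
  refine (hmono.le_iff_le (hinvnonneg s hs) (mem_Ici.2 (by positivity))).1 ?_
  rw [hinvr s hs]
  exact hts.trans h

/-- The near-diagonal lower bound at time `s` comparable to `σ`, for points whose distance is at
most `φinv σ`, with the volume taken at scale `σ`. -/
theorem kernel_lower_of_near_diagonal {M : Type*} [MetricSpace M] {V : M → ℝ → ℝ}
    (hVpos : ∀ x r, 0 < r → 0 < V x r) (hVmono : ∀ x, Monotone (V x))
    {c₂ d₂ : ℝ} (hVscale : ∀ x r R, 0 < r → r < R → V x R / V x r ≤ c₂ * (R / r) ^ d₂)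
    (hmono : StrictMonoOn φ (Ici 0)) (hφ0 : φ 0 = 0)
    (hinvnonneg : ∀ t : ℝ, 0 ≤ t → 0 ≤ φinv t) (hinvr : ∀ t : ℝ, 0 ≤ t → φ (φinv t) = t)
    {c₃ c₄ α₁ α₂ : ℝ}
    (hscale : ∀ r R : ℝ, 0 < r → r < R →
      c₃ * (R / r) ^ α₁ ≤ φ R / φ r ∧ φ R / φ r ≤ c₄ * (R / r) ^ α₂)
    {p : ℝ → M → M → ℝ} {c₀ a : ℝ} (hc₀ : 0 < c₀) (ha : 0 < a)
    (hNDL : ∀ (t : ℝ) (u v : M), 0 < t → dist u v ≤ c₀ * φinv t → a / V u (φinv t) ≤ p t u v)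
    {κ A : ℝ} (hκ : c₄ * (1 + 1 / c₀) ^ α₂ ≤ κ) (hA : 1 < A) (hκA : 2 * κ ≤ c₃ * A ^ α₁)
    {σ s : ℝ} (hσ : 0 < σ) (hs : 0 < s) (hs₁ : κ * σ ≤ s) (hs₂ : s ≤ 2 * κ * σ)
    {u v : M} (huv : φ (dist u v) ≤ σ) :
    a / (c₂ * A ^ d₂ * V u (φinv σ)) ≤ p s u v := by
  have hr := scale_inv_pos hφ0 hinvnonneg hinvr hσ
  have hdist : dist u v ≤ φinv σ := by
    refine (hmono.le_iff_le (mem_Ici.2 dist_nonneg) hr.le).1 ?_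
    rwa [hinvr σ hσ.le]
  have hlow : (1 + 1 / c₀) * φinv σ ≤ φinv s :=
    mul_scale_inv_le hmono hφ0 hinvnonneg hinvr (fun r R h h' => (hscale r R h h').2)
      (lt_add_of_pos_right _ (by positivity)) hσ
      ((mul_le_mul_of_nonneg_right hκ hσ.le).trans hs₁) hs.le
  have hupp : φinv s ≤ A * φinv σ :=
    scale_inv_le_mul hmono hφ0 hinvnonneg hinvr (fun r R h h' => (hscale r R h h').1) hA hσ
      (hs₂.trans (mul_le_mul_of_nonneg_right hκA hσ.le)) hs.le
  have hnear : dist u v ≤ c₀ * φinv s := by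
    have h := mul_le_mul_of_nonneg_left hlow hc₀.le
    have h' : c₀ * ((1 + 1 / c₀) * φinv σ) = c₀ * φinv σ + φinv σ := by field_simp
    nlinarith [mul_pos hc₀ hr]
  refine le_trans ?_ (hNDL s u v hs hnear)
  have hvol := hVscale u (φinv σ) (A * φinv σ) hr (lt_mul_of_one_lt_left hr hA)
  rw [mul_div_cancel_right₀ _ hr.ne', div_le_iff₀ (hVpos u _ hr)] at hvol
  exact div_le_div_of_nonneg_left ha.le
    (hVpos u _ (scale_inv_pos hφ0 hinvnonneg hinvr hs)) ((hVmono u hupp).trans hvol)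

end ScaleFunction

/-- A lower bound on a subordinated kernel from a lower bound of the kernel on `[κσ, 2κσ]`,
where `σ = t ^ (1 / γ)`. -/
theorem subQ2_lower {M : Type*} {π : ℝ → ℝ → ℝ} {γ C₂ : ℝ} (hγ0 : 0 < γ) (hC₂ : 0 < C₂)
    (hπlb : ∀ t s : ℝ, 0 < t → 0 < s → t ^ (1 / γ) ≤ s → C₂ * t / s ^ (1 + γ) ≤ π t s)
    {p1 p2 : ℝ → M → M → ℝ} {x y : M × M} {κ t m : ℝ} (hκ : 1 ≤ κ) (ht : 0 < t) (hm : 0 ≤ m)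
    (hp : ∀ s, κ * t ^ (1 / γ) ≤ s → s ≤ 2 * κ * t ^ (1 / γ) →
      m ≤ p1 s x.1 y.1 * p2 s x.2 y.2) :
    ENNReal.ofReal (C₂ * κ / (2 * κ) ^ (1 + γ) * m) ≤ subQ2 π p1 p2 t x y := by
  set σ := t ^ (1 / γ) with hσdef
  have hσ : 0 < σ := Real.rpow_pos_of_pos ht _
  have hκ0 : 0 < κ := one_pos.trans_le hκ
  have hσγ : σ ^ γ = t := by
    rw [hσdef, ← Real.rpow_mul ht.le, one_div_mul_cancel hγ0.ne', Real.rpow_one]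
  have hpoint : ∀ s ∈ Icc (κ * σ) (2 * κ * σ),
      C₂ / ((2 * κ) ^ (1 + γ) * σ) * m ≤ p1 s x.1 y.1 * p2 s x.2 y.2 * π t s := by
    rintro s ⟨hs₁, hs₂⟩
    have hs : 0 < s := (mul_pos hκ0 hσ).trans_le hs₁
    have hπ := hπlb t s ht hs ((le_mul_of_one_le_left hσ.le hκ).trans hs₁)
    have hpow : s ^ (1 + γ) ≤ (2 * κ) ^ (1 + γ) * (σ * t) := by
      calc s ^ (1 + γ) ≤ (2 * κ * σ) ^ (1 + γ) := by gcongr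
        _ = (2 * κ) ^ (1 + γ) * (σ * t) := by
          rw [Real.mul_rpow (by positivity) hσ.le, Real.rpow_add hσ, Real.rpow_one, hσγ]
    have hlow : C₂ / ((2 * κ) ^ (1 + γ) * σ) ≤ π t s := by
      refine le_trans ?_ hπ
      calc C₂ / ((2 * κ) ^ (1 + γ) * σ) = C₂ * t / ((2 * κ) ^ (1 + γ) * (σ * t)) := by
            field_simp
        _ ≤ C₂ * t / s ^ (1 + γ) := by gcongr
    rw [mul_comm]
    exact mul_le_mul (hp s hs₁ hs₂) hlow (by positivity) (hm.trans (hp s hs₁ hs₂))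
  have hsub : Icc (κ * σ) (2 * κ * σ) ⊆ Ioi 0 := fun s hs => (mul_pos hκ0 hσ).trans_le hs.1
  calc ENNReal.ofReal (C₂ * κ / (2 * κ) ^ (1 + γ) * m)
      = ∫⁻ _ in Icc (κ * σ) (2 * κ * σ),
          ENNReal.ofReal (C₂ / ((2 * κ) ^ (1 + γ) * σ) * m) := by
        rw [setLIntegral_const, Real.volume_Icc, ← ENNReal.ofReal_mul (by positivity)]
        congr 1
        field_simp
        ring
    _ ≤ ∫⁻ s in Icc (κ * σ) (2 * κ * σ),
          ENNReal.ofReal (p1 s x.1 y.1 * p2 s x.2 y.2 * π t s) :=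
        setLIntegral_mono' measurableSet_Icc fun s hs => ENNReal.ofReal_le_ofReal (hpoint s hs)
    _ ≤ subQ2 π p1 p2 t x y := lintegral_mono_set hsub

theorem prod_green_lower
    {M : Type*} [MetricSpace M] [MeasurableSpace M] [BorelSpace M]
    (μ : Measure M) (V : M → ℝ → ℝ)
    (hV : ∀ x r, V x r = (μ (Metric.ball x r)).toReal)
    (hVpos : ∀ (x : M) (r : ℝ), 0 < r → 0 < μ (Metric.ball x r) ∧ μ (Metric.ball x r) < ⊤)
    (c₁ c₂ d₁ d₂ : ℝ) (hc₁ : 0 < c₁) (hc₂ : 0 < c₂) (hd₁ : 0 < d₁) (hd₁₂ : d₁ ≤ d₂)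
    (hVscale : ∀ (x : M) (r R : ℝ), 0 < r → r < R →
      c₁ * (R / r) ^ d₁ ≤ V x R / V x r ∧ V x R / V x r ≤ c₂ * (R / r) ^ d₂)
    (φ₁ φ₂ : ℝ → ℝ)
    (hφ₁mono : StrictMonoOn φ₁ (Ici 0)) (hφ₂mono : StrictMonoOn φ₂ (Ici 0))
    (hφ₁nonneg : ∀ r : ℝ, 0 ≤ r → 0 ≤ φ₁ r) (hφ₂nonneg : ∀ r : ℝ, 0 ≤ r → 0 ≤ φ₂ r)
    (hφ₁0 : φ₁ 0 = 0) (hφ₂0 : φ₂ 0 = 0) (hφ₁1 : φ₁ 1 = 1) (hφ₂1 : φ₂ 1 = 1)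
    (c₃ c₄ α₁ α₂ : ℝ) (hc₃ : 0 < c₃) (hc₄ : 0 < c₄) (hα₁ : 0 < α₁) (hα₁₂ : α₁ ≤ α₂)
    (hφ₁scale : ∀ r R : ℝ, 0 < r → r < R →
      c₃ * (R / r) ^ α₁ ≤ φ₁ R / φ₁ r ∧ φ₁ R / φ₁ r ≤ c₄ * (R / r) ^ α₂)
    (hφ₂scale : ∀ r R : ℝ, 0 < r → r < R →
      c₃ * (R / r) ^ α₁ ≤ φ₂ R / φ₂ r ∧ φ₂ R / φ₂ r ≤ c₄ * (R / r) ^ α₂)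
    (φ₁inv φ₂inv : ℝ → ℝ)
    (hφ₁invnonneg : ∀ t : ℝ, 0 ≤ t → 0 ≤ φ₁inv t) (hφ₂invnonneg : ∀ t : ℝ, 0 ≤ t → 0 ≤ φ₂inv t)
    (hφ₁invl : ∀ r : ℝ, 0 ≤ r → φ₁inv (φ₁ r) = r) (hφ₂invl : ∀ r : ℝ, 0 ≤ r → φ₂inv (φ₂ r) = r)
    (hφ₁invr : ∀ t : ℝ, 0 ≤ t → φ₁ (φ₁inv t) = t) (hφ₂invr : ∀ t : ℝ, 0 ≤ t → φ₂ (φ₂inv t) = t)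
    (γ : ℝ) (hγ0 : 0 < γ) (hγ1 : γ < 1)
    (π : ℝ → ℝ → ℝ) (hπmeas : Measurable (Function.uncurry π))
    (hπnonneg : ∀ t s : ℝ, 0 ≤ π t s)
    (C₁ C₂ : ℝ) (hC₁ : 0 < C₁) (hC₂ : 0 < C₂)
    (hπub : ∀ t s : ℝ, 0 < t → 0 < s → π t s ≤ C₁ * t / s ^ (1 + γ) * Real.exp (-t / s ^ γ))
    (hπlb : ∀ t s : ℝ, 0 < t → 0 < s → t ^ (1 / γ) ≤ s → C₂ * t / s ^ (1 + γ) ≤ π t s)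
    (p1 p2 : ℝ → M → M → ℝ)
    (hp1meas : Measurable (fun z : ℝ × M × M => p1 z.1 z.2.1 z.2.2))
    (hp2meas : Measurable (fun z : ℝ × M × M => p2 z.1 z.2.1 z.2.2))
    (hp1nonneg : ∀ (t : ℝ) (x y : M), 0 ≤ p1 t x y)
    (hp2nonneg : ∀ (t : ℝ) (x y : M), 0 ≤ p2 t x y)
    (c₀ a : ℝ) (hc₀ : 0 < c₀) (ha : 0 < a)
    (hNDL1 : ∀ (t : ℝ) (u v : M), 0 < t → dist u v ≤ c₀ * φ₁inv t →
      a / V u (φ₁inv t) ≤ p1 t u v)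
    (hNDL2 : ∀ (t : ℝ) (u v : M), 0 < t → dist u v ≤ c₀ * φ₂inv t →
      a / V u (φ₂inv t) ≤ p2 t u v) :
    ∃ b : ℝ, 0 < b ∧ ∀ x y : M × M,
      ENNReal.ofReal b *
        (∫⁻ t in Ioi ((phid φ₁ φ₂ x y) ^ γ),
          ENNReal.ofReal (1 /
            (V x.1 (φ₁inv (t ^ (1 / γ))) * V x.2 (φ₂inv (t ^ (1 / γ)))))) ≤
      green2 π p1 p2 x y := by
  have hVp : ∀ x r, 0 < r → 0 < V x r := fun x r hr => by
    rw [hV]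
    exact ENNReal.toReal_pos (hVpos x r hr).1.ne' (hVpos x r hr).2.ne
  have hVmono : ∀ x, Monotone (V x) := fun x r R hrR => by
    rw [hV, hV]
    rcases le_or_gt R 0 with hR | hR
    · simp [Metric.ball_eq_empty.2 hR, Metric.ball_eq_empty.2 (hrR.trans hR)]
    · exact ENNReal.toReal_mono (hVpos x R hR).2.ne (measure_mono (Metric.ball_subset_ball hrR))
  have hVup : ∀ x r R, 0 < r → r < R → V x R / V x r ≤ c₂ * (R / r) ^ d₂ :=
    fun x r R h h' => (hVscale x r R h h').2
  obtain ⟨κ, hκ1, hκ⟩ : ∃ κ : ℝ, 1 ≤ κ ∧ c₄ * (1 + 1 / c₀) ^ α₂ ≤ κ :=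
    ⟨max 1 _, le_max_left _ _, le_max_right _ _⟩
  obtain ⟨A, hA, hκA⟩ : ∃ A : ℝ, 1 < A ∧ 2 * κ ≤ c₃ * A ^ α₁ := by
    obtain ⟨A, hA, hA'⟩ := ((Filter.eventually_gt_atTop 1).and
      (((tendsto_rpow_atTop hα₁).const_mul_atTop hc₃).eventually_ge_atTop (2 * κ))).exists
    exact ⟨A, hA, hA'⟩
  have hA0 : 0 < A := one_pos.trans hA
  have hκ0 : 0 < κ := one_pos.trans_le hκ1
  refine ⟨C₂ * κ / (2 * κ) ^ (1 + γ) * (a / (c₂ * A ^ d₂)) ^ 2, by positivity, fun x y => ?_⟩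
  have hD : 0 ≤ phid φ₁ φ₂ x y := le_max_of_le_left (hφ₁nonneg _ dist_nonneg)
  rw [← lintegral_const_mul' _ _ ENNReal.ofReal_ne_top]
  refine le_trans (setLIntegral_mono' measurableSet_Ioi fun t ht => ?_)
    (lintegral_mono_set (Ioi_subset_Ioi (Real.rpow_nonneg hD γ)))
  have ht0 : 0 < t := (Real.rpow_nonneg hD γ).trans_lt ht
  have hσ : 0 < t ^ (1 / γ) := Real.rpow_pos_of_pos ht0 _
  have hDσ : phid φ₁ φ₂ x y ≤ t ^ (1 / γ) := by
    rw [one_div]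
    exact (Real.le_rpow_inv_iff_of_pos hD ht0.le hγ0).2 (le_of_lt ht)
  have hV₁ := hVp x.1 _ (scale_inv_pos hφ₁0 hφ₁invnonneg hφ₁invr hσ)
  have hV₂ := hVp x.2 _ (scale_inv_pos hφ₂0 hφ₂invnonneg hφ₂invr hσ)
  have hq := subQ2_lower (p1 := p1) (p2 := p2) (x := x) (y := y)
    (m := a / (c₂ * A ^ d₂ * V x.1 (φ₁inv (t ^ (1 / γ)))) *
      (a / (c₂ * A ^ d₂ * V x.2 (φ₂inv (t ^ (1 / γ))))))
    hγ0 hC₂ hπlb hκ1 ht0 (by positivity) fun s hs₁ hs₂ => by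
      have hs : 0 < s := (mul_pos hκ0 hσ).trans_le hs₁
      exact mul_le_mul
        (kernel_lower_of_near_diagonal hVp hVmono hVup hφ₁mono hφ₁0 hφ₁invnonneg hφ₁invr
          hφ₁scale hc₀ ha hNDL1 hκ hA hκA hσ hs hs₁ hs₂ ((le_max_left _ _).trans hDσ))
        (kernel_lower_of_near_diagonal hVp hVmono hVup hφ₂mono hφ₂0 hφ₂invnonneg hφ₂invr
          hφ₂scale hc₀ ha hNDL2 hκ hA hκA hσ hs hs₁ hs₂ ((le_max_right _ _).trans hDσ))
        (by positivity) (hp1nonneg _ _ _)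
  refine le_of_eq_of_le ?_ hq
  rw [← ENNReal.ofReal_mul (by positivity)]
  congr 1
  field_simp
end

section
/- Let ν be a Borel measure on M, F a Borel subset of M and c > 0 a constant such that limsup_{r→0} ν(B(x,r))/φ(r) ≤ c for every x ∈ F. Then ν(F) ≤ c · H^φ(F). -/
open MeasureTheory Set

theorem measure_le_mul_mkMetric {X : Type*} [EMetricSpace X] [MeasurableSpace X] [BorelSpace X]
    (μ : Measure X) (m : ENNReal → ENNReal) {S : Set X} {K ε : ENNReal} (hK : K ≠ 0) (hK' : K ≠ ⊤)
    (hε : 0 < ε)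
    (h : ∀ U : Set X, Metric.ediam U ≤ ε → (S ∩ U).Nonempty →
      μ (S ∩ U) ≤ K * m (Metric.ediam U)) :
    μ S ≤ K * Measure.mkMetric m S := by
  rw [mul_comm, ← ENNReal.div_le_iff hK hK', Measure.mkMetric_apply]
  refine le_iSup₂_of_le ε hε (le_iInf fun t ↦ le_iInf₂ fun hSt hd ↦ ?_)
  rw [ENNReal.div_le_iff hK hK', mul_comm, ← ENNReal.tsum_mul_left]
  calc μ S ≤ μ (⋃ n, S ∩ t n) := measure_mono (by rw [← inter_iUnion]; exact subset_inter le_rfl hSt)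
    _ ≤ ∑' n, μ (S ∩ t n) := measure_iUnion_le _
    _ ≤ _ := ENNReal.tsum_le_tsum fun n ↦ by
      rcases (S ∩ t n).eq_empty_or_nonempty with he | hne
      · simp [he]
      · exact (h _ (hd n) hne).trans
          (mul_le_mul_right (le_iSup_of_le (hne.mono inter_subset_right) le_rfl) K)

theorem measure_le_mul_of_closedBall_le {X : Type*} [MetricSpace X] [MeasurableSpace X]
    (μ : Measure X) {φ : ℝ → ℝ} (hcont : ContinuousOn φ (Ici 0)) {K : ENNReal} (hK : K ≠ ⊤)
    {δ : ℝ} {x : X}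
    (hx : ∀ r, 0 < r → r < δ → μ (Metric.closedBall x r) ≤ K * ENNReal.ofReal (φ r))
    {U : Set X} (hxU : x ∈ U) (hU : Metric.ediam U < ENNReal.ofReal δ) :
    μ U ≤ K * ENNReal.ofReal (φ (Metric.ediam U).toReal) := by
  have hfin : Metric.ediam U ≠ ⊤ := (hU.trans ENNReal.ofReal_lt_top).ne
  set d := (Metric.ediam U).toReal with hd
  have hdδ : d < δ := (ENNReal.lt_ofReal_iff_toReal_lt hfin).1 hU
  have hd0 : 0 ≤ d := ENNReal.toReal_nonneg
  have hsub : U ⊆ Metric.closedBall x d := fun y hy ↦ by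
    rw [Metric.mem_closedBall, dist_edist]
    exact ENNReal.toReal_mono hfin (Metric.edist_le_ediam_of_mem hy hxU)
  have hlim : Filter.Tendsto (fun r ↦ K * ENNReal.ofReal (φ r)) (nhdsWithin d (Ioi d))
      (nhds (K * ENNReal.ofReal (φ d))) :=
    ENNReal.Tendsto.const_mul (ENNReal.tendsto_ofReal
      ((hcont d hd0).mono_left (nhdsWithin_mono d fun r hr ↦ hd0.trans (le_of_lt hr)))) (.inr hK)
  refine ge_of_tendsto hlim ?_
  filter_upwards [Ioo_mem_nhdsGT hdδ] with r hr
  exact (measure_mono (hsub.trans (Metric.closedBall_subset_closedBall hr.1.le))).trans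
    (hx r (hd0.trans_lt hr.1) hr.2)

theorem hausdorff_upper_density_bound
    {M : Type*} [MetricSpace M] [CompleteSpace M] [TopologicalSpace.SeparableSpace M]
    [MeasurableSpace M] [BorelSpace M]
    (φ : ℝ → ℝ)
    (hφcont : ContinuousOn φ (Ici 0))
    (hφmono : MonotoneOn φ (Ici 0))
    (hφpos : ∀ t : ℝ, 0 < t → 0 < φ t)
    (hφ0 : φ 0 = 0)
    (hfo : ∃ η : ℝ, 0 < η ∧ ∃ δ : ℝ, 0 < δ ∧ ∀ t : ℝ, 0 < t → t < δ → φ (3 * t) ≤ η * φ t)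
    (Hφ : Measure M)
    (hHφ : Hφ = MeasureTheory.Measure.mkMetric (fun r : ENNReal => ENNReal.ofReal (φ r.toReal)))
    (ν : Measure M) (F : Set M) (hF : MeasurableSet F)
    (c : ℝ) (hc : 0 < c)
    (hlim : ∀ x ∈ F,
      Filter.limsup (fun r : ℝ => ν (Metric.closedBall x r) / ENNReal.ofReal (φ r))
        (nhdsWithin 0 (Ioi (0:ℝ))) ≤ ENNReal.ofReal c) :
    ν F ≤ ENNReal.ofReal c * Hφ F := by
  subst hHφ
  refine ENNReal.le_mul_of_forall_lt (.inl (by simpa using hc)) (.inl ENNReal.ofReal_ne_top)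
    fun K hK b hb ↦ ?_
  rcases eq_or_ne K ⊤ with rfl | hK'
  · rw [ENNReal.top_mul (pos_of_gt hb).ne']
    exact le_top
  refine le_trans ?_ (mul_le_mul_right hb.le K)
  let S : ℕ → Set M := fun n ↦ {x ∈ F | ∀ r : ℝ, 0 < r → r < 1 / ((n : ℝ) + 1) →
    ν (Metric.closedBall x r) ≤ K * ENNReal.ofReal (φ r)}
  have hmono : Monotone S := fun n k hnk x hx ↦
    ⟨hx.1, fun r hr hrk ↦ hx.2 r hr (hrk.trans_le (Nat.one_div_le_one_div hnk))⟩
  have hFS : F ⊆ ⋃ n, S n := fun x hx ↦ by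
    have hev := Filter.eventually_lt_of_limsup_lt ((hlim x hx).trans_lt hK)
    obtain ⟨δ, hδ, hδ'⟩ := mem_nhdsGT_iff_exists_Ioo_subset.1 hev
    obtain ⟨n, hn⟩ := exists_nat_one_div_lt (show (0 : ℝ) < δ from hδ)
    refine mem_iUnion.2 ⟨n, hx, fun r hr hrn ↦ ?_⟩
    have hle : ν (Metric.closedBall x r) / ENNReal.ofReal (φ r) ≤ K :=
      le_of_lt (hδ' ⟨hr, hrn.trans hn⟩)
    exact (ENNReal.div_le_iff (by simpa using hφpos r hr) ENNReal.ofReal_ne_top).1 hle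
  refine (measure_mono hFS).trans ?_
  rw [hmono.measure_iUnion]
  refine iSup_le fun n ↦ ?_
  have hn : (0 : ℝ) < 1 / ((n : ℝ) + 1) := Nat.one_div_pos_of_nat
  refine le_trans ?_ (mul_le_mul_right (measure_mono (sep_subset F _ : S n ⊆ F)) K)
  refine measure_le_mul_mkMetric ν _ (pos_of_gt hK).ne' hK'
    (ε := ENNReal.ofReal (1 / ((n : ℝ) + 1) / 2)) (by simpa using half_pos hn) ?_
  rintro U hU ⟨x, hxS, hxU⟩
  exact (measure_mono inter_subset_right).trans <|
    measure_le_mul_of_closedBall_le ν hφcont hK' hxS.2 hxU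
      (hU.trans_lt ((ENNReal.ofReal_lt_ofReal_iff hn).2 (half_lt_self hn)))
end

section
/- Let F be a Borel subset of M. If there exists a finite and nontrivial Borel measure ν on M such that ν is supported in F (i.e. ν(M ∖ F) = 0, 0 < ν(M) < ∞) and the φ-energy I^φ(ν) = ∬_{M×M} φ(d(x,y))^{-1} dν(x) dν(y) is finite, then H^φ(F) = ∞. -/
open MeasureTheory Set

open Filter Topology ENNReal in
/-- If the potential `∫ k(x, y) dν(y)` is finite at `x` and `k` is infinite at `(x, x)`, then the
contribution of shrinking closed balls around `x` to the potential tends to `0`. -/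
theorem tendsto_setLIntegral_closedBall_zero {M : Type*} [MetricSpace M] [MeasurableSpace M]
    [BorelSpace M] (ν : Measure M) [IsFiniteMeasure ν] (f : M → ℝ≥0∞) (x : M)
    (hx : f x = ⊤) (hf : ∫⁻ y, f y ∂ν ≠ ⊤) :
    Tendsto (fun n : ℕ => ∫⁻ y in Metric.closedBall x (1 / ((n : ℝ) + 1)), f y ∂ν) atTop
      (𝓝 0) := by
  have hatom : ν {x} = 0 := by
    by_contra h
    apply hf
    rw [eq_top_iff]
    calc (⊤ : ℝ≥0∞) = ∫⁻ y in {x}, f y ∂ν := by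
          rw [setLIntegral_congr_fun (measurableSet_singleton x)
            (g := fun _ => (⊤ : ℝ≥0∞)) (by rintro y rfl; exact hx)]
          rw [setLIntegral_const, ENNReal.top_mul h]
      _ ≤ ∫⁻ y, f y ∂ν := setLIntegral_le_lintegral _ _
  refine tendsto_setLIntegral_zero hf ?_
  have hinter : ⋂ n : ℕ, Metric.closedBall x (1 / ((n : ℝ) + 1)) = {x} := by
    ext y
    simp only [mem_iInter, Metric.mem_closedBall, mem_singleton_iff]
    constructor
    · intro h
      exact dist_le_zero.1 (ge_of_tendsto' tendsto_one_div_add_atTop_nhds_zero_nat h)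
    · rintro rfl n
      rw [dist_self]
      positivity
  rw [← hatom, ← hinter]
  refine tendsto_measure_iInter_atTop
    (fun n => Metric.isClosed_closedBall.measurableSet.nullMeasurableSet) ?_
    ⟨0, measure_ne_top _ _⟩
  intro m n hmn
  exact Metric.closedBall_subset_closedBall (Nat.one_div_le_one_div hmn)

open ENNReal in
/-- Mass distribution estimate: if the part of the `φ`-potential of `ν` coming from the ball of
radius `δ` is at most `ε` on `A`, then `ν (A ∩ F) ≤ ε H^φ(F)`. -/
theorem measure_inter_le_mul_mkMetric {M : Type*} [MetricSpace M] [MeasurableSpace M]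
    [BorelSpace M] (φ : ℝ → ℝ) (hφmono : MonotoneOn φ (Ici 0)) (ν : Measure M)
    (A F : Set M) {δ : ℝ} (hδ : 0 < δ) {ε : ℝ≥0∞} (hε0 : ε ≠ 0) (hε : ε ≠ ⊤)
    (hA : ∀ x ∈ A, ∫⁻ y in Metric.closedBall x δ, (ENNReal.ofReal (φ (dist x y)))⁻¹ ∂ν ≤ ε) :
    ν (A ∩ F) ≤
      ε * Measure.mkMetric (fun r : ℝ≥0∞ => ENNReal.ofReal (φ r.toReal)) F := by
  rw [Measure.mkMetric_apply, mul_comm, ← ENNReal.div_le_iff hε0 hε]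
  refine le_iSup₂_of_le (ENNReal.ofReal δ) (ENNReal.ofReal_pos.2 hδ) ?_
  refine le_iInf fun t => le_iInf fun htF => le_iInf fun htδ => ?_
  rw [ENNReal.div_le_iff hε0 hε, ← ENNReal.tsum_mul_right]
  calc ν (A ∩ F) ≤ ν (⋃ n, A ∩ t n) := by
        rw [← inter_iUnion]
        exact measure_mono (inter_subset_inter_right A htF)
    _ ≤ ∑' n, ν (A ∩ t n) := measure_iUnion_le _
    _ ≤ _ := ENNReal.tsum_le_tsum fun n => ?_
  rcases (A ∩ t n).eq_empty_or_nonempty with h | ⟨x, hxA, hxt⟩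
  · simp [h]
  have hne : (t n).Nonempty := ⟨x, hxt⟩
  simp only [hne, iSup_pos]
  set r := (Metric.ediam (t n)).toReal with hr
  have hfin : Metric.ediam (t n) ≠ ⊤ := ne_top_of_le_ne_top ofReal_ne_top (htδ n)
  have hrδ : r ≤ δ := ENNReal.toReal_le_of_le_ofReal hδ.le (htδ n)
  have hsub : t n ⊆ Metric.closedBall x r := by
    intro y hy
    rw [Metric.mem_closedBall, dist_edist]
    exact ENNReal.toReal_mono hfin (Metric.edist_le_ediam_of_mem hy hxt)
  rw [mul_comm, ← ENNReal.div_le_iff_le_mul (Or.inr hε) (Or.inl ofReal_ne_top),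
    ENNReal.div_eq_inv_mul]
  calc (ENNReal.ofReal (φ r))⁻¹ * ν (A ∩ t n)
      ≤ (ENNReal.ofReal (φ r))⁻¹ * ν (Metric.closedBall x r) := by
        gcongr
        exact inter_subset_right.trans hsub
    _ = ∫⁻ _ in Metric.closedBall x r, (ENNReal.ofReal (φ r))⁻¹ ∂ν :=
        (setLIntegral_const _ _).symm
    _ ≤ ∫⁻ y in Metric.closedBall x r, (ENNReal.ofReal (φ (dist x y)))⁻¹ ∂ν := by
        refine setLIntegral_mono' Metric.isClosed_closedBall.measurableSet fun y hy => ?_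
        rw [Metric.mem_closedBall, dist_comm] at hy
        exact ENNReal.inv_le_inv.2 (ENNReal.ofReal_le_ofReal
          (hφmono dist_nonneg (mem_Ici.2 toReal_nonneg) hy))
    _ ≤ ∫⁻ y in Metric.closedBall x δ, (ENNReal.ofReal (φ (dist x y)))⁻¹ ∂ν :=
        lintegral_mono_set (Metric.closedBall_subset_closedBall hrδ)
    _ ≤ ε := hA x hxA

theorem finite_energy_implies_infinite_hausdorff
    {M : Type*} [MetricSpace M] [CompleteSpace M] [TopologicalSpace.SeparableSpace M]
    [MeasurableSpace M] [BorelSpace M]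
    (φ : ℝ → ℝ)
    (hφcont : ContinuousOn φ (Ici 0))
    (hφmono : MonotoneOn φ (Ici 0))
    (hφpos : ∀ t : ℝ, 0 < t → 0 < φ t)
    (hφ0 : φ 0 = 0)
    (hfo : ∃ η : ℝ, 0 < η ∧ ∃ δ : ℝ, 0 < δ ∧ ∀ t : ℝ, 0 < t → t < δ → φ (3 * t) ≤ η * φ t)
    (Hφ : Measure M)
    (hHφ : Hφ = MeasureTheory.Measure.mkMetric (fun r : ENNReal => ENNReal.ofReal (φ r.toReal)))
    (F : Set M) (hF : MeasurableSet F)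
    (ν : Measure M)
    (hνsupp : ν Fᶜ = 0) (hν0 : 0 < ν univ) (hνfin : ν univ < ⊤)
    (henergy : (∫⁻ x, (∫⁻ y, (ENNReal.ofReal (φ (dist x y)))⁻¹ ∂ν) ∂ν) < ⊤) :
    Hφ F = ⊤ := by
  subst hHφ
  have : IsFiniteMeasure ν := ⟨hνfin⟩
  have : SecondCountableTopology M := UniformSpace.secondCountable_of_separable M
  have hcont : Continuous fun p : M × M => φ (dist p.1 p.2) :=
    hφcont.comp_continuous continuous_dist fun p => mem_Ici.2 dist_nonneg
  have hmeas : Measurable fun x => ∫⁻ y, (ENNReal.ofReal (φ (dist x y)))⁻¹ ∂ν :=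
    Measurable.lintegral_prod_right' (f := fun p : M × M => (ENNReal.ofReal (φ (dist p.1 p.2)))⁻¹)
      hcont.measurable.ennreal_ofReal.inv
  have hae := ae_lt_top hmeas henergy.ne
  have key : ∀ ε : ENNReal, ε ≠ 0 → ε ≠ ⊤ → ν univ ≤
      ε * Measure.mkMetric (fun r : ENNReal => ENNReal.ofReal (φ r.toReal)) F := by
    intro ε hε0 hε
    let A : ℕ → Set M := fun n => {x | ∫⁻ y in Metric.closedBall x (1 / ((n : ℝ) + 1)),
      (ENNReal.ofReal (φ (dist x y)))⁻¹ ∂ν ≤ ε}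
    have hAmono : Monotone A := fun m n hmn x hx =>
      (lintegral_mono_set (Metric.closedBall_subset_closedBall
        (Nat.one_div_le_one_div hmn))).trans hx
    have hAfull : ν univ = ν (⋃ n, A n) := by
      refine (measure_eq_measure_of_null_sdiff (subset_univ _) ?_).symm
      rw [← compl_eq_univ_sdiff]
      change ∀ᵐ x ∂ν, x ∈ ⋃ n, A n
      filter_upwards [hae] with x hx
      have hlim := tendsto_setLIntegral_closedBall_zero ν
        (fun y => (ENNReal.ofReal (φ (dist x y)))⁻¹) x (by simp [hφ0]) hx.ne
      obtain ⟨n, hn⟩ := (hlim.eventually_le_const (pos_iff_ne_zero.2 hε0)).exists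
      exact mem_iUnion.2 ⟨n, hn⟩
    rw [hAfull, hAmono.measure_iUnion]
    refine iSup_le fun n => ?_
    calc ν (A n) ≤ ν (A n ∩ F) + ν (A n \ F) := measure_le_inter_add_sdiff _ _ _
      _ = ν (A n ∩ F) := by rw [measure_mono_null (sdiff_subset_compl _ _) hνsupp, add_zero]
      _ ≤ _ := measure_inter_le_mul_mkMetric φ hφmono ν (A n) F Nat.one_div_pos_of_nat hε0 hε
        fun x hx => hx
  by_contra hH
  obtain ⟨ε, hε0, hε⟩ := ENNReal.exists_nnreal_pos_mul_lt hH hν0.ne'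
  exact (key ε (by exact_mod_cast hε0.ne') ENNReal.coe_ne_top).not_gt hε
end
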